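/- arXiv:1006.0466 — 3 statements merged into one kernel-verified Lean document; each statement's English description precedes it below -/
import Mathlib

section
/- Let l > 5 be a prime and k an algebraic extension of F_l which contains a primitive cube root of unity. Let K be a number field and let r : Gal(K̄/K) → GL_2(k) be a continuous absolutely irreducible representation (k carrying the discrete topology). Then at least one of the following holds. Either (1) r(Gal(K̄/K(ζ_l))) is a 2-big subgroup of GL_2(k), where K(ζ_l) is the extension of K generated by a primitive l-th root of unity; or (2) there are intermediate fields K ⊆ K_1 ⊆ K_2 ⊆ K̄ with K_1/K either trivial or a cubic (hence cyclic) Galois extension and K_2/K_1 quadratic, together with an extension k' of k of degree at most 2 and a continuous character θ̄ : Gal(K̄/K_2) → (k')^× such that the restriction of r (with coefficients extended to k') to Gal(K̄/K_1) is isomorphic to the induced representation Ind_{Gal(K̄/K_2)}^{Gal(K̄/K_1)} θ̄. -/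
open Matrix Polynomial

/-- The `h`-equivariant projection from `k²` onto the `α`-eigenspace of a `2 × 2` matrix `A`
for which `α` is a simple root of the characteristic polynomial (the other root then being
`trace A - α`): it is the polynomial `(A - β • 1) / (α - β)` in `A`, where `β = trace A - α`. -/
noncomputable def eigProj {k : Type*} [Field k] (A : Matrix (Fin 2) (Fin 2) k) (α : k) :
    Matrix (Fin 2) (Fin 2) k :=
  (α - (A.trace - α))⁻¹ • (A - (A.trace - α) • (1 : Matrix (Fin 2) (Fin 2) k))

/-- A subgroup `H` of `GL 2 k` is `m`-big: (i) `H` has no quotient of `l`-power order;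
(ii) `H⁰(H, 𝔰𝔩₂(k)) = 0`; (iii) `H¹(H, 𝔰𝔩₂(k)) = 0` (every conjugation 1-cocycle valued in
trace-zero matrices is a coboundary); (iv) for every irreducible `k[H]`-submodule `W` of
`𝔤𝔩₂(k)` there are `h ∈ H` and `α ∈ k` with `α` a simple root of the characteristic
polynomial of `h`, `α^m ≠ β^m` for every other root `β`, and `π_{h,α} ∘ w ∘ i_{h,α} ≠ 0`
for some `w ∈ W`. -/
def IsMBig (l m : ℕ) {k : Type*} [Field k] (H : Subgroup (GL (Fin 2) k)) : Prop :=
  (∀ N : Subgroup H, N.Normal → ∀ j : ℕ, Nat.card (H ⧸ N) ≠ l ^ (j + 1)) ∧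
  (∀ X : Matrix (Fin 2) (Fin 2) k, X.trace = 0 →
    (∀ h : H, (h : GL (Fin 2) k).val * X = X * (h : GL (Fin 2) k).val) → X = 0) ∧
  (∀ c : H → Matrix (Fin 2) (Fin 2) k,
    (∀ g : H, (c g).trace = 0) →
    (∀ g h : H, c (g * h) =
      c g + (g : GL (Fin 2) k).val * c h * ((g : GL (Fin 2) k)⁻¹).val) →
    ∃ X : Matrix (Fin 2) (Fin 2) k, X.trace = 0 ∧
      ∀ g : H, c g = (g : GL (Fin 2) k).val * X * ((g : GL (Fin 2) k)⁻¹).val - X) ∧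
  (∀ W : Submodule k (Matrix (Fin 2) (Fin 2) k),
    (∀ w ∈ W, ∀ h : H, (h : GL (Fin 2) k).val * w * ((h : GL (Fin 2) k)⁻¹).val ∈ W) →
    W ≠ ⊥ →
    (∀ W' : Submodule k (Matrix (Fin 2) (Fin 2) k), W' ≤ W →
      (∀ w ∈ W', ∀ h : H, (h : GL (Fin 2) k).val * w * ((h : GL (Fin 2) k)⁻¹).val ∈ W') →
      W' = ⊥ ∨ W' = W) →
    ∃ h : H, ∃ α : k,
      (h : GL (Fin 2) k).val.charpoly.rootMultiplicity α = 1 ∧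
      (∀ β : k, (h : GL (Fin 2) k).val.charpoly.IsRoot β → β ≠ α → α ^ m ≠ β ^ m) ∧
      ∃ w ∈ W, eigProj (h : GL (Fin 2) k).val α * w * eigProj (h : GL (Fin 2) k).val α ≠ 0)



section Counting
set_option linter.unusedSectionVars false
open MulAction

variable {Γ X : Type*} [Group Γ] [Finite Γ] [MulAction Γ X]

/-- weight of a point: (order of stabilizer minus one) plus number of elements
fixing only this point -/
noncomputable def ptE (Γ : Type*) {X : Type*} [Group Γ] [MulAction Γ X] (x : X) : ℕ :=
  Nat.card {γ : Γ // γ ≠ 1 ∧ γ • x = x}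

noncomputable def ptP (Γ : Type*) {X : Type*} [Group Γ] [MulAction Γ X] (x : X) : ℕ :=
  Nat.card {γ : Γ // γ ≠ 1 ∧ fixedBy X γ = {x}}

lemma ptE_add_one (x : X) : ptE Γ x + 1 = Nat.card (stabilizer Γ x) := by
  classical
  have := Fintype.ofFinite Γ
  rw [ptE, Nat.card_eq_fintype_card, Nat.card_eq_fintype_card, Fintype.card_subtype,
    Fintype.card_subtype]
  have : (Finset.univ.filter fun γ : Γ => γ ∈ stabilizer Γ x) =
      insert 1 (Finset.univ.filter fun γ : Γ => γ ≠ 1 ∧ γ • x = x) := by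
    ext γ
    by_cases h : γ = 1 <;> simp [h]
  rw [this, Finset.card_insert_of_notMem (by simp)]

lemma fixedBy_conj' (g γ : Γ) (x : X) : fixedBy X (g * γ * g⁻¹) = {g • x} ↔ fixedBy X γ = {x} := by
  simp only [Set.ext_iff, mem_fixedBy, Set.mem_singleton_iff, mul_smul]
  constructor
  · intro h y
    have := h (g • y)
    simpa [smul_eq_iff_eq_inv_smul] using this
  · intro h y
    have := h (g⁻¹ • y)
    rw [inv_smul_eq_iff] at this
    rw [← this, ← smul_eq_iff_eq_inv_smul]

lemma ptE_smul (g : Γ) (x : X) : ptE Γ (g • x) = ptE Γ x := by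
  symm
  refine Nat.card_congr (Equiv.subtypeEquiv (MulAut.conj g).toEquiv fun γ => ?_)
  simp [mul_smul]

lemma ptP_smul (g : Γ) (x : X) : ptP Γ (g • x) = ptP Γ x := by
  symm
  refine Nat.card_congr (Equiv.subtypeEquiv (MulAut.conj g).toEquiv fun γ => ?_)
  simp only [MulEquiv.toEquiv_eq_coe, EquivLike.coe_coe, MulAut.conj_apply, fixedBy_conj']
  simp

lemma sum_points (hfix : ∀ γ : Γ, γ ≠ 1 → (fixedBy X γ).ncard = 1 ∨ (fixedBy X γ).ncard = 2) :
    ∃ S : Finset X, (∀ x, x ∈ S ↔ ptE Γ x ≠ 0) ∧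
      ∑ x ∈ S, (ptE Γ x + ptP Γ x) + 2 = 2 * Nat.card Γ := by
  classical
  have := Fintype.ofFinite Γ
  have hfin : ∀ γ : Γ, γ ≠ 1 → (fixedBy X γ).Finite := fun γ h => by
    apply Set.finite_of_ncard_ne_zero
    rcases hfix γ h with h | h <;> omega
  let A : Finset Γ := Finset.univ.filter (· ≠ 1)
  let S : Finset X := A.attach.biUnion fun γ =>
    (hfin γ.1 (Finset.mem_filter.1 γ.2).2).toFinset
  have hS : ∀ x, x ∈ S ↔ ∃ γ : Γ, γ ≠ 1 ∧ γ • x = x := by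
    intro x; simp [S, A]
  have hE : ∀ x : X, ptE Γ x = ∑ γ ∈ A, if γ • x = x then 1 else 0 := by
    intro x
    rw [ptE, Nat.card_eq_fintype_card, Fintype.card_subtype, Finset.sum_ite]
    simp [A, Finset.filter_filter]
  have hP : ∀ x : X, ptP Γ x = ∑ γ ∈ A, if fixedBy X γ = {x} then 1 else 0 := by
    intro x
    rw [ptP, Nat.card_eq_fintype_card, Fintype.card_subtype, Finset.sum_ite]
    simp [A, Finset.filter_filter]
  refine ⟨S, ?_, ?_⟩
  · intro x
    rw [hS, ptE, ← Nat.pos_iff_ne_zero, Nat.card_pos_iff]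
    constructor
    · rintro ⟨γ, h⟩; exact ⟨⟨⟨γ, h⟩⟩, inferInstance⟩
    · rintro ⟨⟨⟨γ, h⟩⟩, _⟩; exact ⟨γ, h⟩
  · have h1 : ∑ x ∈ S, (ptE Γ x + ptP Γ x) = ∑ γ ∈ A, 2 := by
      simp_rw [hE, hP, ← Finset.sum_add_distrib]
      rw [Finset.sum_comm]
      refine Finset.sum_congr rfl fun γ hγ => ?_
      have hγ1 : γ ≠ 1 := by simpa [A] using hγ
      rw [Finset.sum_add_distrib]
      have e1 : ∑ x ∈ S, (if γ • x = x then 1 else 0) = (fixedBy X γ).ncard := by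
        rw [Finset.sum_ite]
        simp only [Finset.sum_const, smul_eq_mul, mul_one, mul_zero, add_zero]
        rw [← Set.ncard_coe_finset]
        congr 1
        ext x
        simp only [Finset.coe_filter, Set.mem_ofPred_eq, hS, mem_fixedBy]
        exact ⟨fun h => h.2, fun h => ⟨⟨γ, hγ1, h⟩, h⟩⟩
      rw [e1]
      rcases hfix γ hγ1 with h | h
      · rw [h]
        obtain ⟨x, hx⟩ := Set.ncard_eq_one.1 h
        have hxS : x ∈ S := (hS x).2 ⟨γ, hγ1, by
          have : x ∈ fixedBy X γ := by rw [hx]; rfl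
          exact this⟩
        rw [hx]
        simp [Set.singleton_eq_singleton_iff, hxS]
      · rw [h]
        have : ∀ x ∈ S, (if fixedBy X γ = {x} then 1 else 0) = 0 := by
          intro x _
          rw [if_neg]
          intro h'
          rw [h'] at h; simp at h
        rw [Finset.sum_congr rfl this]; simp
    rw [h1]
    have : A.card + 1 = Fintype.card Γ := by
      have : A = Finset.univ.erase 1 := by ext; simp [A]
      rw [this, Finset.card_erase_of_mem (Finset.mem_univ _), Finset.card_univ]
      have := Fintype.card_pos (α := Γ)
      omega
    simp only [Finset.sum_const, smul_eq_mul, Nat.card_eq_fintype_card]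
    omega

lemma peel (S : Finset X) (hS : ∀ (γ : Γ) (x : X), x ∈ S → γ • x ∈ S) (x : X) (hx : x ∈ S) :
    ∃ S' : Finset X, S' ⊆ S ∧ (∀ (γ : Γ) (x : X), x ∈ S' → γ • x ∈ S') ∧
      Nat.card Γ + Nat.card (orbit Γ x) * ptP Γ x + ∑ y ∈ S', (ptE Γ y + ptP Γ y) =
      ∑ y ∈ S, (ptE Γ y + ptP Γ y) + Nat.card (orbit Γ x) := by
  classical
  refine ⟨S.filter (· ∉ orbit Γ x), Finset.filter_subset _ _, ?_, ?_⟩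
  · intro γ y hy
    simp only [Finset.mem_filter] at hy ⊢
    refine ⟨hS _ _ hy.1, fun h => hy.2 ?_⟩
    obtain ⟨g, hg⟩ := h
    exact ⟨γ⁻¹ * g, by simp only at hg ⊢; rw [mul_smul, hg, inv_smul_smul]⟩
  · rw [← Finset.sum_filter_add_sum_filter_not S (· ∈ orbit Γ x)]
    have h1 : ∑ y ∈ S.filter (· ∈ orbit Γ x), (ptE Γ y + ptP Γ y) =
        Nat.card (orbit Γ x) * (ptE Γ x + ptP Γ x) := by
      rw [Finset.sum_congr rfl (g := fun _ => ptE Γ x + ptP Γ x)]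
      · rw [Finset.sum_const, smul_eq_mul]
        congr 1
        rw [Nat.card_coe_set_eq, ← Set.ncard_coe_finset]
        congr 1
        ext y
        simp only [Finset.coe_filter, Set.mem_ofPred_eq, and_iff_right_iff_imp]
        rintro ⟨γ, rfl⟩; exact hS _ _ hx
      · intro y hy
        obtain ⟨γ, rfl⟩ := (Finset.mem_filter.1 hy).2
        simp only [ptE_smul, ptP_smul]
    rw [h1]
    have h2 : Nat.card (orbit Γ x) * (ptE Γ x + 1) = Nat.card Γ := by
      rw [ptE_add_one]
      have := Nat.card_congr (orbitProdStabilizerEquivGroup Γ x)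
      rwa [Nat.card_prod] at this
    rw [← h2]; ring

lemma card_orbit_mul (x : X) : Nat.card (orbit Γ x) * (ptE Γ x + 1) = Nat.card Γ := by
  rw [ptE_add_one]
  have := Nat.card_congr (orbitProdStabilizerEquivGroup Γ x)
  rwa [Nat.card_prod] at this

lemma card_orbit_pos (x : X) : 0 < Nat.card (orbit Γ x) := by
  have := (Set.toFinite (Set.range fun γ : Γ => γ • x))
  have : Finite (orbit Γ x) := this
  have : Nonempty (orbit Γ x) := ⟨⟨x, mem_orbit_self x⟩⟩
  exact Nat.card_pos

/-- tame counting -/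
theorem count_tame [Nonempty X]
    (hfix : ∀ γ : Γ, γ ≠ 1 → (fixedBy X γ).ncard = 2) :
    (∃ x : X, Nat.card (orbit Γ x) ≤ 2) ∨ ∃ γ : Γ, orderOf γ = 3 := by
  by_contra hcon
  push Not at hcon
  obtain ⟨h2, h3⟩ := hcon
  have hP : ∀ x : X, ptP Γ x = 0 := by
    intro x
    rw [ptP, Nat.card_eq_zero]
    left
    constructor
    rintro ⟨γ, h, h'⟩
    have := hfix γ h
    rw [h'] at this; simp at this
  have hE : ∀ x : X, ptE Γ x ≠ 2 := by
    intro x hx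
    have : 3 ∣ Nat.card Γ := by rw [← card_orbit_mul x, hx]; exact dvd_mul_left _ _
    have : Fact (Nat.Prime 3) := ⟨Nat.prime_three⟩
    obtain ⟨γ, hγ⟩ := exists_prime_orderOf_dvd_card' (G := Γ) 3 ‹_›
    exact h3 γ hγ
  obtain ⟨S, hS, hsum⟩ := sum_points (Γ := Γ) (X := X) fun γ h => Or.inr (hfix γ h)
  set g := Nat.card Γ
  obtain ⟨x₀⟩ := ‹Nonempty X›
  have hg : 3 ≤ g := by
    have := card_orbit_mul (Γ := Γ) x₀
    have := h2 x₀
    nlinarith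
  have inv : ∀ (γ : Γ) (x : X), x ∈ S → γ • x ∈ S := by
    intro γ x; simp only [hS, ptE_smul]; exact id
  -- facts per point
  have fact : ∀ x ∈ S, 2 * Nat.card (orbit Γ x) = g ∨ 4 * Nat.card (orbit Γ x) ≤ g := by
    intro x hx
    have h1 := card_orbit_mul (Γ := Γ) x
    have h3 := hE x
    have h4 := (hS x).1 hx
    rcases Nat.lt_or_ge (ptE Γ x) 3 with h | h
    · left
      have : ptE Γ x = 1 := by omega
      rw [this] at h1; linarith
    · right
      nlinarith
  have empty : ∀ T : Finset X, (∃ x, x ∈ T) ∨ ∑ y ∈ T, (ptE Γ y + ptP Γ y) = 0 := by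
    intro T
    rcases T.eq_empty_or_nonempty with h | h
    · right; simp [h]
    · left; exact h
  rcases empty S with ⟨x₁, hx₁⟩ | h
  swap
  · omega
  obtain ⟨S₁, hS₁, inv₁, e₁⟩ := peel S inv x₁ hx₁
  have f₁ := fact x₁ hx₁
  have o₁ := h2 x₁
  rw [hP] at e₁
  rcases empty S₁ with ⟨x₂, hx₂⟩ | h
  swap
  · omega
  obtain ⟨S₂, hS₂, inv₂, e₂⟩ := peel S₁ inv₁ x₂ hx₂
  have f₂ := fact x₂ (hS₁ hx₂)
  have o₂ := h2 x₂
  rw [hP] at e₂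
  rcases empty S₂ with ⟨x₃, hx₃⟩ | h
  swap
  · omega
  obtain ⟨S₃, hS₃, inv₃, e₃⟩ := peel S₂ inv₂ x₃ hx₃
  have f₃ := fact x₃ (hS₁ (hS₂ hx₃))
  have o₃ := h2 x₃
  rw [hP] at e₃
  rcases empty S₃ with ⟨x₄, hx₄⟩ | h
  swap
  · omega
  obtain ⟨S₄, hS₄, inv₄, e₄⟩ := peel S₃ inv₃ x₄ hx₄
  have f₄ := fact x₄ (hS₁ (hS₂ (hS₃ hx₄)))
  rw [hP] at e₄
  omega

/-- wild counting -/
theorem count_wild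
    (hfix : ∀ γ : Γ, γ ≠ 1 → (fixedBy X γ).ncard = 1 ∨ (fixedBy X γ).ncard = 2)
    (x : X) (U : Subgroup Γ) (hU : ∀ γ : Γ, γ ∈ U ↔ γ = 1 ∨ fixedBy X γ = {x})
    (hU1 : 1 < Nat.card U)
    (h2 : ∀ x : X, 2 < Nat.card (orbit Γ x)) :
    Nat.card U * (Nat.card U - 1) ≤ 2 * Nat.card (stabilizer Γ x) := by
  obtain ⟨S, hS, hsum⟩ := sum_points (Γ := Γ) (X := X) hfix
  have inv : ∀ (γ : Γ) (x : X), x ∈ S → γ • x ∈ S := by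
    intro γ x; simp only [hS, ptE_smul]; exact id
  have hUx : ∀ γ ∈ U, γ • x = x := by
    intro γ h
    rcases (hU γ).1 h with h | h
    · simp [h]
    · have : x ∈ fixedBy X γ := by rw [h]; rfl
      exact this
  have hp : ptP Γ x + 1 = Nat.card U := by
    classical
    have := Fintype.ofFinite Γ
    rw [ptP, Nat.card_eq_fintype_card, Nat.card_eq_fintype_card, Fintype.card_subtype,
      Fintype.card_subtype]
    have : (Finset.univ.filter fun γ : Γ => γ ∈ U) =
        insert 1 (Finset.univ.filter fun γ : Γ => γ ≠ 1 ∧ fixedBy X γ = {x}) := by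
      ext γ
      by_cases h : γ = 1 <;> simp [h, hU]
    rw [this, Finset.card_insert_of_notMem (by simp)]
  have hdvd : Nat.card U ∣ Nat.card (stabilizer Γ x) :=
    Subgroup.card_dvd_of_le fun γ h => hUx γ h
  have horb : Nat.card U + 1 ≤ Nat.card (orbit Γ x) := by
    have hfin : (orbit Γ x).Finite := (Set.toFinite (Set.range fun γ : Γ => γ • x))
    obtain ⟨y, hy, hyx⟩ : ∃ y ∈ orbit Γ x, y ≠ x := by
      by_contra hcon
      push Not at hcon
      have := h2 x
      rw [Nat.card_coe_set_eq] at this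
      have h3 : (orbit Γ x).ncard ≤ ({x} : Set X).ncard :=
        Set.ncard_le_ncard (fun y hy => hcon y hy)
      simp at h3; omega
    let f : Option U → orbit Γ x := fun o => o.elim ⟨x, mem_orbit_self x⟩
      fun u => ⟨(u : Γ) • y, by
        obtain ⟨g, rfl⟩ := hy
        exact ⟨u * g, by simp [mul_smul]⟩⟩
    have hf : Function.Injective f := by
      have key : ∀ u : U, (u : Γ) • y ≠ x := by
        intro u h
        apply hyx
        rw [smul_eq_iff_eq_inv_smul] at h
        rw [h]; exact hUx _ (U.inv_mem u.2)
      intro a b hab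
      rcases a with _ | u <;> rcases b with _ | v
      · rfl
      · exact absurd (congrArg Subtype.val hab).symm (key v)
      · exact absurd (congrArg Subtype.val hab) (key u)
      · have h1 : (u : Γ) • y = (v : Γ) • y := congrArg Subtype.val hab
        have h2 : ((v : Γ)⁻¹ * u) • y = y := by rw [mul_smul, h1, inv_smul_smul]
        rcases (hU _).1 (U.mul_mem (U.inv_mem v.2) u.2) with h | h
        · congr 1; ext
          exact (inv_mul_eq_one.1 h).symm
        · have : y ∈ fixedBy X ((v : Γ)⁻¹ * u) := h2
          rw [h] at this
          exact absurd this hyx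
    have : Finite (orbit Γ x) := hfin
    have := Nat.card_le_card_of_injective f hf
    rwa [Nat.card_congr (Equiv.optionEquivSumPUnit U : Option U ≃ U ⊕ PUnit.{1}), Nat.card_sum,
      Nat.card_unique (α := PUnit.{1})] at this
  have hn := card_orbit_mul (Γ := Γ) x
  rw [ptE_add_one] at hn
  obtain ⟨t, ht⟩ := hdvd
  have hxS : x ∈ S := by
    rw [hS]; intro h
    have := ptE_add_one (Γ := Γ) x
    rw [h, ht] at this
    have h1 : Nat.card U ∣ 1 := ⟨t, by omega⟩
    have := Nat.dvd_one.1 h1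
    omega
  obtain ⟨S₁, hS₁, inv₁, e₁⟩ := peel S inv x hxS
  have fact : ∀ y ∈ S, 2 * Nat.card (orbit Γ y) ≤ Nat.card Γ := by
    intro x hx
    have h1 := card_orbit_mul (Γ := Γ) x
    have h4 := (hS x).1 hx
    have : 1 ≤ ptE Γ x := by omega
    nlinarith
  have empty : ∀ T : Finset X, (∃ x, x ∈ T) ∨ ∑ y ∈ T, (ptE Γ y + ptP Γ y) = 0 := by
    intro T
    rcases T.eq_empty_or_nonempty with h | h
    · right; simp [h]
    · left; exact h
  have hx2 := h2 x
  set g := Nat.card Γ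
  set n := Nat.card (orbit Γ x)
  obtain ⟨p, hpp⟩ : ∃ p, ptP Γ x = p := ⟨_, rfl⟩
  rw [hpp] at e₁ hp
  rw [ht, ← hp] at hn ⊢
  rw [← hp] at horb hU1
  rcases empty S₁ with ⟨y, hy⟩ | h
  swap
  · exfalso
    have ht0 : 1 ≤ t := by
      rcases Nat.eq_zero_or_pos t with h | h
      · subst h
        have : 0 < g := Nat.card_pos
        rw [mul_zero, mul_zero] at hn; omega
      · exact h
    have : n * (p + 1) ≤ n * ((p + 1) * t) := by
      apply Nat.mul_le_mul_left; nlinarith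
    rw [hn] at this
    nlinarith
  obtain ⟨S₂, hS₂, inv₂, e₂⟩ := peel S₁ inv₁ y hy
  have fy := fact y (hS₁ hy)
  have oy := h2 y
  have hny := card_orbit_mul (Γ := Γ) y
  rcases Nat.eq_zero_or_pos (ptP Γ y) with hpy | hpy
  swap
  · exfalso
    have : Nat.card (orbit Γ y) ≤ Nat.card (orbit Γ y) * ptP Γ y := Nat.le_mul_of_pos_right _ hpy
    have : n ≤ n * p := Nat.le_mul_of_pos_right _ (by omega)
    omega
  rw [hpy] at e₂
  have hnp : n ≤ n * p := Nat.le_mul_of_pos_right _ (by omega)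
  rcases empty S₂ with ⟨z, hz⟩ | h
  · exfalso
    obtain ⟨S₃, hS₃, inv₃, e₃⟩ := peel S₂ inv₂ z hz
    have fz := fact z (hS₁ (hS₂ hz))
    omega
  -- main case
  set ny := Nat.card (orbit Γ y)
  set ey := ptE Γ y + 1
  have e4 : ny + n = 2 + n * p := by omega
  have e5 : ny * ey + n * ey = 2 * ey + n * p * ey := by rw [← add_mul, e4]; ring
  have hdv : n ∣ 2 * ey := by
    have h1 : n ∣ ny * ey + n * ey := by
      rw [hny]; exact dvd_add ⟨_, hn.symm⟩ ⟨_, rfl⟩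
    rw [e5] at h1
    exact (Nat.dvd_add_left ⟨p * ey, by ring⟩).1 h1
  have hle : n ≤ 2 * ey := Nat.le_of_dvd (by simp only [ey]; omega) hdv
  have e6 : n * ((p + 1) * t) + n * ey = 2 * ey + n * (p * ey) := by
    have : ny * ey = g := hny
    rw [hn, ← this, e5]; ring
  have e7 : n * (p * ey) < n * ((p + 1) * t + ey) := by
    have h1 : n * ((p + 1) * t + ey) = 2 * ey + n * (p * ey) := by rw [← e6]; ring
    rw [h1]; simp only [ey]; omega
  have e8 : p * ey < (p + 1) * t + ey := lt_of_mul_lt_mul_left e7 (Nat.zero_le _)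
  -- 2*(p+1)*t > 2*ey*(p-1) ≥ (p+2)*(p-1)
  obtain ⟨m, rfl⟩ : ∃ m, p = m + 1 := ⟨p - 1, by omega⟩
  have e9 : (m + 3) * m < 2 * ((m + 2) * t) := by nlinarith
  have e10 : m + 1 ≤ 2 * t := by
    by_contra hc
    push Not at hc
    have : 2 * t ≤ m := by omega
    nlinarith
  simp only [Nat.add_sub_cancel]
  nlinarith

end Counting



set_option linter.unusedSectionVars false
section LinAlg
open MulAction
open scoped LinearAlgebra.Projectivization

/-- parallel vectors -/
def Par {F : Type*} [Field F] (v w : Fin 2 → F) : Prop := v 0 * w 1 = v 1 * w 0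

/-- scalar matrices -/
def IsSc {F : Type*} [Field F] (A : Matrix (Fin 2) (Fin 2) F) : Prop :=
  A 0 1 = 0 ∧ A 1 0 = 0 ∧ A 0 0 = A 1 1

lemma vec2_ne_zero {F : Type*} [Field F] {v : Fin 2 → F} : v ≠ 0 ↔ v 0 ≠ 0 ∨ v 1 ≠ 0 := by
  rw [ne_eq, funext_iff, Fin.forall_fin_two]
  simp only [Pi.zero_apply]; tauto

lemma Par.exists_smul {F : Type*} [Field F] {v w : Fin 2 → F} (h : Par v w) (hw : w ≠ 0) :
    ∃ c : F, v = c • w := by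
  rcases vec2_ne_zero.1 hw with h0 | h1
  · refine ⟨v 0 / w 0, ?_⟩
    ext i; fin_cases i
    · simp [h0]
    · simp only [Par] at h; simp; field_simp; linear_combination -h
  · refine ⟨v 1 / w 1, ?_⟩
    ext i; fin_cases i
    · simp only [Par] at h; simp; field_simp; linear_combination h
    · simp [h1]

lemma par_smul {F : Type*} [Field F] (c : F) (w : Fin 2 → F) : Par (c • w) w := by
  simp [Par]; ring

lemma Par.trans {F : Type*} [Field F] {u v w : Fin 2 → F} (h : Par u v) (h' : Par v w)
    (hv : v ≠ 0) : Par u w := by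
  obtain ⟨c, rfl⟩ := h.exists_smul hv
  simp only [Par, Pi.smul_apply, smul_eq_mul] at *
  linear_combination c * h'

lemma Par.symm {F : Type*} [Field F] {u v : Fin 2 → F} (h : Par u v) : Par v u := by
  simp only [Par] at *; linear_combination -h

lemma mk_eq_iff_par {F : Type*} [Field F] {v w : Fin 2 → F} (hv : v ≠ 0) (hw : w ≠ 0) :
    Projectivization.mk F v hv = Projectivization.mk F w hw ↔ Par v w := by
  rw [Projectivization.mk_eq_mk_iff']
  constructor
  · rintro ⟨a, rfl⟩; exact par_smul _ _
  · intro h; obtain ⟨c, hc⟩ := h.exists_smul hw; exact ⟨c, hc.symm⟩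

lemma fix_pts {F : Type*} [Field F] (h2 : (2 : F) ≠ 0) (A : Matrix (Fin 2) (Fin 2) F)
    (hA : ¬ IsSc A) (δ : F) (hδ : δ ^ 2 = (A 0 0 - A 1 1) ^ 2 + 4 * (A 0 1 * A 1 0)) :
    ∃ p q : Fin 2 → F, p ≠ 0 ∧ q ≠ 0 ∧ (∀ v, v ≠ 0 → (Par (A *ᵥ v) v ↔ Par v p ∨ Par v q)) ∧
      (Par p q ↔ δ = 0) := by
  by_cases hc : A 1 0 = 0
  · refine ⟨![1, 0], ![-A 0 1, A 0 0 - A 1 1], ?_, ?_, ?_, ?_⟩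
    · simp [vec2_ne_zero]
    · simp only [vec2_ne_zero]
      simp only [IsSc, hc] at hA
      simp [sub_eq_zero]; tauto
    · intro v hv
      simp only [Par, mulVec, dotProduct, Fin.sum_univ_two, hc]
      simp
      rw [eq_comm (a := (0 : F))]
      rw [show (v 1 = 0 ∨ v 0 * (A 0 0 - A 1 1) = -(v 1 * A 0 1)) ↔
        v 1 * (v 0 * (A 0 0 - A 1 1) + (v 1 * A 0 1)) = 0 by
          rw [mul_eq_zero, add_eq_zero_iff_eq_neg]]
      constructor
      · intro h; linear_combination h
      · intro h; linear_combination h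
    · simp only [Par]
      have : δ ^ 2 = (A 0 0 - A 1 1) ^ 2 := by rw [hδ, hc]; ring
      simp
      rw [← pow_eq_zero_iff (n := 2) two_ne_zero (a := δ), this]
      simp
  · have hne : 2 * A 1 0 ≠ 0 := mul_ne_zero h2 hc
    refine ⟨![A 0 0 - A 1 1 + δ, 2 * A 1 0], ![A 0 0 - A 1 1 - δ, 2 * A 1 0], ?_, ?_, ?_, ?_⟩
    · rw [vec2_ne_zero]; right; simpa using hne
    · rw [vec2_ne_zero]; right; simpa using hne
    · intro v hv
      simp only [Par, mulVec, dotProduct, Fin.sum_univ_two]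
      simp only [cons_val_one, cons_val_zero]
      rw [← sub_eq_zero (b := v 1 * (A 0 0 - A 1 1 + δ)),
        ← sub_eq_zero (b := v 1 * (A 0 0 - A 1 1 - δ)), ← mul_eq_zero]
      constructor
      · intro h; linear_combination (-4 * A 1 0) * h - (v 1) ^ 2 * hδ
      · intro h
        have : (4 * A 1 0) ≠ 0 := by
          rw [show (4 : F) = 2 * 2 by norm_num]; exact mul_ne_zero (mul_ne_zero h2 h2) hc
        apply mul_left_cancel₀ this
        linear_combination -h - (v 1) ^ 2 * hδ
    · simp only [Par]
      simp only [cons_val_one, cons_val_zero]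
      constructor
      · intro h
        have : 2 * (2 * A 1 0) * δ = 0 := by linear_combination h
        rcases mul_eq_zero.1 this with h | h
        · exact absurd h (mul_ne_zero h2 hne)
        · exact h
      · rintro rfl; ring

variable {k Ω : Type*} [Field k] [Field Ω] [Algebra k Ω]

/-- extension of scalars of a matrix -/
abbrev xt (Ω : Type*) {k : Type*} [Field k] [Field Ω] [Algebra k Ω]
    (A : Matrix (Fin 2) (Fin 2) k) : Matrix (Fin 2) (Fin 2) Ω := A.map (algebraMap k Ω)

lemma xt_mul (A B : Matrix (Fin 2) (Fin 2) k) : xt Ω (A * B) = xt Ω A * xt Ω B :=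
  Matrix.map_mul

lemma isSc_xt (A : Matrix (Fin 2) (Fin 2) k) : IsSc (xt Ω A) ↔ IsSc A := by
  simp [IsSc, xt]

/-- action on the projective line -/
noncomputable def permHom (Ω : Type*) {k : Type*} [Field k] [Field Ω] [Algebra k Ω] :
    GL (Fin 2) k →* Equiv.Perm (ℙ Ω (Fin 2 → Ω)) :=
  (MulAction.toPermHom (LinearMap.GeneralLinearGroup Ω (Fin 2 → Ω)) (ℙ Ω (Fin 2 → Ω))).comp
    ((Matrix.GeneralLinearGroup.toLin (n := Fin 2) (R := Ω)).toMonoidHom.comp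
      (Matrix.GeneralLinearGroup.map (algebraMap k Ω)))

lemma xt_mulVec_ne_zero (h : GL (Fin 2) k) {v : Fin 2 → Ω} (hv : v ≠ 0) :
    xt Ω h.val *ᵥ v ≠ 0 := by
  intro h0
  apply hv
  have : xt Ω (h⁻¹).val *ᵥ (xt Ω h.val *ᵥ v) = v := by
    rw [mulVec_mulVec, ← xt_mul, ← Units.val_mul, inv_mul_cancel]
    simp [xt]
  rw [← this, h0, mulVec_zero]

lemma permHom_mk (h : GL (Fin 2) k) (v : Fin 2 → Ω) (hv : v ≠ 0) :
    permHom Ω h (Projectivization.mk Ω v hv) =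
      Projectivization.mk Ω (xt Ω h.val *ᵥ v) (xt_mulVec_ne_zero h hv) := by
  rfl

open Classical in
lemma ncard_fixed [IsAlgClosed Ω] (h2 : (2 : Ω) ≠ 0) (h : GL (Fin 2) k) (hA : ¬ IsSc h.val) :
    ({x | permHom Ω h x = x} : Set (ℙ Ω (Fin 2 → Ω))).ncard =
      if (h.val 0 0 - h.val 1 1) ^ 2 + 4 * (h.val 0 1 * h.val 1 0) = 0 then 1 else 2 := by
  set A := xt Ω h.val
  obtain ⟨δ, hδ⟩ := IsAlgClosed.exists_pow_nat_eq
    ((A 0 0 - A 1 1) ^ 2 + 4 * (A 0 1 * A 1 0)) (n := 2) (by norm_num)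
  obtain ⟨p, q, hp, hq, H, hpq⟩ := fix_pts h2 A (by rwa [isSc_xt]) δ hδ
  have h1 : ({x | permHom Ω h x = x} : Set (ℙ Ω (Fin 2 → Ω))) =
      {Projectivization.mk Ω p hp, Projectivization.mk Ω q hq} := by
    ext x
    induction x using Projectivization.ind with | h v hv => ?_
    rw [Set.mem_ofPred_eq, permHom_mk, mk_eq_iff_par, H v hv]
    simp only [Set.mem_insert_iff, Set.mem_singleton_iff, mk_eq_iff_par]
  have h3 : (h.val 0 0 - h.val 1 1) ^ 2 + 4 * (h.val 0 1 * h.val 1 0) = 0 ↔ δ = 0 := by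
    rw [← pow_eq_zero_iff (n := 2) two_ne_zero (a := δ), hδ,
      ← (algebraMap k Ω).injective.eq_iff]
    simp [A, xt, map_ofNat]
  rw [h1]
  split_ifs with hd
  · rw [h3, ← hpq, ← mk_eq_iff_par hp hq] at hd
    rw [hd]; simp
  · rw [h3, ← hpq, ← mk_eq_iff_par hp hq] at hd
    exact Set.ncard_pair hd

lemma isSc_mulVec {F : Type*} [Field F] {A : Matrix (Fin 2) (Fin 2) F} (hA : IsSc A)
    (v : Fin 2 → F) : A *ᵥ v = A 0 0 • v := by
  obtain ⟨h1, h2, h3⟩ := hA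
  ext i; fin_cases i <;> simp [mulVec, dotProduct, Fin.sum_univ_two, h1, h2, h3]

lemma permHom_eq_one_iff (h : GL (Fin 2) k) : permHom Ω h = 1 ↔ IsSc h.val := by
  constructor
  · intro H
    have key : ∀ v : Fin 2 → Ω, v ≠ 0 → Par (xt Ω h.val *ᵥ v) v := by
      intro v hv
      rw [← mk_eq_iff_par (xt_mulVec_ne_zero h hv) hv, ← permHom_mk, H]; rfl
    have k1 := key ![1, 0] (by simp [vec2_ne_zero])
    have k2 := key ![0, 1] (by simp [vec2_ne_zero])
    have k3 := key ![1, 1] (by simp [vec2_ne_zero])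
    simp [Par, mulVec, dotProduct, Fin.sum_univ_two, xt] at k1 k2 k3
    have k1 : h.val 1 0 = 0 := by simpa using k1.symm
    have k2 : h.val 0 1 = 0 := by simpa using k2
    refine ⟨k2, k1, ?_⟩
    apply (algebraMap k Ω).injective
    simpa [k1, k2] using k3
  · intro H
    ext x
    induction x using Projectivization.ind with | h v hv => ?_
    rw [permHom_mk, Equiv.Perm.one_apply, mk_eq_iff_par, isSc_mulVec ((isSc_xt _).2 H)]
    exact par_smul _ _

/-- `ρ` has no orbit of size at most 2 on the projective line over `Ω` -/
def ND (Ω : Type*) {k Γ : Type*} [Field k] [Field Ω] [Algebra k Ω] [Group Γ]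
    (ρ : Γ →* GL (Fin 2) k) : Prop :=
  ∀ v w : Fin 2 → Ω, v ≠ 0 → w ≠ 0 →
    ¬ ∀ γ, Par (xt Ω (ρ γ).val *ᵥ v) v ∨ Par (xt Ω (ρ γ).val *ᵥ v) w

variable {Γ : Type*} [Group Γ] [Finite Γ] (ρ : Γ →* GL (Fin 2) k)

instance finite_rg : Finite ((permHom Ω).comp ρ).range :=
  Finite.of_surjective _ (MonoidHom.rangeRestrict_surjective _)

lemma ND_orbit {ρ : Γ →* GL (Fin 2) k} (h : ND Ω ρ) (x : ℙ Ω (Fin 2 → Ω)) :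
    2 < Nat.card (orbit ((permHom Ω).comp ρ).range x) := by
  classical
  by_contra hc
  push Not at hc
  have hfin : (orbit ((permHom Ω).comp ρ).range x).Finite :=
    Set.toFinite (Set.range fun γ : ((permHom Ω).comp ρ).range => γ • x)
  rw [Nat.card_coe_set_eq] at hc
  obtain ⟨y, hy⟩ : ∃ y, ∀ z ∈ orbit ((permHom Ω).comp ρ).range x, z = x ∨ z = y := by
    by_contra hcon
    push Not at hcon
    obtain ⟨z, hz, hzx, -⟩ := hcon x
    obtain ⟨w, hw, hwx, hwz⟩ := hcon z
    have : ({x, z, w} : Set _).ncard ≤ _ := Set.ncard_le_ncard (t :=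
      orbit ((permHom Ω).comp ρ).range x) (by
        intro a ha
        simp only [Set.mem_insert_iff, Set.mem_singleton_iff] at ha
        rcases ha with rfl | rfl | rfl
        · exact mem_orbit_self _
        · exact hz
        · exact hw) hfin
    rw [Set.ncard_eq_three.2 ⟨x, z, w, hzx.symm, hwx.symm, hwz.symm, rfl⟩] at this
    omega
  induction x using Projectivization.ind with | h v hv => ?_
  induction y using Projectivization.ind with | h w hw => ?_
  refine h v w hv hw fun γ => ?_
  have := hy (permHom Ω (ρ γ) (Projectivization.mk Ω v hv)) ⟨⟨_, ⟨γ, rfl⟩⟩, rfl⟩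
  rwa [permHom_mk, mk_eq_iff_par, mk_eq_iff_par] at this

/-- discriminant -/
def disc {F : Type*} [Field F] (A : Matrix (Fin 2) (Fin 2) F) : F :=
  (A 0 0 - A 1 1) ^ 2 + 4 * (A 0 1 * A 1 0)

lemma fixedBy_perm (γ : Γ) : fixedBy (ℙ Ω (Fin 2 → Ω))
    (⟨permHom Ω (ρ γ), ⟨γ, rfl⟩⟩ : ((permHom Ω).comp ρ).range) = {x | permHom Ω (ρ γ) x = x} := rfl

open Classical in
lemma ncard_fixedBy [IsAlgClosed Ω] (h2 : (2 : Ω) ≠ 0) (γ : Γ) (hA : ¬ IsSc (ρ γ).val) :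
   (fixedBy (ℙ Ω (Fin 2 → Ω))
    (⟨permHom Ω (ρ γ), ⟨γ, rfl⟩⟩ : ((permHom Ω).comp ρ).range)).ncard =
    if disc (ρ γ).val = 0 then 1 else 2 := by
  rw [fixedBy_perm, ncard_fixed h2 _ hA]; rfl

theorem tame_exists [IsAlgClosed Ω] (h2 : (2 : Ω) ≠ 0) (hND : ND Ω ρ)
    (hss : ∀ γ, ¬ IsSc (ρ γ).val → disc (ρ γ).val ≠ 0) :
    ∃ γ, ¬ IsSc (ρ γ).val ∧ IsSc (ρ (γ ^ 3)).val := by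
  have : Nonempty (ℙ Ω (Fin 2 → Ω)) := ⟨Projectivization.mk Ω ![1, 0] (by simp [vec2_ne_zero])⟩
  rcases count_tame (Γ := ((permHom Ω).comp ρ).range) (X := ℙ Ω (Fin 2 → Ω)) (by
    rintro ⟨_, ⟨γ, rfl⟩⟩ h1
    have hns : ¬ IsSc (ρ γ).val := by
      rw [← permHom_eq_one_iff (Ω := Ω)]
      intro h; exact h1 (Subtype.ext h)
    have := ncard_fixedBy (Ω := Ω) ρ h2 γ hns
    rw [if_neg (hss γ hns)] at this
    exact this) with ⟨x, hx⟩ | ⟨⟨_, ⟨γ, rfl⟩⟩, hγ⟩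
  · exact absurd (ND_orbit hND x) (by omega)
  · refine ⟨γ, ?_, ?_⟩
    · intro h
      rw [← permHom_eq_one_iff (Ω := Ω)] at h
      rw [orderOf_eq_one_iff.2 (Subtype.ext h)] at hγ
      omega
    · rw [← permHom_eq_one_iff (Ω := Ω)]
      have := pow_orderOf_eq_one (⟨((permHom Ω).comp ρ) γ, ⟨γ, rfl⟩⟩ : ((permHom Ω).comp ρ).range)
      rw [hγ] at this
      have := congrArg Subtype.val this
      simpa using this

end LinAlg


section Basic

variable {k Ω : Type*} [Field k] [Field Ω] [Algebra k Ω] {Γ : Type*} [Group Γ]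
  (ρ : Γ →* GL (Fin 2) k)

/-- cocycle condition -/
def Coc (c : Γ → Matrix (Fin 2) (Fin 2) k) : Prop :=
  (∀ g, (c g).trace = 0) ∧
    ∀ g h, c (g * h) = c g + (ρ g).val * c h * ((ρ g)⁻¹).val

/-- coboundary condition -/
def Cob (c : Γ → Matrix (Fin 2) (Fin 2) k) : Prop :=
  ∃ X : Matrix (Fin 2) (Fin 2) k, X.trace = 0 ∧
    ∀ g, c g = (ρ g).val * X * ((ρ g)⁻¹).val - X

/-- condition four -/
def HasIV : Prop :=
  ∀ W : Submodule k (Matrix (Fin 2) (Fin 2) k),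
    (∀ w ∈ W, ∀ h, (ρ h).val * w * ((ρ h)⁻¹).val ∈ W) → W ≠ ⊥ →
    ∃ h, ∃ α : k,
      (ρ h).val.charpoly.rootMultiplicity α = 1 ∧
      (∀ β : k, (ρ h).val.charpoly.IsRoot β → β ≠ α → α ^ 2 ≠ β ^ 2) ∧
      ∃ w ∈ W, eigProj (ρ h).val α * w * eigProj (ρ h).val α ≠ 0

/-- conjugated representation -/
def cjr (Q : GL (Fin 2) k) : Γ →* GL (Fin 2) k := (MulAut.conj Q).toMonoidHom.comp ρ

lemma cjr_apply (Q : GL (Fin 2) k) (g : Γ) : cjr ρ Q g = Q * ρ g * Q⁻¹ := rfl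

lemma trace_cj (Q : GL (Fin 2) k) (X : Matrix (Fin 2) (Fin 2) k) :
    (Q.val * X * (Q⁻¹).val).trace = X.trace := by
  rw [trace_mul_comm, ← mul_assoc, Units.inv_mul, one_mul]

lemma cob_of_cjr (Q : GL (Fin 2) k) (h : ∀ c, Coc (cjr ρ Q) c → Cob (cjr ρ Q) c)
    (c : Γ → Matrix (Fin 2) (Fin 2) k) (hc : Coc ρ c) : Cob ρ c := by
  obtain ⟨X, hX, hX'⟩ := h (fun g => Q.val * c g * (Q⁻¹).val) ⟨fun g => by
    rw [trace_cj, hc.1], fun g g' => by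
      simp only [hc.2, cjr_apply, mul_add, add_mul, Units.val_mul, _root_.mul_inv_rev, inv_inv, mul_assoc,
        Units.inv_mul_cancel_left]⟩
  refine ⟨(Q⁻¹).val * X * Q.val, ?_, fun g => ?_⟩
  · rw [trace_mul_comm, ← mul_assoc, Units.mul_inv, one_mul, hX]
  · have := congrArg (fun Y => (Q⁻¹).val * Y * Q.val) (hX' g)
    simpa only [cjr_apply, mul_sub, sub_mul, Units.val_mul, _root_.mul_inv_rev, inv_inv, mul_assoc,
        Units.inv_mul_cancel_left, Units.inv_mul, mul_one] using this

lemma eigProj_cj (Q : GL (Fin 2) k) (A : Matrix (Fin 2) (Fin 2) k) (α : k) :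
    eigProj (Q.val * A * (Q⁻¹).val) α = Q.val * eigProj A α * (Q⁻¹).val := by
  rw [eigProj, eigProj, trace_cj]
  simp only [mul_smul_comm, smul_mul_assoc, mul_sub, sub_mul, mul_one, Units.mul_inv]

lemma charpoly_cj (Q : GL (Fin 2) k) (A : Matrix (Fin 2) (Fin 2) k) :
    (Q.val * A * (Q⁻¹).val).charpoly = A.charpoly := by
  rw [Matrix.charpoly_mul_comm, ← mul_assoc, Units.inv_mul, one_mul]

lemma hasIV_of_cjr (Q : GL (Fin 2) k) (h : HasIV (cjr ρ Q)) : HasIV ρ := by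
  intro W hW hW0
  obtain ⟨g, α, h1, h2, w, hw, hw0⟩ := h
    (W.comap (LinearMap.mulLeft k (Q⁻¹).val ∘ₗ LinearMap.mulRight k Q.val)) (by
      intro w hw g
      have := hW _ hw g
      simp only [Submodule.mem_comap, LinearMap.comp_apply, LinearMap.mulLeft_apply,
        LinearMap.mulRight_apply] at this ⊢
      simpa only [cjr_apply, Units.val_mul, _root_.mul_inv_rev, inv_inv, mul_assoc,
        Units.inv_mul_cancel_left, Units.inv_mul, mul_one] using this) (by
      intro h0
      apply hW0
      rw [eq_bot_iff] at h0 ⊢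
      intro w hw
      have : Q.val * w * (Q⁻¹).val ∈ W.comap
          (LinearMap.mulLeft k (Q⁻¹).val ∘ₗ LinearMap.mulRight k Q.val) := by
        simpa only [Submodule.mem_comap, LinearMap.comp_apply, LinearMap.mulLeft_apply,
          LinearMap.mulRight_apply, mul_assoc,
        Units.inv_mul_cancel_left, Units.inv_mul, mul_one] using hw
      have := h0 this
      rw [Submodule.mem_bot] at this ⊢
      have := congrArg (fun Y => (Q⁻¹).val * Y * Q.val) this
      simpa only [mul_assoc, Units.inv_mul_cancel_left, Units.inv_mul, mul_one, zero_mul,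
        mul_zero] using this)
  have e : (cjr ρ Q g).val = Q.val * (ρ g).val * (Q⁻¹).val := rfl
  rw [e, charpoly_cj] at h1
  refine ⟨g, α, h1, fun β hβ => h2 β (by rw [e, charpoly_cj]; exact hβ), _, hw, ?_⟩
  intro h0
  apply hw0
  rw [e, eigProj_cj]
  have := congrArg (fun Y => Q.val * Y * (Q⁻¹).val) h0
  simpa only [LinearMap.comp_apply, LinearMap.mulLeft_apply,
          LinearMap.mulRight_apply, mul_assoc, Units.inv_mul_cancel_left, Units.mul_inv_cancel_left,
          Units.inv_mul, Units.mul_inv, mul_one, zero_mul, mul_zero] using this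

lemma Par.mulVec {F : Type*} [Field F] {v w : Fin 2 → F} (h : Par v w)
    (A : Matrix (Fin 2) (Fin 2) F) : Par (A *ᵥ v) (A *ᵥ w) := by
  simp only [Par, Matrix.mulVec, dotProduct, Fin.sum_univ_two] at *
  linear_combination (A 0 0 * A 1 1 - A 0 1 * A 1 0) * h

lemma ND_cjr (Q : GL (Fin 2) k) (h : ND Ω ρ) : ND Ω (cjr ρ Q) := by
  intro v w hv hw H
  refine h _ _ (xt_mulVec_ne_zero Q⁻¹ hv) (xt_mulVec_ne_zero Q⁻¹ hw) fun g => ?_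
  have e : xt Ω (ρ g).val *ᵥ (xt Ω (Q⁻¹).val *ᵥ v) =
      xt Ω (Q⁻¹).val *ᵥ (xt Ω (cjr ρ Q g).val *ᵥ v) := by
    rw [mulVec_mulVec, mulVec_mulVec, ← xt_mul, ← xt_mul]
    simp only [cjr_apply, Units.val_mul, mul_assoc, Units.inv_mul_cancel_left]
  rw [e]
  exact (H g).imp (fun h => h.mulVec _) (fun h => h.mulVec _)

lemma exists_diag (A : Matrix (Fin 2) (Fin 2) k) (α β : k) (hne : α ≠ β)
    (ht : A 0 0 + A 1 1 = α + β) (hd : A 0 0 * A 1 1 - A 0 1 * A 1 0 = α * β) :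
    ∃ Q : GL (Fin 2) k, Q.val * A * (Q⁻¹).val = !![α, 0; 0, β] := by
  have key : ∀ P : Matrix (Fin 2) (Fin 2) k, P.det ≠ 0 → A * P = P * !![α, 0; 0, β] →
      ∃ Q : GL (Fin 2) k, Q.val * A * (Q⁻¹).val = !![α, 0; 0, β] := by
    intro P hP h
    refine ⟨(Matrix.GeneralLinearGroup.mkOfDetNeZero P hP)⁻¹, ?_⟩
    rw [inv_inv, mul_assoc]
    change _ * (A * P) = _
    rw [h]
    exact Units.inv_mul_cancel_left (Matrix.GeneralLinearGroup.mkOfDetNeZero P hP) _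
  have hne' := sub_ne_zero.2 hne
  by_cases h1 : A 1 0 = 0
  · by_cases h2 : A 0 1 = 0
    · have : (A 0 0 - α) * (A 0 0 - β) = 0 := by
        rw [h1] at hd; linear_combination -hd + A 0 0 * ht
      rcases mul_eq_zero.1 this with h3 | h3
      · have e0 : A 0 0 = α := sub_eq_zero.1 h3
        have e1 : A 1 1 = β := by rw [e0] at ht; exact add_left_cancel ht
        refine key 1 (by simp) ?_
        ext i j; fin_cases i <;> fin_cases j <;> simp [*]
      · have e0 : A 0 0 = β := sub_eq_zero.1 h3
        have e1 : A 1 1 = α := by rw [e0, add_comm α] at ht; exact add_left_cancel ht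
        refine key !![0, 1; 1, 0] (by simp) ?_
        ext i j; fin_cases i <;> fin_cases j <;> simp [*, Matrix.mul_apply, Fin.sum_univ_two]
    · refine key !![A 0 1, A 0 1; α - A 0 0, β - A 0 0] ?_ ?_
      · rw [det_fin_two]; simp
        rw [show A 0 1 * (β - A 0 0) - A 0 1 * (α - A 0 0) = - (A 0 1 * (α - β)) by ring]
        exact neg_ne_zero.2 (mul_ne_zero h2 hne')
      · ext i j; fin_cases i <;> fin_cases j <;> simp [Matrix.mul_apply, Fin.sum_univ_two]
        · ring
        · ring
        · linear_combination α * ht - hd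
        · linear_combination β * ht - hd
  · refine key !![α - A 1 1, β - A 1 1; A 1 0, A 1 0] ?_ ?_
    · rw [det_fin_two]; simp
      rw [show (α - A 1 1) * A 1 0 - (β - A 1 1) * A 1 0 = (A 1 0 * (α - β)) by ring]
      exact (mul_ne_zero h1 hne')
    · ext i j; fin_cases i <;> fin_cases j <;> simp [Matrix.mul_apply, Fin.sum_univ_two]
      · linear_combination α * ht - hd
      · linear_combination β * ht - hd
      · ring
      · ring

lemma exists_tri (A : Matrix (Fin 2) (Fin 2) k) (v : Fin 2 → k) (hv : v ≠ 0)
    (h : Par (A *ᵥ v) v) :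
    ∃ Q : GL (Fin 2) k, (Q.val * A * (Q⁻¹).val) 1 0 = 0 := by
  obtain ⟨c, hc⟩ := h.exists_smul hv
  have key : ∀ P : Matrix (Fin 2) (Fin 2) k, P.det ≠ 0 → P *ᵥ ![1, 0] = v →
      ∃ Q : GL (Fin 2) k, (Q.val * A * (Q⁻¹).val) 1 0 = 0 := by
    intro P hP h
    refine ⟨(Matrix.GeneralLinearGroup.mkOfDetNeZero P hP)⁻¹, ?_⟩
    set R := Matrix.GeneralLinearGroup.mkOfDetNeZero P hP
    have hR : R.val = P := rfl
    have : ((R⁻¹).val * A * (R⁻¹⁻¹).val) *ᵥ ![1, 0] = c • ![1, 0] := by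
      rw [inv_inv, ← mulVec_mulVec, hR, h, ← mulVec_mulVec, hc, mulVec_smul, ← h, mulVec_mulVec,
        ← hR, Units.inv_mul, one_mulVec]
    have := congrFun this 1
    simpa [Matrix.mulVec, dotProduct, Fin.sum_univ_two] using this
  rcases vec2_ne_zero.1 hv with h0 | h1
  · refine key !![v 0, 0; v 1, 1] (by simpa using h0) ?_
    ext i; fin_cases i <;> simp
  · refine key !![v 0, 1; v 1, 0] (by simpa using h1) ?_
    ext i; fin_cases i <;> simp

lemma inv_val (g : GL (Fin 2) k) : (g⁻¹).val =
    (g.val.det)⁻¹ • !![g.val 1 1, -g.val 0 1; -g.val 1 0, g.val 0 0] := by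
  rw [Matrix.coe_units_inv, Matrix.inv_def, Matrix.adjugate_fin_two, Ring.inverse_eq_inv']

lemma xt_e1 (A : Matrix (Fin 2) (Fin 2) k) :
    xt Ω A *ᵥ ![1, 0] = ![algebraMap k Ω (A 0 0), algebraMap k Ω (A 1 0)] := by
  ext i; fin_cases i <;> simp [Matrix.mulVec, dotProduct, Fin.sum_univ_two, xt]

lemma xt_e2 (A : Matrix (Fin 2) (Fin 2) k) :
    xt Ω A *ᵥ ![0, 1] = ![algebraMap k Ω (A 0 1), algebraMap k Ω (A 1 1)] := by
  ext i; fin_cases i <;> simp [Matrix.mulVec, dotProduct, Fin.sum_univ_two, xt]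

lemma rootMult_diag (α β : k) (h : α ≠ β) :
    (!![α, 0; 0, β] : Matrix (Fin 2) (Fin 2) k).charpoly.rootMultiplicity α = 1 ∧
    (!![α, 0; 0, β] : Matrix (Fin 2) (Fin 2) k).charpoly.rootMultiplicity β = 1 ∧
    ∀ γ, (!![α, 0; 0, β] : Matrix (Fin 2) (Fin 2) k).charpoly.IsRoot γ ↔ γ = α ∨ γ = β := by
  have e : (!![α, 0; 0, β] : Matrix (Fin 2) (Fin 2) k).charpoly = (X - C α) * (X - C β) := by
    rw [Matrix.charpoly, Matrix.charmatrix, det_fin_two]; simp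
  have hne : (X - C α) * (X - C β) ≠ 0 := mul_ne_zero (X_sub_C_ne_zero _) (X_sub_C_ne_zero _)
  classical
  refine ⟨?_, ?_, ?_⟩
  · rw [e, rootMultiplicity_mul hne, rootMultiplicity_X_sub_C, rootMultiplicity_X_sub_C]
    simp [h]
  · rw [e, rootMultiplicity_mul hne, rootMultiplicity_X_sub_C, rootMultiplicity_X_sub_C]
    simp [h.symm]
  · intro γ
    rw [e]; simp [sub_eq_zero]

lemma hasIV_diag (hND : ND Ω ρ) (h0 : Γ) (α β : k)
    (hh : (ρ h0).val = !![α, 0; 0, β]) (hab : α ^ 2 ≠ β ^ 2) : HasIV ρ := by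
  intro W hW hW0
  have hne : α ≠ β := by rintro rfl; exact hab rfl
  obtain ⟨r1, r2, r3⟩ := rootMult_diag α β hne
  by_cases hz : ∀ w ∈ W, w 0 0 = 0 ∧ w 1 1 = 0
  · exfalso
    obtain ⟨w, hw, hwne⟩ := W.ne_bot_iff.1 hW0
    have key : ∀ g, (ρ g).val 0 1 * (ρ g).val 1 1 * w 1 0 =
        (ρ g).val 0 0 * (ρ g).val 1 0 * w 0 1 := by
      intro g
      have h1 := (hz _ (hW w hw g)).1
      rw [inv_val] at h1
      have hd : (ρ g).val.det ≠ 0 := ((Matrix.isUnit_iff_isUnit_det _).1 (ρ g).isUnit).ne_zero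
      obtain ⟨w1, w2⟩ := hz w hw
      simp [Matrix.mul_apply, Fin.sum_univ_two, w1, w2, hd] at h1
      field_simp at h1
      linear_combination h1
    have key2 : ∀ g, β ^ 2 * ((ρ g).val 0 1 * (ρ g).val 1 1 * w 1 0) =
        α ^ 2 * ((ρ g).val 0 0 * (ρ g).val 1 0 * w 0 1) := by
      intro g
      have := key (g * h0)
      rw [map_mul, Units.val_mul, hh] at this
      simp [Matrix.mul_apply, Fin.sum_univ_two] at this
      linear_combination this
    have z1 : ∀ g, (ρ g).val 0 0 * (ρ g).val 1 0 * w 0 1 = 0 := by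
      intro g
      have : (α ^ 2 - β ^ 2) * ((ρ g).val 0 0 * (ρ g).val 1 0 * w 0 1) = 0 := by
        linear_combination -key2 g + β ^ 2 * key g
      exact (mul_eq_zero.1 this).resolve_left (sub_ne_zero.2 hab)
    by_cases hb : w 0 1 = 0
    · have hc : w 1 0 ≠ 0 := by
        intro hc
        apply hwne
        obtain ⟨w1, w2⟩ := hz w hw
        ext i j; fin_cases i <;> fin_cases j <;> simp [*]
      refine hND ![0, 1] ![1, 0] (by simp) (by simp) fun g => ?_
      have := key g
      rw [z1 g] at this
      have := (mul_eq_zero.1 this).resolve_right hc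
      rw [xt_e2]
      rcases mul_eq_zero.1 this with h | h <;> simp [Par, h]
    · refine hND ![1, 0] ![0, 1] (by simp) (by simp) fun g => ?_
      have := (mul_eq_zero.1 (z1 g)).resolve_right hb
      rw [xt_e1]
      rcases mul_eq_zero.1 this with h | h <;> simp [Par, h]
  · push Not at hz
    obtain ⟨w, hw, hz⟩ := hz
    by_cases hw0 : w 0 0 = 0
    · refine ⟨h0, β, by rw [hh]; exact r2, ?_, w, hw, ?_⟩
      · intro γ hγ hγ'
        rw [hh, r3] at hγ
        rw [hγ.resolve_right hγ']; exact hab.symm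
      · intro h
        apply hz hw0
        have := congrFun (congrFun h 1) 1
        rw [hh] at this
        have hs : β - α ≠ 0 := sub_ne_zero.2 hne.symm
        have e : eigProj !![α, 0; 0, β] β = !![0, 0; 0, 1] := by
          ext i j; fin_cases i <;> fin_cases j <;> simp [eigProj, trace_fin_two, hs]
        rw [e] at this
        simpa [Matrix.mul_apply, Fin.sum_univ_two, Matrix.vecMul, dotProduct] using this
    · refine ⟨h0, α, by rw [hh]; exact r1, ?_, w, hw, ?_⟩
      · intro γ hγ hγ'
        rw [hh, r3] at hγ
        rw [hγ.resolve_left hγ']; exact hab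
      · intro h
        apply hw0
        have := congrFun (congrFun h 0) 0
        rw [hh] at this
        have hs : α - β ≠ 0 := sub_ne_zero.2 hne
        have e : eigProj !![α, 0; 0, β] α = !![1, 0; 0, 0] := by
          ext i j; fin_cases i <;> fin_cases j <;> simp [eigProj, trace_fin_two, hs]
        rw [e] at this
        simpa [Matrix.mul_apply, Fin.sum_univ_two, Matrix.vecMul, dotProduct] using this

lemma hasIV (hND : ND Ω ρ) (h0 : Γ) (α β : k) (hab : α ^ 2 ≠ β ^ 2)
    (ht : (ρ h0).val 0 0 + (ρ h0).val 1 1 = α + β)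
    (hd : (ρ h0).val 0 0 * (ρ h0).val 1 1 - (ρ h0).val 0 1 * (ρ h0).val 1 0 = α * β) :
    HasIV ρ := by
  obtain ⟨Q, hQ⟩ := exists_diag _ α β (by rintro rfl; exact hab rfl) ht hd
  exact hasIV_of_cjr ρ Q (hasIV_diag _ (ND_cjr (Ω := Ω) ρ Q hND) h0 α β hQ hab)

lemma average [Finite Γ] (B : Subgroup Γ) (hB : (B.index : k) ≠ 0)
    (c : Γ → Matrix (Fin 2) (Fin 2) k) (hc : Coc ρ c) (hcB : ∀ b ∈ B, c b = 0) : Cob ρ c := by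
  classical
  have hinv : ∀ g, ∀ b ∈ B, c (g * b) = c g := by
    intro g b hb; rw [hc.2, hcB b hb]; simp
  let f : Γ ⧸ B → Matrix (Fin 2) (Fin 2) k := Quotient.lift c (by
    intro a b hab
    rw [← Quotient.eq_iff_equiv] at hab
    have : a⁻¹ * b ∈ B := QuotientGroup.eq.1 hab
    rw [← hinv a _ this]; simp)
  have hf : ∀ g : Γ, f (g : Γ ⧸ B) = c g := fun g => rfl
  have : Fintype (Γ ⧸ B) := Fintype.ofFinite _
  have hcard : (Fintype.card (Γ ⧸ B) : k) = B.index := by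
    rw [Subgroup.index, Nat.card_eq_fintype_card]
  have hsm : ∀ g q, f (g • q) = c g + (ρ g).val * f q * ((ρ g)⁻¹).val := by
    intro g q
    induction q using QuotientGroup.induction_on with | H q => ?_
    rw [MulAction.Quotient.smul_coe, hf, hf, smul_eq_mul, hc.2]
  refine ⟨-((B.index : k)⁻¹ • ∑ q, f q), ?_, fun g => ?_⟩
  · rw [trace_neg, trace_smul, trace_sum, Finset.sum_eq_zero]
    · simp
    · intro q _
      induction q using QuotientGroup.induction_on with | H q => ?_
      rw [hf, hc.1]
  · have h1 : ∑ q, f (g • q) = ∑ q, f q := by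
      exact Equiv.sum_comp (MulAction.toPerm g) f
    simp only [hsm, Finset.sum_add_distrib, Finset.sum_const, Finset.card_univ,
      ← Finset.mul_sum, ← Finset.sum_mul] at h1
    rw [← Nat.cast_smul_eq_nsmul k, hcard] at h1
    rw [mul_neg, neg_mul, mul_smul_comm, smul_mul_assoc]
    nth_rw 2 [← h1]
    rw [smul_add, smul_smul, inv_mul_cancel₀ hB, one_smul]
    abel

lemma h0_of_ND [IsAlgClosed Ω] (h2 : (2 : Ω) ≠ 0) (hND : ND Ω ρ)
    (X : Matrix (Fin 2) (Fin 2) k) (hX : X.trace = 0)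
    (hc : ∀ g, (ρ g).val * X = X * (ρ g).val) : X = 0 := by
  by_contra hne
  have h2k : (2 : k) ≠ 0 := by
    intro h; apply h2; rw [← map_ofNat (algebraMap k Ω), h, map_zero]
  have hns : ¬ IsSc X := by
    rintro ⟨a, b, c⟩
    rw [trace_fin_two, c, ← two_mul] at hX
    have := (mul_eq_zero.1 hX).resolve_left h2k
    apply hne
    ext i j; fin_cases i <;> fin_cases j <;> simp [*]
  obtain ⟨δ, hδ⟩ := IsAlgClosed.exists_pow_nat_eq
    ((xt Ω X 0 0 - xt Ω X 1 1) ^ 2 + 4 * (xt Ω X 0 1 * xt Ω X 1 0)) (n := 2) (by norm_num)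
  obtain ⟨p, q, hp, hq, H, -⟩ := fix_pts h2 (xt Ω X) (by rwa [isSc_xt]) δ hδ
  refine hND p q hp hq fun g => ?_
  rw [← H _ (xt_mulVec_ne_zero _ hp), mulVec_mulVec, ← xt_mul, ← hc, xt_mul, ← mulVec_mulVec]
  exact ((H p hp).2 (Or.inl (by simp [Par, mul_comm]))).mulVec _

end Basic



section CaseA

variable {k Ω : Type*} [Field k] [Field Ω] [Algebra k Ω] {Γ : Type*} [Group Γ]
  (ρ : Γ →* GL (Fin 2) k)

lemma isSc_eq {A : Matrix (Fin 2) (Fin 2) k} (h : IsSc A) : A = A 0 0 • 1 := by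
  obtain ⟨h1, h2, h3⟩ := h
  ext i j; fin_cases i <;> fin_cases j <;> simp [*]

lemma order_l_unip (l : ℕ) [Fact l.Prime] [CharP k l] (hinj : Function.Injective ρ) (γ : Γ)
    (hγ : orderOf γ = l) : ¬ IsSc (ρ γ).val ∧ disc (ρ γ).val = 0 := by
  have hp : ((ρ γ).val) ^ l = 1 := by
    rw [← Units.val_pow_eq_pow_val, ← map_pow, ← hγ, pow_orderOf_eq_one]; simp
  constructor
  · intro h
    have h1 := isSc_eq h
    set a := (ρ γ).val 0 0
    rw [h1, _root_.smul_pow, one_pow] at hp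
    have h2 := congrFun (congrFun hp 0) 0
    simp at h2
    have h3 : (a - 1) ^ l = 0 := by rw [sub_pow_char, h2]; simp
    have h4 : a = 1 := sub_eq_zero.1 (pow_eq_zero_iff (Fact.out : l.Prime).ne_zero |>.1 h3)
    have : γ = 1 := by
      apply hinj; apply Units.ext; rw [h1, h4]; simp
    rw [this, orderOf_one] at hγ
    exact (Fact.out : l.Prime).ne_one hγ.symm
  · set N := (ρ γ).val - 1 with hN
    have hnil : N ^ l = 0 := by
      rw [hN, sub_pow_char_of_commute _ (Commute.one_right _), hp]; simp
    have ht : N.trace = 0 := (Matrix.isNilpotent_trace_of_isNilpotent ⟨l, hnil⟩).eq_zero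
    have hd : N.det = 0 := by
      have : N.det ^ l = 0 := by
        rw [← det_pow, hnil, det_zero]
      exact pow_eq_zero_iff (Fact.out : l.Prime).ne_zero |>.1 this
    rw [trace_fin_two] at ht
    rw [det_fin_two] at hd
    simp [hN] at ht hd
    rw [disc]
    linear_combination ((ρ γ).val 0 0 + (ρ γ).val 1 1 - 2) * ht - 4 * hd

theorem caseA [Finite Γ] [IsAlgClosed Ω] (l : ℕ) [Fact l.Prime] [CharP k l] (hl : 5 < l)
    (ζ : k) (hζ : IsPrimitiveRoot ζ 3) (hinj : Function.Injective ρ)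
    (hND : ND Ω ρ) (hss : ∀ γ, ¬ IsSc (ρ γ).val → disc (ρ γ).val ≠ 0) :
    (∀ N : Subgroup Γ, N.Normal → ∀ j : ℕ, Nat.card (Γ ⧸ N) ≠ l ^ (j + 1)) ∧
    (∀ c, Coc ρ c → Cob ρ c) ∧ HasIV ρ := by
  have hlc : ¬ l ∣ Nat.card Γ := by
    intro h
    obtain ⟨γ, hγ⟩ := exists_prime_orderOf_dvd_card' l h
    have := order_l_unip ρ l hinj γ hγ
    exact hss γ this.1 this.2
  have h2k : (2 : k) ≠ 0 := by
    intro h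
    have h : ((2 : ℕ) : k) = 0 := by exact_mod_cast h
    rw [CharP.cast_eq_zero_iff k l] at h
    have := Nat.le_of_dvd (by norm_num) h
    omega
  have h2 : (2 : Ω) ≠ 0 := by
    intro h; apply h2k
    apply (algebraMap k Ω).injective; rw [map_ofNat, h, map_zero]
  refine ⟨?_, ?_, ?_⟩
  · intro N hN j hj
    apply hlc
    exact (Dvd.intro_left (l ^ j) (by rw [hj, pow_succ])).trans (Subgroup.card_quotient_dvd_card N)
  · intro c hc
    refine average ρ ⊥ ?_ c hc ?_
    · rw [Subgroup.index_bot]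
      rwa [Ne, CharP.cast_eq_zero_iff k l]
    · intro b hb
      rw [Subgroup.mem_bot] at hb
      have := hc.2 1 1
      simp at this
      rw [hb, this]
  · obtain ⟨γ, h1, h3⟩ := tame_exists (Ω := Ω) ρ h2 hND hss
    set A := (ρ γ).val with hA
    have hA3 : (ρ (γ ^ 3)).val = A * A * A := by
      rw [map_pow, Units.val_pow_eq_pow_val, pow_three', hA]
    rw [hA3] at h3
    obtain ⟨e1, e2, e3⟩ := h3
    simp only [Matrix.mul_apply, Fin.sum_univ_two] at e1 e2 e3
    have ht : (A 0 0 + A 1 1) ^ 2 = A 0 0 * A 1 1 - A 0 1 * A 1 0 := by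
      by_contra hne
      have hne := sub_ne_zero.2 hne
      apply h1
      refine ⟨?_, ?_, ?_⟩
      · refine (mul_eq_zero.1 ?_).resolve_left hne
        linear_combination e1
      · refine (mul_eq_zero.1 ?_).resolve_left hne
        linear_combination e2
      · rw [← sub_eq_zero]
        refine (mul_eq_zero.1 ?_).resolve_left hne
        linear_combination e3
    have hdet : A 0 0 * A 1 1 - A 0 1 * A 1 0 ≠ 0 := by
      rw [← det_fin_two]
      exact ((Matrix.isUnit_iff_isUnit_det _).1 (ρ γ).isUnit).ne_zero
    have hz : 1 + ζ + ζ ^ 2 = 0 := by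
      have := hζ.geom_sum_eq_zero (by norm_num)
      simpa [Finset.sum_range_succ] using this
    have hz1 : ζ ≠ 1 := hζ.ne_one (by norm_num)
    have hz0 : ζ ≠ 0 := hζ.ne_zero (by norm_num)
    set t := A 0 0 + A 1 1 with htt
    refine hasIV (Ω := Ω) ρ hND γ (-t * ζ) (-t * ζ ^ 2) ?_ ?_ ?_
    · intro h
      have h4 : t ^ 2 * (ζ * (ζ - 1)) = 0 := by
        have h3 := hζ.pow_eq_one
        linear_combination h + t ^ 2 * ζ * h3
      rw [ht] at h4
      exact (mul_ne_zero hdet (mul_ne_zero hz0 (sub_ne_zero.2 hz1))) h4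
    · linear_combination t * hz
    · rw [← hA, ← ht]
      linear_combination (-t ^ 2) * hζ.pow_eq_one

end CaseA



section Arith
variable {k : Type*} [Field k]

lemma four_mem (l : ℕ) [Fact l.Prime] [CharP k l] (hl : 5 < l) (S : AddSubgroup k) [Finite S]
    (T : Subgroup kˣ) [Finite T] (hTS : ∀ t ∈ T, ∀ x ∈ S, (t : k) * x ∈ S)
    (hS : S ≠ ⊥) (hc : Nat.card S ≤ 2 * Nat.card T + 1) :
    3 ≤ Nat.card T ∧ (∃ t ∈ T, (t : k) = 4) ∧
    ∀ x0 ∈ S, x0 ≠ 0 → ∀ S' : AddSubgroup k, S' ≤ S → (∀ t ∈ T, (t : k) * x0 ∈ S') → S' = S := by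
  classical
  obtain ⟨x1, hx1, hx1'⟩ := S.ne_bot_iff_exists_ne_zero.1 hS |>.elim
    (fun a ha => (⟨a.1, a.2, fun h => ha (Subtype.ext h)⟩ : ∃ x ∈ S, x ≠ 0))
  have hlS : l ≤ Nat.card S := by
    have h1 : addOrderOf x1 = l := by
      apply addOrderOf_eq_prime
      · rw [nsmul_eq_mul, CharP.cast_eq_zero, zero_mul]
      · exact hx1'
    have h2 := addOrderOf_dvd_natCard (⟨x1, hx1⟩ : S)
    rw [← AddSubgroup.addOrderOf_coe, h1] at h2
    exact Nat.le_of_dvd Nat.card_pos h2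
  have n2 : (2 : k) ≠ 0 := by
    intro h
    have h : ((2 : ℕ) : k) = 0 := by exact_mod_cast h
    rw [CharP.cast_eq_zero_iff k l] at h
    have := Nat.le_of_dvd (by norm_num) h
    omega
  have hl7 : l ≠ 6 := by rintro rfl; exact absurd (Fact.out : (6).Prime) (by norm_num)
  refine ⟨by omega, ?_, ?_⟩
  · -- pigeonhole
    by_contra h4
    push Not at h4
    have h2 : ∀ t ∈ T, (t : k) ≠ 2 := by
      intro t ht h
      apply h4 (t * t) (mul_mem ht ht)
      rw [Units.val_mul, h]; norm_num
    have : Function.Injective (fun p : Option (T × Fin 3) =>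
        (match p with
        | none => 0
        | some (t, i) => ((t : kˣ) : k) * (2 ^ (i : ℕ) * x1) : k)) := by
      have hinj : ∀ (t t' : T) (i j : Fin 3), i < j →
          ((t : kˣ) : k) * (2 ^ (i : ℕ) * x1) ≠ ((t' : kˣ) : k) * (2 ^ (j : ℕ) * x1) := by
        intro t t' i j hij h
        have hm : (t : kˣ) * (t' : kˣ)⁻¹ ∈ T := mul_mem t.2 (inv_mem t'.2)
        have hv : (((t : kˣ) * (t' : kˣ)⁻¹ : kˣ) : k) * 2 ^ (i : ℕ) = 2 ^ (j : ℕ) := by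
          have ht' : ((t' : kˣ) : k) ≠ 0 := Units.ne_zero _
          rw [Units.val_mul, Units.val_inv_eq_inv_val]
          field_simp
          apply mul_right_cancel₀ hx1'
          linear_combination h
        fin_cases i <;> fin_cases j <;> simp at hij hv
        · exact h2 _ hm (by simpa using hv)
        · exact h4 _ hm (by rw [show (4 : k) = 2 ^ 2 by norm_num]; simpa using hv)
        · refine h2 _ hm ?_
          apply mul_right_cancel₀ n2
          rw [Units.val_mul, Units.val_inv_eq_inv_val]; linear_combination hv
      have hnz : ∀ (t : T) (i : Fin 3), ((t : kˣ) : k) * (2 ^ (i : ℕ) * x1) ≠ 0 :=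
        fun t i => mul_ne_zero (Units.ne_zero _) (mul_ne_zero (pow_ne_zero _ n2) hx1')
      rintro (_ | ⟨t, i⟩) (_ | ⟨t', j⟩) h
      · rfl
      · exact absurd h.symm (hnz _ _)
      · exact absurd h (hnz _ _)
      · dsimp only at h
        rcases lt_trichotomy i j with hij | rfl | hij
        · exact absurd h (hinj _ _ _ _ hij)
        · have := mul_right_cancel₀ (mul_ne_zero (pow_ne_zero _ n2) hx1') h
          rw [Subtype.ext (Units.ext this)]
        · exact absurd h.symm (hinj _ _ _ _ hij)
    have hmem : ∀ p : Option (T × Fin 3),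
        (match p with
        | none => 0
        | some (t, i) => ((t : kˣ) : k) * (2 ^ (i : ℕ) * x1) : k) ∈ S := by
      rintro (_ | ⟨t, i⟩)
      · exact zero_mem _
      · dsimp only
        apply hTS _ t.2
        have := S.nsmul_mem hx1 (2 ^ (i : ℕ))
        simpa using this
    have hle := Nat.card_le_card_of_injective (fun p => (⟨_, hmem p⟩ : S))
      (fun p q h => this (congrArg Subtype.val h))
    rw [Finite.card_option, Nat.card_prod, Nat.card_fin] at hle
    have : 0 < Nat.card T := Nat.card_pos
    omega
  · intro x0 hx0 hx0' S' hS' hT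
    have : Finite S' := Finite.of_injective _ (AddSubgroup.inclusion_injective hS')
    have hinj : Nat.card (Option T) ≤ Nat.card S' := by
      refine Nat.card_le_card_of_injective
        (fun p => match p with | none => 0 | some t => (⟨_, hT t t.2⟩ : S')) ?_
      rintro (_ | t) (_ | t') h
      · rfl
      · have := congrArg Subtype.val h
        exact absurd this.symm (mul_ne_zero (Units.ne_zero _) hx0')
      · have := congrArg Subtype.val h
        exact absurd this (mul_ne_zero (Units.ne_zero _) hx0')
      · have := congrArg Subtype.val h
        have := mul_right_cancel₀ hx0' this
        rw [Subtype.ext (Units.ext this)]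
    rw [Finite.card_option] at hinj
    obtain ⟨m, hm⟩ := AddSubgroup.card_dvd_of_le hS'
    have hm1 : m < 2 := by
      by_contra h
      push Not at h
      have := Nat.mul_le_mul_left (Nat.card S') h
      omega
    have hm0 : m ≠ 0 := by
      rintro rfl
      have : 0 < Nat.card S := Nat.card_pos
      omega
    obtain rfl : m = 1 := by omega
    exact AddSubgroup.eq_of_le_of_card_ge hS' (by omega)

end Arith

section Borel

variable {k Ω : Type*} [Field k] [Field Ω] [Algebra k Ω] {Γ : Type*} [Group Γ]
  (ρ : Γ →* GL (Fin 2) k)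

/-- the Borel subgroup -/
def Bor : Subgroup Γ where
  carrier := {γ | (ρ γ).val 1 0 = 0}
  mul_mem' := by
    intro a b ha hb
    simp only [Set.mem_ofPred_eq] at *
    simp [Matrix.mul_apply, Fin.sum_univ_two, ha, hb]
  one_mem' := by simp
  inv_mem' := by
    intro a ha
    simp only [Set.mem_ofPred_eq] at *
    rw [map_inv, inv_val]; simp [ha]

lemma mem_Bor {γ : Γ} : γ ∈ Bor ρ ↔ (ρ γ).val 1 0 = 0 := Iff.rfl

lemma det_ne (g : GL (Fin 2) k) : g.val 0 0 * g.val 1 1 - g.val 0 1 * g.val 1 0 ≠ 0 := by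
  rw [← det_fin_two]
  exact ((Matrix.isUnit_iff_isUnit_det _).1 g.isUnit).ne_zero

lemma tri_ne {g : GL (Fin 2) k} (h : g.val 1 0 = 0) : g.val 0 0 ≠ 0 ∧ g.val 1 1 ≠ 0 := by
  have := det_ne g
  rw [h, mul_zero, sub_zero] at this
  exact ⟨left_ne_zero_of_mul this, right_ne_zero_of_mul this⟩

/-- ratio of the diagonal entries -/
noncomputable def chi : Bor ρ →* kˣ :=
  MonoidHom.toHomUnits
  { toFun := fun γ => (ρ γ).val 0 0 / (ρ γ).val 1 1
    map_one' := by simp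
    map_mul' := by
      rintro ⟨a, ha⟩ ⟨b, hb⟩
      rw [mem_Bor] at ha hb
      have := tri_ne ha
      have := tri_ne hb
      simp [Matrix.mul_apply, Fin.sum_univ_two, ha, hb]
      field_simp }

lemma chi_apply (γ : Bor ρ) : (chi ρ γ : k) = (ρ γ).val 0 0 / (ρ γ).val 1 1 := rfl

/-- translation parts of unipotents -/
def Sad : AddSubgroup k where
  carrier := {x | ∃ γ, (ρ γ).val 1 0 = 0 ∧ (ρ γ).val 0 0 = (ρ γ).val 1 1 ∧
    (ρ γ).val 0 1 = x * (ρ γ).val 1 1}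
  zero_mem' := ⟨1, by simp⟩
  add_mem' := by
    rintro x y ⟨a, a1, a2, a3⟩ ⟨b, b1, b2, b3⟩
    refine ⟨a * b, ?_⟩
    simp [Matrix.mul_apply, Fin.sum_univ_two, a1, b1, a2, b2, a3, b3]
    ring
  neg_mem' := by
    rintro x ⟨a, a1, a2, a3⟩
    refine ⟨a⁻¹, ?_⟩
    have := (tri_ne a1).2
    rw [map_inv, inv_val]
    simp [a1, a2, a3]
    ring

lemma mem_Sad {x : k} : x ∈ Sad ρ ↔ ∃ γ, (ρ γ).val 1 0 = 0 ∧ (ρ γ).val 0 0 = (ρ γ).val 1 1 ∧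
    (ρ γ).val 0 1 = x * (ρ γ).val 1 1 := Iff.rfl

instance [Finite Γ] : Finite (Sad ρ) := by
  have : ((Sad ρ : Set k)) ⊆ Set.range (fun γ : Γ => (ρ γ).val 0 1 / (ρ γ).val 1 1) := by
    rintro x ⟨γ, h1, h2, h3⟩
    refine ⟨γ, ?_⟩
    have := (tri_ne h1).2
    dsimp only
    rw [h3]; field_simp
  exact ((Set.finite_range _).subset this)

instance [Finite Γ] : Finite (chi ρ).range :=
  Finite.of_surjective _ (MonoidHom.rangeRestrict_surjective _)

lemma T_smul_S : ∀ t ∈ (chi ρ).range, ∀ x ∈ Sad ρ, (t : k) * x ∈ Sad ρ := by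
  rintro _ ⟨⟨g, hg⟩, rfl⟩ x ⟨u, u1, u2, u3⟩
  rw [mem_Bor] at hg
  obtain ⟨h1, h1'⟩ := tri_ne hg
  obtain ⟨h2, h2'⟩ := tri_ne u1
  refine ⟨g * u * g⁻¹, ?_⟩
  rw [chi_apply, map_mul, map_mul, map_inv, Units.val_mul, Units.val_mul, inv_val, det_fin_two]
  simp [Matrix.mul_apply, Fin.sum_univ_two, hg, u1, u2, u3]
  field_simp
  exact ⟨trivial, by ring⟩

open MulAction
open scoped LinearAlgebra.Projectivization

theorem card_bound [Finite Γ] [IsAlgClosed Ω] (h2 : (2 : Ω) ≠ 0) (hND : ND Ω ρ)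
    (hS : Sad ρ ≠ ⊥) : Nat.card (Sad ρ) ≤ 2 * Nat.card (chi ρ).range + 1 := by
  classical
  set R := ((permHom Ω).comp ρ).range
  have he1 : (![1, 0] : Fin 2 → Ω) ≠ 0 := by simp
  set x : ℙ Ω (Fin 2 → Ω) := Projectivization.mk Ω ![1, 0] he1 with hx
  let π : Γ →* R := ((permHom Ω).comp ρ).rangeRestrict
  have hπ : Function.Surjective π := MonoidHom.rangeRestrict_surjective _
  have hπ1 : ∀ γ, π γ = 1 ↔ IsSc (ρ γ).val := by
    intro γ
    rw [← permHom_eq_one_iff (Ω := Ω)]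
    exact Subtype.ext_iff
  have hst : ∀ γ, π γ • x = x ↔ (ρ γ).val 1 0 = 0 := by
    intro γ
    change permHom Ω (ρ γ) x = x ↔ _
    rw [hx, permHom_mk, mk_eq_iff_par, xt_e1]
    simp [Par]
    rw [eq_comm, map_eq_zero]
  let V : Subgroup Γ := ((chi ρ).ker).map (Bor ρ).subtype
  have hV : ∀ γ, γ ∈ V ↔ (ρ γ).val 1 0 = 0 ∧ (ρ γ).val 0 0 = (ρ γ).val 1 1 := by
    intro γ
    simp only [V, Subgroup.mem_map, MonoidHom.mem_ker, Units.ext_iff, chi_apply, Units.val_one]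
    constructor
    · rintro ⟨⟨g, hg⟩, h, rfl⟩
      refine ⟨hg, ?_⟩
      exact eq_of_div_eq_one h
    · rintro ⟨h1, h2⟩
      refine ⟨⟨γ, h1⟩, ?_, rfl⟩
      change (ρ γ).val 0 0 / (ρ γ).val 1 1 = 1
      rw [h2, div_self (tri_ne h1).2]
  let U : Subgroup R := V.map π
  have hfix : ∀ γ : R, γ ≠ 1 → (fixedBy (ℙ Ω (Fin 2 → Ω)) γ).ncard = 1 ∨
      (fixedBy (ℙ Ω (Fin 2 → Ω)) γ).ncard = 2 := by
    intro γ hγ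
    obtain ⟨γ, rfl⟩ := hπ γ
    have := ncard_fixedBy (Ω := Ω) ρ h2 γ (by rwa [Ne, hπ1] at hγ)
    have : (fixedBy (ℙ Ω (Fin 2 → Ω)) (π γ)).ncard = if disc (ρ γ).val = 0 then 1 else 2 := this
    rw [this]
    split_ifs <;> simp
  have hU : ∀ γ, γ ∈ U ↔ γ = 1 ∨ fixedBy (ℙ Ω (Fin 2 → Ω)) γ = {x} := by
    intro γ
    constructor
    · rintro ⟨γ, hγ, rfl⟩
      by_cases h : π γ = 1
      · left; exact h
      · right
        have hγ := (hV γ).1 hγ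
        have h3 : (fixedBy (ℙ Ω (Fin 2 → Ω)) (π γ)).ncard =
          if disc (ρ γ).val = 0 then 1 else 2 :=
            ncard_fixedBy (Ω := Ω) ρ h2 γ (by rwa [hπ1] at h)
        rw [if_pos (by rw [disc, hγ.1, hγ.2]; ring), Set.ncard_eq_one] at h3
        obtain ⟨y, hy⟩ := h3
        have : x ∈ fixedBy (ℙ Ω (Fin 2 → Ω)) (π γ) := (hst γ).2 hγ.1
        rw [hy] at this ⊢
        rw [Set.mem_singleton_iff.1 this]
    · rintro (rfl | h)
      · exact one_mem _
      · obtain ⟨γ, rfl⟩ := hπ γ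
        refine ⟨γ, (hV γ).2 ?_, rfl⟩
        by_cases hs : IsSc (ρ γ).val
        · exact ⟨hs.2.1, hs.2.2⟩
        · have h3 : (fixedBy (ℙ Ω (Fin 2 → Ω)) (π γ)).ncard =
            if disc (ρ γ).val = 0 then 1 else 2 := ncard_fixedBy (Ω := Ω) ρ h2 γ hs
          rw [h, Set.ncard_singleton] at h3
          have hd : disc (ρ γ).val = 0 := by
            by_contra hd; rw [if_neg hd] at h3; omega
          have h4 : x ∈ fixedBy (ℙ Ω (Fin 2 → Ω)) (π γ) := by rw [h]; rfl
          have h5 := (hst γ).1 h4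
          refine ⟨h5, ?_⟩
          rw [disc, h5] at hd
          simp at hd
          exact sub_eq_zero.1 hd
  have hSU : Nat.card (Sad ρ) ≤ Nat.card U := by
    have hch : ∀ u : U, ∃ γ, γ ∈ V ∧ π γ = u := fun u => u.2
    choose f hf hf' using hch
    have hm : ∀ u, (ρ (f u)).val 0 1 / (ρ (f u)).val 1 1 ∈ Sad ρ := by
      intro u
      have h := (hV _).1 (hf u)
      have := (tri_ne h.1).2
      exact ⟨f u, h.1, h.2, by field_simp⟩
    refine Nat.card_le_card_of_surjective (fun u => (⟨_, hm u⟩ : Sad ρ)) ?_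
    rintro ⟨y, γ, g1, g2, g3⟩
    refine ⟨⟨π γ, γ, (hV γ).2 ⟨g1, g2⟩, rfl⟩, ?_⟩
    set u : U := ⟨π γ, γ, (hV γ).2 ⟨g1, g2⟩, rfl⟩
    have h1 : π ((f u)⁻¹ * γ) = 1 := by rw [map_mul, map_inv, hf']; simp [u]
    rw [hπ1] at h1
    obtain ⟨v1, v2⟩ := (hV _).1 (hf u)
    have := (tri_ne v1).2
    apply Subtype.ext
    dsimp only
    have h3 : ρ γ = ρ (f u) * ρ ((f u)⁻¹ * γ) := by rw [← map_mul]; simp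
    obtain ⟨s1, s2, s3⟩ := h1
    set D := ρ ((f u)⁻¹ * γ)
    have hD := (tri_ne s2).2
    rw [h3, Units.val_mul] at g3
    simp [Matrix.mul_apply, Fin.sum_univ_two, s1, s2, s3, v1] at g3
    rw [div_eq_iff this]
    apply mul_right_cancel₀ hD
    linear_combination g3
  have hU1 : 1 < Nat.card U := by
    refine lt_of_lt_of_le ?_ hSU
    rw [← not_le, AddSubgroup.card_le_one_iff_eq_bot]
    exact hS
  have hcount := count_wild hfix x U hU hU1 (fun y => ND_orbit hND y)
  have hstab : Nat.card (stabilizer R x) ≤ Nat.card U * Nat.card (chi ρ).range := by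
    have hle : U ≤ stabilizer R x := by
      rintro _ ⟨γ, hγ, rfl⟩
      exact (hst γ).2 ((hV γ).1 hγ).1
    rw [← Nat.card_congr (Subgroup.subgroupOfEquivOfLe hle).toEquiv,
      ← Subgroup.card_mul_index (U.subgroupOf (stabilizer R x))]
    apply Nat.mul_le_mul_left
    have hch : ∀ t : (chi ρ).range, ∃ γ : Bor ρ, chi ρ γ = t := fun t => t.2
    choose f hf using hch
    refine Nat.card_le_card_of_surjective (fun t : (chi ρ).range =>
      (QuotientGroup.mk (⟨π (f t), (hst _).2 (f t).2⟩ : stabilizer R x))) ?_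
    intro q
    induction q using QuotientGroup.induction_on with | H q => ?_
    obtain ⟨q, hq⟩ := q
    obtain ⟨γ, rfl⟩ := hπ q
    have hγ := (hst γ).1 hq
    refine ⟨⟨chi ρ ⟨γ, hγ⟩, ⟨_, rfl⟩⟩, ?_⟩
    rw [QuotientGroup.eq, Subgroup.mem_subgroupOf]
    set t : (chi ρ).range := ⟨chi ρ ⟨γ, hγ⟩, ⟨_, rfl⟩⟩
    have h1 : (f t)⁻¹ * ⟨γ, hγ⟩ ∈ (chi ρ).ker := by
      rw [MonoidHom.mem_ker, map_mul, map_inv, hf]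
      simp [t]
    refine ⟨(f t)⁻¹ * γ, ⟨_, h1, rfl⟩, ?_⟩
    have e : π ((f t : Γ)⁻¹ * γ) = (π (f t))⁻¹ * π γ := by rw [map_mul, map_inv]
    exact e
  have h5 := hcount.trans (Nat.mul_le_mul_left 2 hstab)
  have h6 : Nat.card U - 1 ≤ 2 * Nat.card (chi ρ).range := by
    have h7 : Nat.card U * (Nat.card U - 1) ≤ Nat.card U * (2 * Nat.card (chi ρ).range) := by
      refine h5.trans (le_of_eq ?_)
      ring
    exact Nat.le_of_mul_le_mul_left h7 (by omega)
  omega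

end Borel



section CaseB

variable {k Ω : Type*} [Field k] [Field Ω] [Algebra k Ω] {Γ : Type*} [Group Γ]
  (ρ : Γ →* GL (Fin 2) k)

/-- unipotent (up to scalars) with coordinate `x` -/
def UC (x : k) (γ : Γ) : Prop := (ρ γ).val 1 0 = 0 ∧ (ρ γ).val 0 0 = (ρ γ).val 1 1 ∧
    (ρ γ).val 0 1 = x * (ρ γ).val 1 1

/-- diagonal with ratio `y` -/
def DC (y : k) (γ : Γ) : Prop := (ρ γ).val 1 0 = 0 ∧ (ρ γ).val 0 1 = 0 ∧
    (ρ γ).val 0 0 = y * (ρ γ).val 1 1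

variable {ρ}

lemma UC.mul {x y : k} {a b : Γ} (ha : UC ρ x a) (hb : UC ρ y b) : UC ρ (x + y) (a * b) := by
  obtain ⟨a1, a2, a3⟩ := ha
  obtain ⟨b1, b2, b3⟩ := hb
  simp [UC, Matrix.mul_apply, Fin.sum_univ_two, a1, b1, a2, b2, a3, b3]
  ring

lemma UC.one : UC ρ 0 (1 : Γ) := by simp [UC]

lemma UC.pow {x : k} {a : Γ} (ha : UC ρ x a) (n : ℕ) : UC ρ (n * x) (a ^ n) := by
  induction n with
  | zero => simpa using UC.one
  | succ n ih => rw [pow_succ]; push_cast; rw [add_mul, one_mul]; exact ih.mul ha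

lemma UC.inv {x : k} {a : Γ} (ha : UC ρ x a) : UC ρ (-x) a⁻¹ := by
  obtain ⟨a1, a2, a3⟩ := ha
  have := (tri_ne a1).2
  simp only [UC]
  rw [map_inv, inv_val]
  simp [a1, a2, a3]
  ring

lemma UC.ne {x : k} {a : Γ} (ha : UC ρ x a) : (ρ a).val 1 1 ≠ 0 := (tri_ne ha.1).2

lemma UC.dc {a : Γ} (ha : UC ρ 0 a) : DC ρ 1 a := ⟨ha.1, by simpa using ha.2.2, by simpa using ha.2.1⟩

lemma DC.uc {a : Γ} (ha : DC ρ 1 a) : UC ρ 0 a := ⟨ha.1, by simpa using ha.2.2, by simpa using ha.2.1⟩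

lemma DC.ne {x : k} {a : Γ} (ha : DC ρ x a) : (ρ a).val 1 1 ≠ 0 ∧ x ≠ 0 := by
  have := tri_ne ha.1
  refine ⟨this.2, ?_⟩
  rintro rfl
  exact this.1 (by simpa using ha.2.2)

lemma DC.mul {x y : k} {a b : Γ} (ha : DC ρ x a) (hb : DC ρ y b) : DC ρ (x * y) (a * b) := by
  obtain ⟨a1, a2, a3⟩ := ha
  obtain ⟨b1, b2, b3⟩ := hb
  simp [DC, Matrix.mul_apply, Fin.sum_univ_two, a1, b1, a2, b2, a3, b3]
  ring

lemma DC.one : DC ρ 1 (1 : Γ) := by simp [DC]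

lemma DC.inv {x : k} {a : Γ} (ha : DC ρ x a) : DC ρ x⁻¹ a⁻¹ := by
  have h1 := ha.ne.1
  have h2 := ha.ne.2
  obtain ⟨a1, a2, a3⟩ := ha
  simp only [DC]
  rw [map_inv, inv_val]
  simp [a1, a2, a3]
  field_simp

lemma DC.pow {x : k} {a : Γ} (ha : DC ρ x a) (n : ℕ) : DC ρ (x ^ n) (a ^ n) := by
  induction n with
  | zero => simpa using DC.one
  | succ n ih => rw [pow_succ, pow_succ]; exact ih.mul ha

lemma UC.conj {x y : k} {u b : Γ} (hu : UC ρ x u) (hb : DC ρ y b) :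
    UC ρ (y * x) (b * u * b⁻¹) := by
  have h1 := hb.ne.1
  have h2 := hb.ne.2
  have h3 := hu.ne
  obtain ⟨a1, a2, a3⟩ := hu
  obtain ⟨b1, b2, b3⟩ := hb
  simp only [UC]
  rw [map_mul, map_mul, map_inv, Units.val_mul, Units.val_mul, inv_val, det_fin_two]
  simp [Matrix.mul_apply, Fin.sum_univ_two, a1, b1, a2, b2, a3, b3]
  field_simp
  exact ⟨trivial, trivial⟩

lemma UC.mat {x : k} {u : Γ} (hu : UC ρ x u) (M : Matrix (Fin 2) (Fin 2) k) :
    (ρ u).val * M * ((ρ u)⁻¹).val =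
      !![M 0 0 + x * M 1 0, M 0 1 + x * M 1 1 - x * (M 0 0 + x * M 1 0);
        M 1 0, M 1 1 - x * M 1 0] := by
  have h3 := hu.ne
  obtain ⟨a1, a2, a3⟩ := hu
  rw [inv_val, det_fin_two]
  ext i j
  fin_cases i <;> fin_cases j <;>
    simp [Matrix.mul_apply, Fin.sum_univ_two, a1, a2, a3] <;> field_simp <;> ring

lemma DC.mat {y : k} {u : Γ} (hu : DC ρ y u) (M : Matrix (Fin 2) (Fin 2) k) :
    (ρ u).val * M * ((ρ u)⁻¹).val = !![M 0 0, y * M 0 1; y⁻¹ * M 1 0, M 1 1] := by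
  have h1 := hu.ne.1
  have h2 := hu.ne.2
  obtain ⟨a1, a2, a3⟩ := hu
  rw [inv_val, det_fin_two]
  ext i j
  fin_cases i <;> fin_cases j <;>
    simp [Matrix.mul_apply, Fin.sum_univ_two, a1, a2, a3] <;> field_simp

variable [Finite Γ] (l : ℕ) [Fact l.Prime] [CharP k l]

lemma DC.order (hinj : Function.Injective ρ) {y : k} {a : Γ} (ha : DC ρ y a) :
    ¬ l ∣ orderOf a := by
  rintro ⟨m, hm⟩
  have hpos := orderOf_pos a
  have hm0 : m ≠ 0 := by rintro rfl; omega
  have h1 : orderOf (a ^ m) = l := by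
    rw [orderOf_pow_of_dvd hm0 ⟨l, by rw [hm, mul_comm]⟩, hm, Nat.mul_div_cancel _ (by omega)]
  obtain ⟨h2, h3⟩ := order_l_unip ρ l hinj _ h1
  obtain ⟨d1, d2, d3⟩ := ha.pow m
  apply h2
  refine ⟨d2, d1, ?_⟩
  rw [disc, d1, d2, mul_zero, mul_zero, add_zero, sq_eq_zero_iff] at h3
  exact sub_eq_zero.1 h3

lemma index_Bor (hinj : Function.Injective ρ) {x : k} {γ : Γ} (hγ : UC ρ x γ) (hx : x ≠ 0) :
    (Bor ρ).index ≡ 1 [MOD l] := by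
  have hdvd : l ∣ orderOf γ := by
    have h := (hγ.pow (orderOf γ)).2.2
    rw [pow_orderOf_eq_one] at h
    simp [hx] at h
    rwa [CharP.cast_eq_zero_iff k l] at h
  obtain ⟨m, hm⟩ := hdvd
  have hpos := orderOf_pos γ
  have hm0 : m ≠ 0 := by rintro rfl; omega
  have h1 : orderOf (γ ^ m) = l := by
    rw [orderOf_pow_of_dvd hm0 ⟨l, by rw [hm, mul_comm]⟩, hm, Nat.mul_div_cancel _ (by omega)]
  obtain ⟨h2, -⟩ := order_l_unip ρ l hinj _ h1
  have hu := hγ.pow m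
  set u := γ ^ m
  set z := (m : k) * x
  have hz : z ≠ 0 := by
    intro h0
    rw [h0] at hu
    exact h2 ⟨hu.dc.2.1, hu.1, hu.2.1⟩
  have hp : IsPGroup l (Subgroup.zpowers u) := by
    apply IsPGroup.of_card (n := 1)
    rw [Nat.card_zpowers, h1, pow_one]
  have := hp.card_modEq_card_fixedPoints (Γ ⧸ Bor ρ)
  rw [Subgroup.index]
  refine this.trans ?_
  have hfp : MulAction.fixedPoints (Subgroup.zpowers u) (Γ ⧸ Bor ρ) =
      {((1 : Γ) : Γ ⧸ Bor ρ)} := by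
    ext q
    induction q using QuotientGroup.induction_on with | H g => ?_
    rw [MulAction.mem_fixedPoints, Set.mem_singleton_iff]
    constructor
    · intro h
      have h := h ⟨u, Subgroup.mem_zpowers u⟩
      have h : ((u * g : Γ) : Γ ⧸ Bor ρ) = (g : Γ ⧸ Bor ρ) := h
      rw [eq_comm, QuotientGroup.eq, mem_Bor] at h
      rw [eq_comm, QuotientGroup.eq, inv_one, one_mul, mem_Bor]
      have hd := det_ne (ρ g)
      have hn := hu.ne
      obtain ⟨a1, a2, a3⟩ := hu
      rw [map_mul, map_mul, Units.val_mul, Units.val_mul, map_inv, inv_val, det_fin_two] at h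
      simp [Matrix.mul_apply, Fin.sum_univ_two, a1, a2, a3] at h
      field_simp at h
      have : (z * (ρ u).val 1 1) * ((ρ g).val 1 0) ^ 2 = 0 := by
        linear_combination -h
      have := (mul_eq_zero.1 this).resolve_left (mul_ne_zero hz hn)
      exact pow_eq_zero_iff two_ne_zero |>.1 this
    · intro h v
      rw [h]
      obtain ⟨n, hn⟩ := v.2
      change ((v.1 * 1 : Γ) : Γ ⧸ Bor ρ) = _
      rw [eq_comm, QuotientGroup.eq, inv_one, one_mul, mul_one, ← hn]
      exact zpow_mem (show u ∈ Bor ρ from hu.1) n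
  rw [hfp, Nat.card_coe_set_eq, Set.ncard_singleton]

end CaseB



section CaseB2

set_option linter.unusedSectionVars false
set_option linter.unusedVariables false

variable {k Ω : Type*} [Field k] [Field Ω] [Algebra k Ω] {Γ : Type*} [Group Γ]
  {ρ : Γ →* GL (Fin 2) k} [Finite Γ] (l : ℕ) [Fact l.Prime] [CharP k l]

lemma Coc.sub_cob {c : Γ → Matrix (Fin 2) (Fin 2) k} (hc : Coc ρ c)
    (X : Matrix (Fin 2) (Fin 2) k) (hX : X.trace = 0) :
    Coc ρ (fun g => c g - ((ρ g).val * X * ((ρ g)⁻¹).val - X)) := by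
  constructor
  · intro g
    rw [trace_sub, trace_sub, trace_cj, hc.1, sub_self, sub_self]
  · intro g h
    simp only [hc.2, map_mul, Units.val_mul, _root_.mul_inv_rev, mul_sub, sub_mul, mul_assoc]
    abel

lemma Cob.of_sub {c : Γ → Matrix (Fin 2) (Fin 2) k}
    {X : Matrix (Fin 2) (Fin 2) k} (hX : X.trace = 0)
    (h : Cob ρ (fun g => c g - ((ρ g).val * X * ((ρ g)⁻¹).val - X))) : Cob ρ c := by
  obtain ⟨Y, hY, hY'⟩ := h
  refine ⟨Y + X, by rw [trace_add, hX, hY, add_zero], fun g => ?_⟩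
  have := hY' g
  rw [sub_eq_iff_eq_add] at this
  rw [this, mul_add, add_mul]
  abel

lemma Coc.one {c : Γ → Matrix (Fin 2) (Fin 2) k} (hc : Coc ρ c) : c 1 = 0 := by
  have := hc.2 1 1
  simpa using this

variable (ρ) in
/-- diagonal subgroup -/
def Dg : Subgroup Γ where
  carrier := {γ | ∃ y, DC ρ y γ}
  mul_mem' := by rintro a b ⟨x, hx⟩ ⟨y, hy⟩; exact ⟨_, hx.mul hy⟩
  one_mem' := ⟨_, DC.one⟩
  inv_mem' := by rintro a ⟨x, hx⟩; exact ⟨_, hx.inv⟩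

lemma kill_Dg (l : ℕ) [Fact l.Prime] [CharP k l] (hinj : Function.Injective ρ) {c : Γ → Matrix (Fin 2) (Fin 2) k} (hc : Coc ρ c) :
    ∃ X : Matrix (Fin 2) (Fin 2) k, X.trace = 0 ∧
      ∀ g ∈ Dg ρ, c g - ((ρ g).val * X * ((ρ g)⁻¹).val - X) = 0 := by
  have hc' : Coc (ρ.comp (Dg ρ).subtype) (fun g => c g) := ⟨fun g => hc.1 _, fun g h => hc.2 _ _⟩
  obtain ⟨X, hX, hX'⟩ := average (ρ.comp (Dg ρ).subtype) ⊥ (by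
    rw [Subgroup.index_bot, Ne, CharP.cast_eq_zero_iff k l]
    intro h
    obtain ⟨γ, hγ⟩ := exists_prime_orderOf_dvd_card' l h
    obtain ⟨y, hy⟩ := γ.2
    apply hy.order l hinj
    rw [← hγ, Subgroup.orderOf_coe]) _ hc' (by
      intro b hb
      rw [Subgroup.mem_bot] at hb
      rw [hb]; exact hc.one)
  refine ⟨X, hX, fun g hg => ?_⟩
  rw [sub_eq_zero]
  exact hX' ⟨g, hg⟩

lemma nat_ne (hl : 5 < l) : (2 : k) ≠ 0 ∧ (3 : k) ≠ 0 ∧ (15 : k) ≠ 0 := by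
  have h : ∀ n : ℕ, ¬ l ∣ n → (n : k) ≠ 0 := by
    intro n hn; rwa [Ne, CharP.cast_eq_zero_iff k l]
  have h2 : ¬ l ∣ 2 := fun h => by have := Nat.le_of_dvd (by norm_num) h; omega
  have h3 : ¬ l ∣ 3 := fun h => by have := Nat.le_of_dvd (by norm_num) h; omega
  have h5 : ¬ l ∣ 5 := fun h => by have := Nat.le_of_dvd (by norm_num) h; omega
  have h15 : ¬ l ∣ 15 := fun h => by
    rw [show 15 = 3 * 5 by norm_num, (Fact.out : l.Prime).dvd_mul] at h
    tauto
  refine ⟨?_, ?_, ?_⟩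
  · exact_mod_cast h 2 h2
  · exact_mod_cast h 3 h3
  · exact_mod_cast h 15 h15

/-- data available in the wild case -/
structure Wild (ρ : Γ →* GL (Fin 2) k) (b0 : Γ) (y0 : k) : Prop where
  dc : DC ρ y0 b0
  sq : y0 ^ 2 ≠ 1
  gen : ∀ g, (ρ g).val 1 0 = 0 → ∃ (n : ℕ) (u : Γ) (x : k), UC ρ x u ∧ g = b0 ^ n * u
  four : ∃ n : ℕ, y0 ^ n = 4
  ne : ∃ (u : Γ) (x : k), UC ρ x u ∧ x ≠ 0
  clos : ∀ x0 ∈ Sad ρ, x0 ≠ 0 → ∀ S' : AddSubgroup k, S' ≤ Sad ρ →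
    (∀ n : ℕ, y0 ^ n * x0 ∈ S') → S' = Sad ρ

lemma Wild.index {b0 : Γ} {y0 : k} (W : Wild ρ b0 y0) (hinj : Function.Injective ρ) :
    (Bor ρ).index ≡ 1 [MOD l] := by
  obtain ⟨u, x, hu, hx⟩ := W.ne
  exact index_Bor l hinj hu hx

lemma Wild.no_quot {b0 : Γ} {y0 : k} (W : Wild ρ b0 y0) (hl : 5 < l)
    (hinj : Function.Injective ρ) (N : Subgroup Γ) (hN : N.Normal) (j : ℕ) :
    Nat.card (Γ ⧸ N) ≠ l ^ (j + 1) := by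
  intro hj
  have hlp : l.Prime := Fact.out
  have hmem : ∀ (g : Γ) (m : ℕ), ¬ l ∣ m → g ^ m ∈ N → g ∈ N := by
    intro g m hm hg
    rw [← QuotientGroup.eq_one_iff] at hg ⊢
    have h1 : orderOf (g : Γ ⧸ N) ∣ m := orderOf_dvd_of_pow_eq_one (by exact_mod_cast hg)
    have h2 : orderOf (g : Γ ⧸ N) ∣ l ^ (j + 1) := hj ▸ orderOf_dvd_natCard _
    rw [← orderOf_eq_one_iff, ← Nat.dvd_one]
    have : Nat.Coprime m (l ^ (j + 1)) :=
      Nat.Coprime.pow_right _ ((Nat.Prime.coprime_iff_not_dvd hlp).2 hm).symm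
    rw [← this]
    exact Nat.dvd_gcd h1 h2
  have hD : ∀ (y : k) (g : Γ), DC ρ y g → g ∈ N := by
    intro y g hg
    exact hmem g (orderOf g) (hg.order l hinj) (by rw [pow_orderOf_eq_one]; exact one_mem _)
  have hU : ∀ (x : k) (g : Γ), UC ρ x g → g ∈ N := by
    intro x u hu
    obtain ⟨n, hn⟩ := W.four
    have hb := W.dc.pow n
    rw [hn] at hb
    have h1 : b0 ^ n * u * (b0 ^ n)⁻¹ * u⁻¹ ∈ N := by
      have : u * (b0 ^ n)⁻¹ * u⁻¹ ∈ N := hN.conj_mem _ (inv_mem (hD _ _ hb)) u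
      simpa [mul_assoc] using mul_mem (hD _ _ hb) this
    have h2 : UC ρ (4 * x + -x) (b0 ^ n * u * (b0 ^ n)⁻¹ * u⁻¹) := (hu.conj hb).mul hu.inv
    have h3 := (hu.pow 3).mul h2.inv
    have h4 := hD _ _ (UC.dc (show UC ρ 0 _ by convert h3 using 1; push_cast; ring))
    have h5 := mul_mem h4 h1
    simp only [inv_mul_cancel_right] at h5
    refine hmem u 3 ?_ h5
    intro h; have := Nat.le_of_dvd (by norm_num) h; omega
  have hle : Bor ρ ≤ N := by
    intro g hg
    obtain ⟨n, u, x, hu, rfl⟩ := W.gen g hg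
    exact mul_mem (pow_mem (hD _ _ W.dc) n) (hU _ _ hu)
  have h1 := Subgroup.index_dvd_of_le hle
  have h2 : l ∣ (Bor ρ).index := by
    refine dvd_trans ?_ h1
    rw [Subgroup.index, hj, pow_succ]
    exact dvd_mul_left _ _
  have h3 := W.index l hinj
  have h4 := (Nat.modEq_zero_iff_dvd.2 h2).symm.trans h3
  have := (Nat.modEq_iff_dvd' (by norm_num)).1 h4
  have := Nat.le_of_dvd (by norm_num) this
  omega

lemma Wild.h1 {b0 : Γ} {y0 : k} (W : Wild ρ b0 y0) (hl : 5 < l)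
    (hinj : Function.Injective ρ) (c : Γ → Matrix (Fin 2) (Fin 2) k) (hc : Coc ρ c) :
    Cob ρ c := by
  classical
  obtain ⟨n2, n3, n15⟩ := nat_ne (k := k) l hl
  -- normalise on the diagonal subgroup
  obtain ⟨X, hX, hXD⟩ := kill_Dg l hinj hc
  refine Cob.of_sub hX ?_
  have hc := hc.sub_cob X hX
  have hD0 : ∀ y g, DC ρ y g → (fun g => c g - ((ρ g).val * X * ((ρ g)⁻¹).val - X)) g = 0 :=
    fun y g h => hXD g ⟨y, h⟩
  generalize (fun g => c g - ((ρ g).val * X * ((ρ g)⁻¹).val - X)) = c' at *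
  -- equality on cosets of the diagonal
  have hwd : ∀ x u u', UC ρ x u → UC ρ x u' → c' u = c' u' := by
    intro x u u' hu hu'
    have h1 : UC ρ 0 (u⁻¹ * u') := by simpa using hu.inv.mul hu'
    have h2 := hc.2 u (u⁻¹ * u')
    rw [mul_inv_cancel_left, hD0 _ _ h1.dc, mul_zero, zero_mul, add_zero] at h2
    exact h2.symm
  obtain ⟨C, hC⟩ : ∃ C : k → Matrix (Fin 2) (Fin 2) k, ∀ u x, UC ρ x u → c' u = C x := by
    refine ⟨fun x => if h : ∃ u, UC ρ x u then c' h.choose else 0, fun u x hu => ?_⟩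
    have h : ∃ u, UC ρ x u := ⟨u, hu⟩
    simp only [h, dif_pos]
    exact hwd _ _ _ hu h.choose_spec
  have hS : ∀ x, x ∈ Sad ρ ↔ ∃ u, UC ρ x u := fun x => mem_Sad ρ
  have hC0 : C 0 = 0 := by rw [← hC 1 0 UC.one]; exact hc.one
  have htr : ∀ x ∈ Sad ρ, C x 1 1 = - C x 0 0 := by
    intro x hx
    obtain ⟨u, hu⟩ := (hS x).1 hx
    have := hc.1 u
    rw [hC _ _ hu, trace_fin_two] at this
    linear_combination this
  have hadd : ∀ x ∈ Sad ρ, ∀ x' ∈ Sad ρ, C (x + x') = C x +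
      !![C x' 0 0 + x * C x' 1 0, C x' 0 1 + x * C x' 1 1 - x * (C x' 0 0 + x * C x' 1 0);
        C x' 1 0, C x' 1 1 - x * C x' 1 0] := by
    intro x hx x' hx'
    obtain ⟨u, hu⟩ := (hS x).1 hx
    obtain ⟨u', hu'⟩ := (hS x').1 hx'
    rw [← hC _ _ (hu.mul hu'), hc.2, hC _ _ hu, hC _ _ hu', hu.mat]
  have hmul : ∀ x ∈ Sad ρ, ∀ n : ℕ, y0 ^ n * x ∈ Sad ρ ∧ C (y0 ^ n * x) =
      !![C x 0 0, y0 ^ n * C x 0 1; (y0 ^ n)⁻¹ * C x 1 0, C x 1 1] := by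
    intro x hx n
    obtain ⟨u, hu⟩ := (hS x).1 hx
    have hb := W.dc.pow n
    refine ⟨(hS _).2 ⟨_, hu.conj hb⟩, ?_⟩
    rw [← hC _ _ (hu.conj hb), hc.2, hc.2, hD0 _ _ hb, hD0 _ _ hb.inv, hC _ _ hu, hb.mat]
    simp
  obtain ⟨n4, hn4⟩ := W.four
  have hr : ∀ x ∈ Sad ρ, C x 1 0 = 0 := by
    intro x hx
    have h1 := (hmul x hx n4).2
    rw [hn4] at h1
    have h2x := add_mem hx hx
    have e1 := hadd x hx x hx
    have e2 := hadd _ h2x _ h2x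
    rw [show x + x + (x + x) = 4 * x by ring, h1] at e2
    have f1 := congrFun (congrFun e1 1) 0
    have f2 := congrFun (congrFun e2 1) 0
    simp at f1 f2
    have n4 : (4 : k) ≠ 0 := by
      rw [show (4 : k) = 2 * 2 by norm_num]; exact mul_ne_zero n2 n2
    rw [f1, inv_mul_eq_iff_eq_mul₀ n4] at f2
    have : (15 : k) * C x 1 0 = 0 := by linear_combination -f2
    simpa [n15] using this
  have hp : ∀ x ∈ Sad ρ, C x 0 0 = 0 := by
    intro x hx
    have h1 := (hmul x hx n4).2
    rw [hn4] at h1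
    have h2x := add_mem hx hx
    have e1 := hadd x hx x hx
    have e2 := hadd _ h2x _ h2x
    rw [show x + x + (x + x) = 4 * x by ring, h1] at e2
    have f1 := congrFun (congrFun e1 0) 0
    have f2 := congrFun (congrFun e2 0) 0
    simp [hr x hx, hr _ h2x] at f1 f2
    rw [f1] at f2
    have : (3 : k) * C x 0 0 = 0 := by linear_combination -f2
    simpa [n3] using this
  have hq : ∀ x ∈ Sad ρ, ∀ x' ∈ Sad ρ, C (x + x') 0 1 = C x 0 1 + C x' 0 1 := by
    intro x hx x' hx'
    rw [hadd x hx x' hx']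
    simp [hr x' hx', hp x' hx', htr x' hx']
  obtain ⟨u0, x0, hu0, hx0⟩ := W.ne
  have hx0S : x0 ∈ Sad ρ := (hS _).2 ⟨_, hu0⟩
  obtain ⟨κ, hκ⟩ : ∃ κ, ∀ x ∈ Sad ρ, C x 0 1 = κ * x := by
    refine ⟨C x0 0 1 / x0, ?_⟩
    let S' : AddSubgroup k :=
      { carrier := {x | x ∈ Sad ρ ∧ C x 0 1 = C x0 0 1 / x0 * x}
        zero_mem' := ⟨zero_mem _, by simp [hC0]⟩
        add_mem' := by
          rintro a b ⟨ha, ha'⟩ ⟨hb, hb'⟩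
          exact ⟨add_mem ha hb, by rw [hq a ha b hb, ha', hb']; ring⟩
        neg_mem' := by
          rintro a ⟨ha, ha'⟩
          refine ⟨neg_mem ha, ?_⟩
          have := hq a ha (-a) (neg_mem ha)
          rw [add_neg_cancel, hC0, ha'] at this
          simp at this
          linear_combination -this }
    have hS' : S' = Sad ρ := by
      refine W.clos x0 hx0S hx0 S' (fun x hx => hx.1) (fun n => ?_)
      refine ⟨(hmul x0 hx0S n).1, ?_⟩
      rw [(hmul x0 hx0S n).2]
      simp
      field_simp
    intro x hx
    rw [← hS'] at hx
    exact hx.2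
  -- subtract the last coboundary
  set X' : Matrix (Fin 2) (Fin 2) k := !![-κ / 2, 0; 0, κ / 2] with hX'
  have hX'0 : X'.trace = 0 := by rw [trace_fin_two]; simp [hX']; ring
  refine Cob.of_sub hX'0 ?_
  have hc2 := hc.sub_cob X' hX'0
  refine average ρ (Bor ρ) ?_ _ hc2 ?_
  · have h := W.index l hinj
    have h2 := (CharP.natCast_eq_natCast' k l h)
    rw [h2]; simp
  · have hbn : ∀ n : ℕ, c' (b0 ^ n) - ((ρ (b0 ^ n)).val * X' * ((ρ (b0 ^ n))⁻¹).val - X') = 0 := by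
      intro n
      rw [hD0 _ _ (W.dc.pow n), (W.dc.pow n).mat]
      ext i j; fin_cases i <;> fin_cases j <;> simp [hX']
    have hun : ∀ u x, UC ρ x u → c' u - ((ρ u).val * X' * ((ρ u)⁻¹).val - X') = 0 := by
      intro u x hu
      have hx := (hS _).2 ⟨_, hu⟩
      rw [hC _ _ hu, hu.mat]
      ext i j; fin_cases i <;> fin_cases j <;>
        simp [hX', hp x hx, hr x hx, htr x hx, hκ x hx]
      field_simp
      ring
    intro g hg
    obtain ⟨n, u, x, hu, rfl⟩ := W.gen g hg
    have := hc2.2 (b0 ^ n) u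
    simp only [hun _ _ hu, hbn, mul_zero, zero_mul, add_zero] at this
    exact this

end CaseB2



section CaseB3

set_option linter.unusedSectionVars false
set_option linter.unusedVariables false

variable {k Ω : Type*} [Field k] [Field Ω] [Algebra k Ω] {Γ : Type*} [Group Γ]
  (ρ : Γ →* GL (Fin 2) k) [Finite Γ] [IsAlgClosed Ω]

lemma mkWild (l : ℕ) [Fact l.Prime] [CharP k l] (hl : 5 < l) (h2 : (2 : Ω) ≠ 0) (hND : ND Ω ρ)
    (hS : Sad ρ ≠ ⊥) (b0 : Γ) (y0 : k) (hb : DC ρ y0 b0)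
    (hgen : ∀ g, (ρ g).val 1 0 = 0 → ∃ n : ℕ, (ρ g).val 0 0 = y0 ^ n * (ρ g).val 1 1) :
    Wild ρ b0 y0 := by
  classical
  obtain ⟨c3, ⟨t4, ht4, ht4'⟩, hcl⟩ := four_mem l hl (Sad ρ) (chi ρ).range (T_smul_S ρ) hS
    (card_bound (Ω := Ω) ρ h2 hND hS)
  have hT : ∀ t ∈ (chi ρ).range, ∃ n : ℕ, (t : k) = y0 ^ n := by
    rintro _ ⟨⟨g, hg⟩, rfl⟩
    obtain ⟨n, hn⟩ := hgen g hg
    refine ⟨n, ?_⟩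
    rw [chi_apply]
    have := (tri_ne ((mem_Bor ρ).1 hg)).2
    simp only [hn]
    field_simp
  have hTn : ∀ n : ℕ, ∃ t ∈ (chi ρ).range, (t : k) = y0 ^ n := by
    intro n
    have h := hb.pow n
    refine ⟨_, ⟨⟨b0 ^ n, h.1⟩, rfl⟩, ?_⟩
    rw [chi_apply]
    have := h.ne.1
    simp only [h.2.2]
    field_simp
  refine ⟨hb, ?_, ?_, ?_, ?_, ?_⟩
  · intro hsq
    have hy0 : y0 ≠ 0 := hb.ne.2
    let T2 : Finset kˣ := {1, Units.mk0 y0 hy0}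
    have : ((chi ρ).range : Set kˣ) ⊆ (T2 : Set kˣ) := by
      intro t ht
      obtain ⟨n, hn⟩ := hT t ht
      have h' : (t : k) = 1 ∨ (t : k) = y0 := by
        rw [hn]
        rcases Nat.even_or_odd' n with ⟨m, rfl | rfl⟩
        · left; rw [pow_mul, hsq, one_pow]
        · right; rw [pow_succ, pow_mul, hsq, one_pow, one_mul]
      simp only [T2, Finset.coe_insert, Finset.coe_singleton, Set.mem_insert_iff,
        Set.mem_singleton_iff, Units.ext_iff]
      simpa using h'
    have h3 := Set.ncard_le_ncard this (Finset.finite_toSet _)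
    rw [Set.ncard_coe_finset] at h3
    have h4 : T2.card ≤ 2 := Finset.card_le_two
    have h5 : Nat.card (chi ρ).range = ((chi ρ).range : Set kˣ).ncard := rfl
    omega
  · intro g hg
    obtain ⟨n, hn⟩ := hgen g hg
    have hbn := (hb.pow n).inv
    have hne := (hb.pow n).ne
    have hg' := (tri_ne hg)
    have e1 : (ρ ((b0 ^ n)⁻¹ * g)).val 1 0 = 0 := by
      simp only [map_mul, Units.val_mul, Matrix.mul_apply, Fin.sum_univ_two, hbn.1, hg, zero_mul,
        mul_zero, add_zero]
    refine ⟨n, (b0 ^ n)⁻¹ * g, (ρ ((b0 ^ n)⁻¹ * g)).val 0 1 / (ρ ((b0 ^ n)⁻¹ * g)).val 1 1,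
      ⟨e1, ?_, ?_⟩, by group⟩
    · simp only [map_mul, Units.val_mul, Matrix.mul_apply, Fin.sum_univ_two, hbn.1, hg, zero_mul,
        mul_zero, add_zero, zero_add, hbn.2.2, hbn.2.1, hn]
      have := hne.2
      field_simp
    · have := (tri_ne e1).2
      field_simp
  · obtain ⟨n, hn⟩ := hT t4 ht4
    exact ⟨n, by rw [← hn, ht4']⟩
  · obtain ⟨x, hx, hx0⟩ : ∃ x, x ∈ Sad ρ ∧ x ≠ 0 := by
      by_contra! h
      exact hS ((AddSubgroup.eq_bot_iff_forall _).2 h)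
    obtain ⟨u, hu⟩ := (mem_Sad ρ).1 hx
    exact ⟨u, x, hu, hx0⟩
  · intro x0 hx0 hx0' S' hS' h
    refine hcl x0 hx0 hx0' S' hS' ?_
    intro t ht
    obtain ⟨n, hn⟩ := hT t ht
    rw [hn]; exact h n

/-- elementary unipotent -/
def upr (m : k) : GL (Fin 2) k where
  val := !![1, m; 0, 1]
  inv := !![1, -m; 0, 1]
  val_inv := by ext i j; fin_cases i <;> fin_cases j <;> simp [Matrix.mul_apply]
  inv_val := by ext i j; fin_cases i <;> fin_cases j <;> simp [Matrix.mul_apply]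

lemma upr_cj (m : k) (g : Γ) : (cjr ρ (upr m) g).val =
    !![(ρ g).val 0 0 + m * (ρ g).val 1 0,
      (ρ g).val 0 1 + m * (ρ g).val 1 1 - m * ((ρ g).val 0 0 + m * (ρ g).val 1 0);
      (ρ g).val 1 0, (ρ g).val 1 1 - m * (ρ g).val 1 0] := by
  rw [cjr_apply, Units.val_mul, Units.val_mul]
  have h1 : (upr m).val = !![1, m; 0, 1] := rfl
  have h2 : ((upr m)⁻¹).val = !![1, -m; 0, 1] := rfl
  rw [h1, h2]
  ext i j; fin_cases i <;> fin_cases j <;> simp [Matrix.mul_apply, Matrix.vecMul, dotProduct, Fin.sum_univ_two] <;> ring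

lemma caseB0 (l : ℕ) [Fact l.Prime] [CharP k l] (hl : 5 < l) (h2 : (2 : Ω) ≠ 0) (hND : ND Ω ρ)
    (hS : Sad ρ ≠ ⊥) : ∃ (Q : GL (Fin 2) k) (b0 : Γ) (y0 : k), Wild (cjr ρ Q) b0 y0 := by
  classical
  obtain ⟨c3, -, -⟩ := four_mem l hl (Sad ρ) (chi ρ).range (T_smul_S ρ) hS
    (card_bound (Ω := Ω) ρ h2 hND hS)
  obtain ⟨⟨_, b0, rfl⟩, hg⟩ := IsCyclic.exists_monoid_generator (α := (chi ρ).range)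
  have hb0' := (mem_Bor ρ).1 b0.2
  set y0 : k := (chi ρ b0 : k) with hy0
  have hgen : ∀ g, (ρ g).val 1 0 = 0 → ∃ n : ℕ, (ρ g).val 0 0 = y0 ^ n * (ρ g).val 1 1 := by
    intro g hg0
    obtain ⟨n, hn⟩ := hg ⟨chi ρ ⟨g, hg0⟩, ⟨_, rfl⟩⟩
    have hn' := congrArg (fun t : (chi ρ).range => ((t : kˣ) : k)) hn
    simp at hn'
    refine ⟨n, ?_⟩
    rw [hy0, hn', chi_apply]
    have := (tri_ne hg0).2
    field_simp
  have hy1 : y0 ≠ 1 := by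
    intro h1
    have : (chi ρ).range = ⊥ := by
      rw [Subgroup.eq_bot_iff_forall]
      rintro _ ⟨⟨g, hg0⟩, rfl⟩
      obtain ⟨n, hn⟩ := hgen g hg0
      rw [h1, one_pow, one_mul] at hn
      apply Units.ext
      rw [chi_apply]
      have := (tri_ne ((mem_Bor ρ).1 hg0)).2
      simp only [hn]
      field_simp
      simp
    rw [this] at c3
    simp at c3
  have hd0 := (tri_ne hb0').2
  have hy0' : (ρ b0).val 0 0 = y0 * (ρ b0).val 1 1 := by
    rw [hy0, chi_apply]; field_simp
  set m : k := (ρ b0).val 0 1 / ((ρ b0).val 0 0 - (ρ b0).val 1 1) with hm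
  have hne : (ρ b0).val 0 0 - (ρ b0).val 1 1 ≠ 0 := by
    rw [hy0']
    intro h
    apply hy1
    have : (y0 - 1) * (ρ b0).val 1 1 = 0 := by linear_combination h
    have := (mul_eq_zero.1 this).resolve_right hd0
    linear_combination this
  refine ⟨upr m, b0, y0, mkWild (Ω := Ω) _ l hl h2 (ND_cjr ρ _ hND) ?_ _ _ ⟨?_, ?_, ?_⟩ ?_⟩
  · intro h
    apply hS
    rw [eq_bot_iff, ← h]
    rintro x ⟨u, h1, h2, h3⟩
    refine ⟨u, ?_⟩
    rw [upr_cj]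
    simp [h1, h2, h3]
  · rw [upr_cj]; simpa using hb0'
  · rw [upr_cj]; simp [hb0']
    rw [hm]; field_simp; ring
  · rw [upr_cj]; simp [hb0', hy0']
  · intro g hg0
    rw [upr_cj] at hg0
    simp at hg0
    obtain ⟨n, hn⟩ := hgen g hg0
    refine ⟨n, ?_⟩
    rw [upr_cj]; simp [hg0, hn]

lemma cjr_cjr (Q Q' : GL (Fin 2) k) : cjr (cjr ρ Q) Q' = cjr ρ (Q' * Q) := by
  ext1 g
  simp [cjr_apply, mul_assoc]

lemma cjr_inj (hinj : Function.Injective ρ) (Q : GL (Fin 2) k) : Function.Injective (cjr ρ Q) :=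
  (MulAut.conj Q).injective.comp hinj

lemma caseB (l : ℕ) [Fact l.Prime] [CharP k l] (hl : 5 < l) (hinj : Function.Injective ρ)
    (hND : ND Ω ρ) (γ : Γ) (hγ : ¬ IsSc (ρ γ).val) (hd : disc (ρ γ).val = 0) :
    (∀ N : Subgroup Γ, N.Normal → ∀ j : ℕ, Nat.card (Γ ⧸ N) ≠ l ^ (j + 1)) ∧
    (∀ c, Coc ρ c → Cob ρ c) ∧ HasIV ρ := by
  have h2k : (2 : k) ≠ 0 := (nat_ne l hl).1
  have h2 : (2 : Ω) ≠ 0 := by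
    have := (map_ne_zero (algebraMap k Ω)).2 h2k
    rwa [map_ofNat] at this
  obtain ⟨p, q, hp, -, hpq, -⟩ := fix_pts h2k (ρ γ).val hγ 0 (by
    rw [disc] at hd; rw [hd]; ring)
  obtain ⟨Q1, hQ1⟩ := exists_tri (ρ γ).val p hp ((hpq p hp).2 (Or.inl (mul_comm _ _)))
  have e1 : (cjr ρ Q1 γ).val = Q1.val * (ρ γ).val * (Q1⁻¹).val := by
    rw [cjr_apply, Units.val_mul, Units.val_mul]
  rw [← e1] at hQ1
  have hne := tri_ne hQ1
  have hdisc : disc (cjr ρ Q1 γ).val = 0 := by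
    have hh : ∀ A : Matrix (Fin 2) (Fin 2) k, disc A = A.trace ^ 2 - 4 * A.det := by
      intro A; rw [disc, trace_fin_two, det_fin_two]; ring
    rw [hh, e1, trace_cj, det_mul, det_mul, mul_right_comm, ← det_mul, Units.mul_inv, det_one,
      one_mul, ← hh, hd]
  have h00 : (cjr ρ Q1 γ).val 0 0 = (cjr ρ Q1 γ).val 1 1 := by
    rw [disc, hQ1] at hdisc
    have : ((cjr ρ Q1 γ).val 0 0 - (cjr ρ Q1 γ).val 1 1) ^ 2 = 0 := by linear_combination hdisc
    exact sub_eq_zero.1 (pow_eq_zero_iff (by norm_num) |>.1 this)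
  have h01 : (cjr ρ Q1 γ).val 0 1 ≠ 0 := by
    intro h
    apply hγ
    have e2 : (cjr ρ Q1 γ).val = (cjr ρ Q1 γ).val 1 1 • 1 := by
      ext i j; fin_cases i <;> fin_cases j <;> simp [h, hQ1, h00]
    have e3 : (ρ γ).val = (cjr ρ Q1 γ).val 1 1 • 1 := by
      have : (ρ γ).val = (Q1⁻¹).val * (cjr ρ Q1 γ).val * Q1.val := by
        rw [e1]; simp only [mul_assoc, Units.inv_mul_cancel_left, Units.inv_mul, mul_one]
      rw [this, e2]
      simp
    rw [e3]
    simp [IsSc]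
  have hS : Sad (cjr ρ Q1) ≠ ⊥ := by
    intro h
    have : (cjr ρ Q1 γ).val 0 1 / (cjr ρ Q1 γ).val 1 1 ∈ Sad (cjr ρ Q1) :=
      ⟨γ, hQ1, h00, by have := hne.2; field_simp⟩
    rw [h, AddSubgroup.mem_bot, div_eq_zero_iff] at this
    exact this.elim h01 hne.2
  obtain ⟨Q2, b0, y0, W⟩ := caseB0 (Ω := Ω) _ l hl h2 (ND_cjr ρ Q1 hND) hS
  rw [cjr_cjr] at W
  set Q := Q2 * Q1
  have hi := cjr_inj ρ hinj Q
  refine ⟨W.no_quot l hl hi, cob_of_cjr ρ Q (W.h1 l hl hi), hasIV_of_cjr ρ Q ?_⟩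
  refine hasIV_diag (Ω := Ω) _ (ND_cjr ρ Q hND) b0 (y0 * (cjr ρ Q b0).val 1 1)
    ((cjr ρ Q b0).val 1 1) ?_ ?_
  · ext i j; fin_cases i <;> fin_cases j <;> simp [W.dc.1, W.dc.2.1, W.dc.2.2]
  · intro h
    have h0 := W.dc.ne.1
    apply W.sq
    rw [mul_pow] at h
    exact mul_right_cancel₀ (pow_ne_zero 2 h0) (by rw [h, one_mul])

lemma bigness (l : ℕ) [Fact l.Prime] [CharP k l] (hl : 5 < l) (ζ : k) (hζ : IsPrimitiveRoot ζ 3)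
    (hinj : Function.Injective ρ) (hND : ND Ω ρ) :
    (∀ N : Subgroup Γ, N.Normal → ∀ j : ℕ, Nat.card (Γ ⧸ N) ≠ l ^ (j + 1)) ∧
    (∀ c, Coc ρ c → Cob ρ c) ∧ HasIV ρ := by
  by_cases h : ∀ γ, ¬ IsSc (ρ γ).val → disc (ρ γ).val ≠ 0
  · exact caseA (Ω := Ω) ρ l hl ζ hζ hinj hND h
  · push Not at h
    obtain ⟨γ, h1, h2⟩ := h
    exact caseB (Ω := Ω) ρ l hl hinj hND γ h1 h2

end CaseB3



section CaseD

set_option linter.unusedSectionVars false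
set_option linter.unusedVariables false

variable {k Ω : Type*} [Field k] [Field Ω] [Algebra k Ω] {Γ : Type*} [Group Γ]
  (ρ : Γ →* GL (Fin 2) k)

lemma two_eig {A B : Matrix (Fin 2) (Fin 2) Ω} {v w : Fin 2 → Ω} (hvw : ¬ Par v w)
    (hv : v ≠ 0) (hw : w ≠ 0)
    (h1 : Par (A *ᵥ v) v) (h2 : Par (A *ᵥ w) w) (h3 : Par (B *ᵥ v) v) (h4 : Par (B *ᵥ w) w) :
    A * B = B * A := by
  obtain ⟨α, hα⟩ := h1.exists_smul hv
  obtain ⟨α', hα'⟩ := h2.exists_smul hw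
  obtain ⟨β, hβ⟩ := h3.exists_smul hv
  obtain ⟨β', hβ'⟩ := h4.exists_smul hw
  have e1 : (A * B - B * A) *ᵥ v = 0 := by
    rw [sub_mulVec, ← mulVec_mulVec, ← mulVec_mulVec, hα, hβ, mulVec_smul, mulVec_smul, hα, hβ,
      smul_smul, smul_smul, mul_comm, sub_self]
  have e2 : (A * B - B * A) *ᵥ w = 0 := by
    rw [sub_mulVec, ← mulVec_mulVec, ← mulVec_mulVec, hα', hβ', mulVec_smul, mulVec_smul, hα', hβ',
      smul_smul, smul_smul, mul_comm, sub_self]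
  generalize hM : A * B - B * A = M at e1 e2
  rw [← sub_eq_zero, hM]
  have hD : v 0 * w 1 - v 1 * w 0 ≠ 0 := fun h => hvw (sub_eq_zero.1 h)
  ext i j
  have f1 := congrFun e1 i
  have f2 := congrFun e2 i
  simp [Matrix.mulVec, dotProduct, Fin.sum_univ_two] at f1 f2
  fin_cases j
  · have : M i 0 * (v 0 * w 1 - v 1 * w 0) = 0 := by linear_combination w 1 * f1 - v 1 * f2
    simpa [hD] using this
  · have : M i 1 * (v 0 * w 1 - v 1 * w 0) = 0 := by linear_combination v 0 * f2 - w 0 * f1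
    simpa [hD] using this

lemma swap_trace {A : Matrix (Fin 2) (Fin 2) Ω} {v w : Fin 2 → Ω} (hvw : ¬ Par v w)
    (hv : v ≠ 0) (hw : w ≠ 0) (h1 : Par (A *ᵥ v) w) (h2 : Par (A *ᵥ w) v) : A.trace = 0 := by
  obtain ⟨α, hα⟩ := h1.exists_smul hw
  obtain ⟨β, hβ⟩ := h2.exists_smul hv
  have hD : v 0 * w 1 - v 1 * w 0 ≠ 0 := fun h => hvw (sub_eq_zero.1 h)
  have a0 := congrFun hα 0
  have a1 := congrFun hα 1
  have b0 := congrFun hβ 0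
  have b1 := congrFun hβ 1
  simp [Matrix.mulVec, dotProduct, Fin.sum_univ_two] at a0 a1 b0 b1
  have : A.trace * (v 0 * w 1 - v 1 * w 0) = 0 := by
    rw [trace_fin_two]
    linear_combination w 1 * a0 - v 1 * b0 + v 0 * b1 - w 0 * a1
  simpa [hD] using this

lemma xt_inj {A B : Matrix (Fin 2) (Fin 2) k} (h : xt Ω A = xt Ω B) : A = B := by
  ext i j
  have := congrFun (congrFun h i) j
  simpa [xt] using this

lemma xt_one : xt Ω (1 : Matrix (Fin 2) (Fin 2) k) = 1 := by simp [xt]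

lemma par_cancel (g : GL (Fin 2) k) {x y : Fin 2 → Ω}
    (h : Par (xt Ω g.val *ᵥ x) (xt Ω g.val *ᵥ y)) : Par x y := by
  have := h.mulVec (xt Ω (g⁻¹).val)
  simpa only [mulVec_mulVec, ← xt_mul, Units.inv_mul, xt_one, one_mulVec] using this

variable (H : Subgroup Γ) (hcom : ∀ a b : Γ, a * b * a⁻¹ * b⁻¹ ∈ H)
include hcom

lemma H_normal : H.Normal := ⟨fun h hh g => by
  have := mul_mem (hcom g h) hh
  simpa using this⟩

lemma tr_comm (hirr : ∀ v : Fin 2 → Ω, v ≠ 0 → ¬ ∀ γ, Par (xt Ω (ρ γ).val *ᵥ v) v)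
    {v w : Fin 2 → Ω} (hv : v ≠ 0) (hw : w ≠ 0)
    (h : ∀ h ∈ H, Par (xt Ω (ρ h).val *ᵥ v) v ∨ Par (xt Ω (ρ h).val *ᵥ v) w) :
    ∀ a ∈ H, ∀ a' ∈ H, (ρ a).val.trace ≠ 0 → (ρ a').val.trace ≠ 0 →
      (ρ a).val * (ρ a').val = (ρ a').val * (ρ a).val := by
  by_cases hfix : ∀ h ∈ H, Par (xt Ω (ρ h).val *ᵥ v) v
  · obtain ⟨g, hg⟩ := not_forall.1 (hirr v hv)
    have hu := xt_mulVec_ne_zero (ρ g) hv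
    have hfix' : ∀ h ∈ H, Par (xt Ω (ρ h).val *ᵥ (xt Ω (ρ g).val *ᵥ v)) (xt Ω (ρ g).val *ᵥ v) := by
      intro h hh
      have h1 := (hfix (g⁻¹ * h * g) (by
        simpa using (H_normal H hcom).conj_mem h hh g⁻¹)).mulVec (xt Ω (ρ g).val)
      rw [mulVec_mulVec, ← xt_mul, ← Units.val_mul, ← map_mul] at h1
      rw [mulVec_mulVec, ← xt_mul, ← Units.val_mul, ← map_mul]
      rwa [show g * (g⁻¹ * h * g) = h * g by group] at h1
    intro a ha a' ha' _ _
    apply xt_inj (Ω := Ω)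
    rw [xt_mul, xt_mul]
    exact two_eig hg hu hv (hfix' a ha) (hfix a ha) (hfix' a' ha') (hfix a' ha')
  · push Not at hfix
    obtain ⟨b, hb, hbv⟩ := hfix
    have hbw := (h b hb).resolve_left hbv
    set u := xt Ω (ρ b).val *ᵥ v with hu
    have hu0 : u ≠ 0 := xt_mulVec_ne_zero (ρ b) hv
    have h' : ∀ h ∈ H, Par (xt Ω (ρ h).val *ᵥ v) v ∨ Par (xt Ω (ρ h).val *ᵥ v) u := by
      intro x hx
      exact (h x hx).imp id (fun h => h.trans hbw.symm hw)
    have key : ∀ a ∈ H, (ρ a).val.trace ≠ 0 →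
        Par (xt Ω (ρ a).val *ᵥ v) v ∧ Par (xt Ω (ρ a).val *ᵥ u) u := by
      intro a ha hta
      have h2 := h' (a * b) (mul_mem ha hb)
      rw [map_mul, Units.val_mul, xt_mul, ← mulVec_mulVec, ← hu] at h2
      rcases h' a ha with h1 | h1
      · refine ⟨h1, h2.resolve_left fun h3 => hbv ?_⟩
        exact par_cancel (ρ a) (h3.trans h1.symm hv)
      · exfalso
        rcases h2 with h2 | h2
        · apply hta
          have := swap_trace hbv hu0 hv h2 h1
          rw [trace_fin_two] at this ⊢
          simp only [xt, Matrix.map_apply] at this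
          rw [← map_add] at this
          exact (map_eq_zero _).1 this
        · exact hbv (par_cancel (ρ a) (h2.trans h1.symm hu0))
    intro a ha a' ha' hta hta'
    apply xt_inj (Ω := Ω)
    rw [xt_mul, xt_mul]
    exact two_eig hbv hu0 hv (key a ha hta).2 (key a ha hta).1 (key a' ha' hta').2 (key a' ha' hta').1

end CaseD



section CaseD2

set_option linter.unusedSectionVars false
set_option linter.unusedVariables false

variable {k Ω : Type*} [Field k] [Field Ω] [Algebra k Ω] {Γ : Type*} [Group Γ]
  (ρ : Γ →* GL (Fin 2) k)

lemma anticomm {A B : Matrix (Fin 2) (Fin 2) k} (hA : A.trace = 0) (hB : B.trace = 0)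
    (hAB : (A * B).trace = 0) : A * B = -(B * A) := by
  rw [trace_fin_two] at *
  simp only [Matrix.mul_apply, Fin.sum_univ_two] at hAB
  have e1 : A 1 1 = - A 0 0 := by linear_combination hA
  have e2 : B 1 1 = - B 0 0 := by linear_combination hB
  ext i j
  fin_cases i <;> fin_cases j <;> simp [Matrix.mul_apply, Fin.sum_univ_two, e1, e2] at hAB ⊢ <;>
    first | linear_combination hAB | ring1

lemma sq_tr0 {A : Matrix (Fin 2) (Fin 2) k} (hA : A.trace = 0) : A * A = (-A.det) • 1 := by
  rw [trace_fin_two] at *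
  have e1 : A 1 1 = - A 0 0 := by linear_combination hA
  ext i j
  fin_cases i <;> fin_cases j <;> simp [Matrix.mul_apply, Fin.sum_univ_two, e1, det_fin_two] <;> ring

/-- projective equality -/
def Pj (x y : Matrix (Fin 2) (Fin 2) k) : Prop := ∃ s : k, s ≠ 0 ∧ x = s • y

lemma Pj.symm {x y : Matrix (Fin 2) (Fin 2) k} (h : Pj x y) : Pj y x := by
  obtain ⟨s, hs, rfl⟩ := h
  exact ⟨s⁻¹, inv_ne_zero hs, by rw [smul_smul, inv_mul_cancel₀ hs, one_smul]⟩

lemma Pj.trans {x y z : Matrix (Fin 2) (Fin 2) k} (h : Pj x y) (h' : Pj y z) : Pj x z := by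
  obtain ⟨s, hs, rfl⟩ := h
  obtain ⟨t, ht, rfl⟩ := h'
  exact ⟨s * t, mul_ne_zero hs ht, by rw [smul_smul]⟩

lemma Pj.conj {a b : Γ} (h : Pj (ρ a).val (ρ b).val) (g : Γ) :
    Pj (ρ (g * a * g⁻¹)).val (ρ (g * b * g⁻¹)).val := by
  obtain ⟨s, hs, h⟩ := h
  refine ⟨s, hs, ?_⟩
  simp only [map_mul, Units.val_mul, h, mul_smul_comm, smul_mul_assoc]

lemma isSc_smul_one (s : k) : IsSc (s • (1 : Matrix (Fin 2) (Fin 2) k)) := by simp [IsSc]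

lemma gl_det (g : GL (Fin 2) k) : g.val.det ≠ 0 := by
  have := g.isUnit
  rw [Matrix.isUnit_iff_isUnit_det] at this
  exact this.ne_zero

lemma isSc_conj {a g : Γ} (h : IsSc (ρ (g * a * g⁻¹)).val) : IsSc (ρ a).val := by
  have h1 := isSc_eq h
  generalize (ρ (g * a * g⁻¹)).val 0 0 = s at h1
  have : (ρ a).val = (ρ g⁻¹).val * (ρ (g * a * g⁻¹)).val * (ρ g).val := by
    rw [← Units.val_mul, ← map_mul, ← Units.val_mul, ← map_mul]; congr 2; group
  rw [this, h1]
  have e : (ρ g⁻¹).val * (ρ g).val = 1 := by rw [← Units.val_mul, ← map_mul]; simp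
  simp only [mul_smul_comm, smul_mul_assoc, mul_one, e]
  exact isSc_smul_one s

/-- the three-class situation -/
lemma three_class (h2 : (2 : k) ≠ 0) (H : Subgroup Γ)
    (hcom : ∀ a b : Γ, a * b * a⁻¹ * b⁻¹ ∈ H)
    (h0 : ∀ h ∈ H, ¬ IsSc (ρ h).val → (ρ h).val.trace = 0)
    (α β : Γ) (hα : α ∈ H) (hβ : β ∈ H) (hne : (ρ α).val * (ρ β).val ≠ (ρ β).val * (ρ α).val) :
    ∃ e : Fin 3 → Γ, (∀ i, e i ∈ H) ∧ (∀ i, ¬ IsSc (ρ (e i)).val) ∧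
      (∀ i j, i ≠ j → (ρ (e i)).val * (ρ (e j)).val = - ((ρ (e j)).val * (ρ (e i)).val)) ∧
      (∀ h ∈ H, ¬ IsSc (ρ h).val → ∃ i, Pj (ρ h).val (ρ (e i)).val) := by
  have hscm : ∀ x y : Γ, IsSc (ρ (x * y)).val →
      (ρ x).val * (ρ y).val = (ρ y).val * (ρ x).val := by
    intro x y h
    have h1 := isSc_eq h
    generalize (ρ (x * y)).val 0 0 = s at h1
    have : (ρ (y * x)).val = (ρ x⁻¹).val * (ρ (x * y)).val * (ρ x).val := by
      rw [← Units.val_mul, ← map_mul, ← Units.val_mul, ← map_mul]; congr 2; group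
    rw [← Units.val_mul, ← map_mul, ← Units.val_mul, ← map_mul, this, h1]
    have e : (ρ x⁻¹).val * (ρ x).val = 1 := by rw [← Units.val_mul, ← map_mul]; simp
    simp only [mul_smul_comm, smul_mul_assoc, mul_one, e]
  have hsα : ¬ IsSc (ρ α).val := by
    intro h; rw [isSc_eq h] at hne; simp at hne
  have hsβ : ¬ IsSc (ρ β).val := by
    intro h; rw [isSc_eq h] at hne; simp at hne
  have hsαβ : ¬ IsSc (ρ (α * β)).val := fun h => hne (hscm _ _ h)
  have tα := h0 _ hα hsα
  have tβ := h0 _ hβ hsβ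
  have tαβ := h0 _ (mul_mem hα hβ) hsαβ
  have anti : (ρ α).val * (ρ β).val = - ((ρ β).val * (ρ α).val) :=
    anticomm tα tβ (by rw [← Units.val_mul, ← map_mul]; exact tαβ)
  have eab : (ρ (α * β)).val = (ρ α).val * (ρ β).val := by rw [map_mul, Units.val_mul]
  -- class lemma
  have hcl : ∀ h ∈ H, ∀ x ∈ H, (ρ x).val.trace = 0 →
      Pj (ρ h).val (ρ x).val ∨ ((ρ h).val * (ρ x).val).trace = 0 := by
    intro h hh x hx tx
    by_cases hs : IsSc (ρ (h * x)).val
    · left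
      have h1 := isSc_eq hs
      have hs0 : (ρ (h * x)).val 0 0 ≠ 0 := (tri_ne hs.2.1).1
      generalize (ρ (h * x)).val 0 0 = s at h1 hs0
      have hd := gl_det (ρ x)
      refine ⟨s / (-(ρ x).val.det), div_ne_zero hs0 (neg_ne_zero.2 hd), ?_⟩
      have h2 := congrArg (· * (ρ x).val) h1
      simp only [map_mul, Units.val_mul, mul_assoc, sq_tr0 tx, mul_smul_comm, smul_mul_assoc,
        mul_one, one_mul] at h2
      rw [div_eq_inv_mul, ← smul_smul, ← h2, smul_smul, inv_mul_cancel₀ (neg_ne_zero.2 hd),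
        one_smul]
    · right
      have := h0 _ (mul_mem hh hx) hs
      rwa [map_mul, Units.val_mul] at this
  refine ⟨![α, β, α * β], ?_, ?_, ?_, ?_⟩
  · intro i; fin_cases i
    exacts [hα, hβ, mul_mem hα hβ]
  · intro i; fin_cases i
    exacts [hsα, hsβ, hsαβ]
  · have a1 : (ρ α).val * (ρ (α * β)).val = - ((ρ (α * β)).val * (ρ α).val) := by
      rw [eab, mul_assoc, ← mul_neg]
      rw [anti]
    have a2 : (ρ β).val * (ρ (α * β)).val = - ((ρ (α * β)).val * (ρ β).val) := by
      rw [eab, ← mul_assoc, ← neg_mul, anti, neg_neg]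
    intro i j hij
    fin_cases i <;> fin_cases j <;> simp at hij
    · exact anti
    · exact a1
    · show (ρ β).val * (ρ α).val = - ((ρ α).val * (ρ β).val)
      rw [anti, neg_neg]
    · exact a2
    · show (ρ (α * β)).val * (ρ α).val = - ((ρ α).val * (ρ (α * β)).val)
      rw [a1, neg_neg]
    · show (ρ (α * β)).val * (ρ β).val = - ((ρ β).val * (ρ (α * β)).val)
      rw [a2, neg_neg]
  · intro h hh hs
    have th := h0 h hh hs
    rcases hcl h hh α hα tα with p1 | p1
    · exact ⟨0, p1⟩
    rcases hcl h hh β hβ tβ with p2 | p2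
    · exact ⟨1, p2⟩
    rcases hcl h hh (α * β) (mul_mem hα hβ) tαβ with p3 | p3
    · exact ⟨2, p3⟩
    exfalso
    have q1 := anticomm th tα p1
    have q2 := anticomm th tβ p2
    have q3 := anticomm th tαβ p3
    have q4 : (ρ h).val * (ρ (α * β)).val = (ρ (α * β)).val * (ρ h).val := by
      rw [eab, ← mul_assoc, q1, neg_mul, mul_assoc, q2, mul_neg, neg_neg, mul_assoc]
    have q5 : (2 : k) • (ρ (h * (α * β))).val = 0 := by
      rw [map_mul ρ h, Units.val_mul, two_smul]
      nth_rw 1 [q3]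
      rw [q4]; simp
    have q6 := (smul_eq_zero.1 q5).resolve_left h2
    have := gl_det (ρ (h * (α * β)))
    rw [q6] at this
    simp at this

end CaseD2



section CaseD3

set_option linter.unusedSectionVars false
set_option linter.unusedVariables false

variable {k Ω : Type*} [Field k] [Field Ω] [Algebra k Ω] {Γ : Type*} [Group Γ]
  (ρ : Γ →* GL (Fin 2) k)

lemma xt_neg (A : Matrix (Fin 2) (Fin 2) k) : xt Ω (-A) = - xt Ω A := by
  ext i j; simp [xt]

/-- stabiliser of a projective class -/
def Stb (e : Γ) : Subgroup Γ where
  carrier := {γ | Pj (ρ (γ * e * γ⁻¹)).val (ρ e).val}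
  mul_mem' := by
    intro a b ha hb
    have := (Pj.conj ρ hb a).trans ha
    have e1 : a * (b * e * b⁻¹) * a⁻¹ = a * b * e * (a * b)⁻¹ := by group
    rwa [e1] at this
  one_mem' := ⟨1, one_ne_zero, by simp⟩
  inv_mem' := by
    intro a ha
    have := (Pj.conj ρ (Pj.symm ha) a⁻¹)
    have e1 : a⁻¹ * (a * e * a⁻¹) * a⁻¹⁻¹ = e := by group
    rwa [e1] at this

lemma mem_Stb {e γ : Γ} : γ ∈ Stb ρ e ↔ Pj (ρ (γ * e * γ⁻¹)).val (ρ e).val := Iff.rfl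

lemma caseD_comm {a g : Γ} (h : Pj (ρ (g * a * g⁻¹)).val (ρ a).val) :
    (ρ a).val * ((ρ g).val * (ρ a).val * ((ρ g)⁻¹).val) =
      ((ρ g).val * (ρ a).val * ((ρ g)⁻¹).val) * (ρ a).val := by
  obtain ⟨s, -, h⟩ := h
  rw [map_mul, map_mul, map_inv, Units.val_mul, Units.val_mul] at h
  rw [h]; simp

theorem caseD (h2 : (2 : k) ≠ 0) (H : Subgroup Γ)
    (hcom : ∀ a b : Γ, a * b * a⁻¹ * b⁻¹ ∈ H)
    (hirr : ∀ v : Fin 2 → Ω, v ≠ 0 → ¬ ∀ γ, Par (xt Ω (ρ γ).val *ᵥ v) v)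
    {v w : Fin 2 → Ω} (hv : v ≠ 0) (hw : w ≠ 0)
    (h : ∀ h ∈ H, Par (xt Ω (ρ h).val *ᵥ v) v ∨ Par (xt Ω (ρ h).val *ᵥ v) w) :
    ∃ (G₁ : Subgroup Γ) (a : Matrix (Fin 2) (Fin 2) k), ¬ IsSc a ∧
      (∀ g ∈ G₁, a * ((ρ g).val * a * ((ρ g)⁻¹).val) = ((ρ g).val * a * ((ρ g)⁻¹).val) * a) ∧
      (G₁ = ⊤ ∨ (G₁.Normal ∧ G₁.index = 3)) ∧
      (∀ v : Fin 2 → Ω, v ≠ 0 → ¬ ∀ γ ∈ G₁, Par (xt Ω (ρ γ).val *ᵥ v) v) ∧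
      ρ.ker ≤ G₁ := by
  have hirr' : ∀ v : Fin 2 → Ω, v ≠ 0 → ¬ ∀ γ ∈ (⊤ : Subgroup Γ), Par (xt Ω (ρ γ).val *ᵥ v) v := by
    intro v hv h; exact hirr v hv (fun γ => h γ trivial)
  by_cases hsc : ∀ h ∈ H, IsSc (ρ h).val
  · obtain ⟨γ0, hγ0⟩ : ∃ γ, ¬ IsSc (ρ γ).val := by
      by_contra! hh
      refine hirr v hv (fun γ => ?_)
      rw [isSc_mulVec ((isSc_xt _).2 (hh γ))]
      exact par_smul _ _
    refine ⟨⊤, (ρ γ0).val, hγ0, fun g _ => caseD_comm ρ ?_, Or.inl rfl, hirr', le_top⟩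
    have h1 := hsc _ (hcom g γ0)
    have h3 := isSc_eq h1
    refine ⟨_, (tri_ne h1.2.1).1, ?_⟩
    have : g * γ0 * g⁻¹ = (g * γ0 * g⁻¹ * γ0⁻¹) * γ0 := by group
    rw [this, map_mul ρ (g * γ0 * g⁻¹ * γ0⁻¹), Units.val_mul, h3]
    simp
  push Not at hsc
  have hN := H_normal H hcom
  by_cases hab : ∀ a ∈ H, ∀ a' ∈ H, (ρ a).val * (ρ a').val = (ρ a').val * (ρ a).val
  · obtain ⟨a, ha, has⟩ := hsc
    refine ⟨⊤, (ρ a).val, has, fun g _ => ?_, Or.inl rfl, hirr', le_top⟩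
    have := hab a ha _ (hN.conj_mem a ha g)
    simpa only [map_mul, map_inv, Units.val_mul] using this
  have htc := tr_comm ρ H hcom hirr hv hw h
  by_cases htr : ∃ a ∈ H, ¬ IsSc (ρ a).val ∧ (ρ a).val.trace ≠ 0
  · obtain ⟨a, ha, has, hat⟩ := htr
    refine ⟨⊤, (ρ a).val, has, fun g _ => ?_, Or.inl rfl, hirr', le_top⟩
    have := htc a ha _ (hN.conj_mem a ha g) hat (by
      rw [map_mul, map_mul, map_inv, Units.val_mul, Units.val_mul, trace_cj]; exact hat)
    simpa only [map_mul, map_inv, Units.val_mul] using this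
  push Not at htr hab
  obtain ⟨α, hα, β, hβ, hne⟩ := hab
  obtain ⟨e, heH, hes, hanti, hcl⟩ := three_class ρ h2 H hcom htr α β hα hβ hne
  by_cases hst : ∃ i, Stb ρ (e i) = ⊤
  · obtain ⟨i, hi⟩ := hst
    refine ⟨⊤, (ρ (e i)).val, hes i, fun g _ => caseD_comm ρ ?_, Or.inl rfl, hirr', le_top⟩
    rw [← mem_Stb, hi]; trivial
  push Not at hst
  have huniq : ∀ i j, Pj (ρ (e i)).val (ρ (e j)).val → i = j := by
    intro i j hij
    by_contra hne
    have h1 := hanti i j hne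
    obtain ⟨s, hs, h3⟩ := hij
    rw [h3] at h1
    simp only [smul_mul_assoc, mul_smul_comm] at h1
    have h4 : (2 * s) • ((ρ (e j)).val * (ρ (e j)).val) = 0 := by
      rw [mul_smul, two_smul]; nth_rw 1 [h1]; simp
    have h5 := (smul_eq_zero.1 h4).resolve_left (mul_ne_zero h2 hs)
    rw [← Units.val_mul] at h5
    have := gl_det (ρ (e j) * ρ (e j))
    rw [h5] at this
    simp at this
  have hex : ∀ i γ, ∃ j, Pj (ρ (γ * e i * γ⁻¹)).val (ρ (e j)).val := by
    intro i γ
    exact hcl _ (hN.conj_mem _ (heH i) γ) (fun hh => hes i (isSc_conj ρ hh))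
  let R : Fin 3 → Fin 3 → Prop := fun i j => ∃ γ, Pj (ρ (γ * e i * γ⁻¹)).val (ρ (e j)).val
  have Rsymm : ∀ i j, R i j → R j i := by
    rintro i j ⟨γ, hγ⟩
    refine ⟨γ⁻¹, ?_⟩
    have := Pj.conj ρ hγ.symm γ⁻¹
    have e1 : γ⁻¹ * (γ * e i * γ⁻¹) * γ⁻¹⁻¹ = e i := by group
    rwa [e1] at this
  have Rtrans : ∀ i j m, R i j → R j m → R i m := by
    rintro i j m ⟨γ, hγ⟩ ⟨δ, hδ⟩
    refine ⟨δ * γ, ?_⟩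
    have := (Pj.conj ρ hγ δ).trans hδ
    have e1 : δ * (γ * e i * γ⁻¹) * δ⁻¹ = δ * γ * e i * (δ * γ)⁻¹ := by group
    rwa [e1] at this
  have Rrefl : ∀ i, R i i := fun i => ⟨1, 1, one_ne_zero, by simp⟩
  have Rne : ∀ i, ∃ j, j ≠ i ∧ R i j := by
    intro i
    obtain ⟨γ, hγ⟩ : ∃ γ, γ ∉ Stb ρ (e i) := by
      by_contra! hh
      exact hst i (eq_top_iff.2 fun γ _ => hh γ)
    obtain ⟨j, hj⟩ := hex i γ
    refine ⟨j, ?_, γ, hj⟩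
    rintro rfl
    exact hγ hj
  have R0 : ∀ j, R 0 j := by
    obtain ⟨j0, hj0, r0⟩ := Rne 0
    obtain ⟨j1, hj1, r1⟩ := Rne 1
    obtain ⟨j2, hj2, r2⟩ := Rne 2
    clear_value R
    have h01or : R 0 1 ∨ R 0 2 := by fin_cases j0 <;> simp at hj0 <;> tauto
    have h10or : R 1 0 ∨ R 1 2 := by fin_cases j1 <;> simp at hj1 <;> tauto
    have h20or : R 2 0 ∨ R 2 1 := by fin_cases j2 <;> simp at hj2 <;> tauto
    have h01 : R 0 1 := by
      rcases h01or with h | h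
      · exact h
      · rcases h10or with h' | h'
        · exact Rsymm _ _ h'
        · exact Rtrans _ _ _ h (Rsymm _ _ h')
    have h02 : R 0 2 := by
      rcases h20or with h | h
      · exact Rsymm _ _ h
      · exact Rtrans _ _ _ h01 (Rsymm _ _ h)
    intro j; fin_cases j
    exacts [Rrefl 0, h01, h02]
  have hHS : H ≤ Stb ρ (e 0) := by
    intro x hx
    by_cases hs : IsSc (ρ x).val
    · refine ⟨1, one_ne_zero, ?_⟩
      rw [one_smul, map_mul, map_mul, Units.val_mul, Units.val_mul]
      have h3 := isSc_eq hs
      have : (ρ x).val * (ρ (e 0)).val = (ρ (e 0)).val * (ρ x).val := by rw [h3]; simp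
      rw [this, mul_assoc, ← Units.val_mul, ← map_mul]; simp
    · obtain ⟨i, s, hs, hi⟩ := hcl x hx hs
      have : ∃ t : k, t ≠ 0 ∧ (ρ x).val * (ρ (e 0)).val = t • ((ρ (e 0)).val * (ρ x).val) := by
        by_cases hi0 : i = 0
        · subst hi0
          exact ⟨1, one_ne_zero, by rw [hi]; simp⟩
        · refine ⟨-1, neg_ne_zero.2 one_ne_zero, ?_⟩
          rw [hi, smul_mul_assoc, hanti i 0 hi0]; simp
      obtain ⟨t, ht, h3⟩ := this
      refine ⟨t, ht, ?_⟩
      rw [map_mul, map_mul, Units.val_mul, Units.val_mul, h3, smul_mul_assoc, mul_assoc,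
        ← Units.val_mul (ρ x), ← map_mul ρ x]; simp
  refine ⟨Stb ρ (e 0), (ρ (e 0)).val, hes 0, fun g hg => caseD_comm ρ hg,
    Or.inr ⟨H_normal _ (fun a b => hHS (hcom a b)), ?_⟩, ?_, ?_⟩
  · choose f hf using hex 0
    have hf1 : ∀ γ j, Pj (ρ (γ * e 0 * γ⁻¹)).val (ρ (e j)).val → f γ = j := by
      intro γ j hj
      exact huniq _ _ ((hf γ).symm.trans hj)
    have hf2 : ∀ a b, f a = f b ↔ a⁻¹ * b ∈ Stb ρ (e 0) := by
      intro a b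
      constructor
      · intro hab
        have h1 := (hf b).trans (hab ▸ (hf a).symm)
        have h3 := Pj.conj ρ h1 a⁻¹
        rw [mem_Stb]
        convert h3 using 3 <;> group
      · intro hab
        have h3 := Pj.conj ρ (mem_Stb ρ |>.1 hab) a
        have e1 : a * (a⁻¹ * b * e 0 * (a⁻¹ * b)⁻¹) * a⁻¹ = b * e 0 * b⁻¹ := by group
        rw [e1] at h3
        exact (hf1 b _ (h3.trans (hf a))).symm
    let F : Γ ⧸ Stb ρ (e 0) → Fin 3 := Quotient.lift f (by
      intro a b hab
      exact (hf2 a b).2 (QuotientGroup.leftRel_apply.1 hab))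
    have hF : Function.Bijective F := by
      constructor
      · intro x y
        induction x using QuotientGroup.induction_on with | _ a => ?_
        induction y using QuotientGroup.induction_on with | _ b => ?_
        intro hab
        exact QuotientGroup.eq.2 ((hf2 a b).1 hab)
      · intro j
        obtain ⟨γ, hγ⟩ := R0 j
        exact ⟨(γ : Γ ⧸ Stb ρ (e 0)), hf1 γ j hγ⟩
    rw [Subgroup.index, Nat.card_eq_of_bijective F hF, Nat.card_fin]
  · intro v hv hh
    have m0 := hHS (heH 0)
    have m1 := hHS (heH 1)
    obtain ⟨s, hs⟩ := (hh _ m0).exists_smul hv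
    obtain ⟨t, ht⟩ := (hh _ m1).exists_smul hv
    have ne := xt_mulVec_ne_zero (ρ (e 0 * e 1)) hv
    have h1 : xt Ω (ρ (e 0 * e 1)).val *ᵥ v = (s * t) • v := by
      rw [map_mul, Units.val_mul, xt_mul, ← mulVec_mulVec, ht, mulVec_smul, hs, smul_smul, mul_comm]
    have h3 : xt Ω (ρ (e 0 * e 1)).val *ᵥ v = - ((s * t) • v) := by
      rw [map_mul, Units.val_mul, hanti 0 1 (by decide)]
      have : xt Ω (-((ρ (e 1)).val * (ρ (e 0)).val)) = -(xt Ω (ρ (e 1)).val * xt Ω (ρ (e 0)).val) := by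
        rw [← xt_mul, xt_neg]
      rw [this, neg_mulVec, ← mulVec_mulVec, hs, mulVec_smul, ht, smul_smul]
    have h4 : (2 : Ω) • ((s * t) • v) = 0 := by
      rw [two_smul]; nth_rw 1 [← h1]; rw [h3]; simp
    have h2Ω : (2 : Ω) ≠ 0 := by
      have := (map_ne_zero (algebraMap k Ω)).2 h2
      rwa [map_ofNat] at this
    exact ne (h1.trans ((smul_eq_zero.1 h4).resolve_left h2Ω))
  · intro x hx
    rw [MonoidHom.mem_ker] at hx
    refine ⟨1, one_ne_zero, ?_⟩
    simp [hx]

end CaseD3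



section Ind

set_option linter.unusedSectionVars false
set_option linter.unusedVariables false

section lin
variable {F : Type*} [Field F]

lemma row_scalar {A : Matrix (Fin 2) (Fin 2) F} {v w : Fin 2 → F} (hvw : ¬ Par v w) {α : F}
    (h1 : v ᵥ* A = α • v) (h2 : w ᵥ* A = α • w) : IsSc A := by
  have hD : v 0 * w 1 - v 1 * w 0 ≠ 0 := fun h => hvw (sub_eq_zero.1 h)
  have a0 := congrFun h1 0
  have a1 := congrFun h1 1
  have b0 := congrFun h2 0
  have b1 := congrFun h2 1
  simp [Matrix.vecMul, dotProduct, Fin.sum_univ_two] at a0 a1 b0 b1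
  have e1 : A 0 1 * (v 0 * w 1 - v 1 * w 0) = 0 := by linear_combination w 1 * a1 - v 1 * b1
  have e2 : A 1 0 * (v 0 * w 1 - v 1 * w 0) = 0 := by linear_combination v 0 * b0 - w 0 * a0
  have e3 : (A 0 0 - A 1 1) * (v 0 * w 1 - v 1 * w 0) = 0 := by
    linear_combination w 1 * a0 - v 1 * b0 - (v 0 * b1 - w 0 * a1)
  simp only [mul_eq_zero, hD, or_false] at e1 e2 e3
  exact ⟨e1, e2, sub_eq_zero.1 e3⟩

lemma row_trace {A : Matrix (Fin 2) (Fin 2) F} {v w : Fin 2 → F} (hvw : ¬ Par v w) {α β : F}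
    (h1 : v ᵥ* A = α • v) (h2 : w ᵥ* A = β • w) : α + β = A.trace := by
  have hD : v 0 * w 1 - v 1 * w 0 ≠ 0 := fun h => hvw (sub_eq_zero.1 h)
  have a0 := congrFun h1 0
  have a1 := congrFun h1 1
  have b0 := congrFun h2 0
  have b1 := congrFun h2 1
  simp [Matrix.vecMul, dotProduct, Fin.sum_univ_two] at a0 a1 b0 b1
  rw [trace_fin_two]
  have e3 : (α + β - (A 0 0 + A 1 1)) * (v 0 * w 1 - v 1 * w 0) = 0 := by
    linear_combination -(w 1 * a0 - v 1 * b0 + (v 0 * b1 - w 0 * a1))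
  simp only [mul_eq_zero, hD, or_false] at e3
  exact sub_eq_zero.1 e3

lemma row_two {A : Matrix (Fin 2) (Fin 2) F} (hA : ¬ IsSc A) {u v w : Fin 2 → F} {α β γ : F}
    (h1 : u ᵥ* A = α • u) (h2 : v ᵥ* A = β • v) (h3 : w ᵥ* A = γ • w)
    (huv : ¬ Par u v) (huw : ¬ Par u w) : Par v w := by
  by_contra hvw
  have t1 := row_trace huv h1 h2
  have t2 := row_trace huw h1 h3
  have t3 := row_trace hvw h2 h3
  have e : α = β := by linear_combination t2 - t3
  subst e
  exact hA (row_scalar huv h1 h2)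

end lin

variable {k k' : Type*} [Field k] [Field k'] [Algebra k k'] {Γ : Type*} [Group Γ]
  (ρ : Γ →* GL (Fin 2) k)

theorem ind_data (F₁ F₂ : Subgroup Γ) (hle : F₂ ≤ F₁) (lam : Fin 2 → k') (hlam0 : lam ≠ 0)
    (hlam : ∀ g ∈ F₂, ∃ c : k', lam ᵥ* xt k' (ρ g).val = c • lam)
    (s : Γ) (hs : s ∈ F₁) (hs2 : ¬ Par lam (lam ᵥ* xt k' (ρ s).val))
    (hdec : ∀ g ∈ F₁, g ∈ F₂ ∨ g * s⁻¹ ∈ F₂) :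
    ∃ θ : F₂ →* k'ˣ, (∀ h : F₂, ρ h = 1 → θ h = 1) ∧
      ∃ V : Submodule k' (F₁ → k'),
        (∀ f : F₁ → k', f ∈ V ↔ ∀ (h g : F₁) (hh : (h : Γ) ∈ F₂),
          f (h * g) = (θ ⟨↑h, hh⟩ : k') * f g) ∧
        ∃ e : (Fin 2 → k') ≃ₗ[k'] V, ∀ (g : F₁) (v : Fin 2 → k') (x : F₁),
          (e (((ρ ↑g).val.map (algebraMap k k')).mulVec v) : F₁ → k') x =
            (e v : F₁ → k') (x * g) := by
  have hxm : ∀ a b : Γ, xt k' (ρ (a * b)).val = xt k' (ρ a).val * xt k' (ρ b).val := by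
    intro a b; rw [map_mul, Units.val_mul, xt_mul]
  have hx1 : xt k' (ρ (1 : Γ)).val = 1 := by rw [map_one, Units.val_one, xt_one]
  choose c hc using hlam
  have cuniq : ∀ x y : k', x • lam = y • lam → x = y := fun x y h => smul_left_injective k' hlam0 h
  let θ0 : F₂ →* k' :=
    { toFun := fun g => c g.1 g.2
      map_one' := by
        apply cuniq
        rw [← hc]
        simp [xt_one]
      map_mul' := by
        intro g h
        apply cuniq
        rw [← hc, Subgroup.coe_mul, hxm, ← vecMul_vecMul, hc _ g.2, smul_vecMul, hc _ h.2, smul_smul] }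
  have hθ0 : ∀ g : F₂, lam ᵥ* xt k' (ρ g).val = θ0 g • lam := fun g => hc g.1 g.2
  refine ⟨θ0.toHomUnits, ?_, ?_⟩
  · intro h hh
    apply Units.ext
    apply cuniq
    rw [MonoidHom.coe_toHomUnits, ← hθ0, hh]
    simp [xt_one]
  let V : Submodule k' (F₁ → k') :=
    { carrier := {f | ∀ (h g : F₁) (hh : (h : Γ) ∈ F₂), f (h * g) = θ0 ⟨↑h, hh⟩ * f g}
      zero_mem' := by intro h g hh; simp
      add_mem' := by
        intro f f' hf hf' h g hh
        simp only [Pi.add_apply, hf h g hh, hf' h g hh, mul_add]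
      smul_mem' := by
        intro c f hf h g hh
        simp only [Pi.smul_apply, hf h g hh, smul_eq_mul]; ring }
  refine ⟨V, fun f => Iff.rfl, ?_⟩
  let E : (Fin 2 → k') →ₗ[k'] (F₁ → k') :=
    { toFun := fun v x => (lam ᵥ* xt k' (ρ x).val) ⬝ᵥ v
      map_add' := by intro v w; ext x; simp [dotProduct_add]
      map_smul' := by intro c v; ext x; simp [dotProduct_smul] }
  have hE : ∀ v x, E v x = (lam ᵥ* xt k' (ρ x).val) ⬝ᵥ v := fun v x => rfl
  have hEV : ∀ v, E v ∈ V := by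
    intro v h g hh
    rw [hE, hE, Subgroup.coe_mul, hxm, ← vecMul_vecMul, hθ0 ⟨h, hh⟩, smul_vecMul, smul_dotProduct,
      smul_eq_mul]
  let E' := E.codRestrict V hEV
  have hD : lam 0 * (lam ᵥ* xt k' (ρ s).val) 1 - lam 1 * (lam ᵥ* xt k' (ρ s).val) 0 ≠ 0 :=
    fun h => hs2 (sub_eq_zero.1 h)
  have hbij : Function.Bijective E' := by
    constructor
    · rw [← LinearMap.ker_eq_bot, LinearMap.ker_eq_bot']
      intro v hv
      have hv' : E v = 0 := congrArg Subtype.val hv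
      have h1 := congrFun hv' 1
      have h2 := congrFun hv' ⟨s, hs⟩
      rw [hE] at h1 h2
      simp only [Subgroup.coe_one, hx1, vecMul_one] at h1
      simp only [dotProduct, Fin.sum_univ_two, Pi.zero_apply] at h1 h2
      have e0 : v 0 * (lam 0 * (lam ᵥ* xt k' (ρ s).val) 1 - lam 1 * (lam ᵥ* xt k' (ρ s).val) 0) = 0 := by
        linear_combination (lam ᵥ* xt k' (ρ s).val) 1 * h1 - lam 1 * h2
      have e1 : v 1 * (lam 0 * (lam ᵥ* xt k' (ρ s).val) 1 - lam 1 * (lam ᵥ* xt k' (ρ s).val) 0) = 0 := by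
        linear_combination lam 0 * h2 - (lam ᵥ* xt k' (ρ s).val) 0 * h1
      rw [mul_eq_zero, or_iff_left hD] at e0 e1
      ext i; fin_cases i
      exacts [e0, e1]
    · rintro ⟨f, hf⟩
      set m := lam ᵥ* xt k' (ρ s).val with hm
      set D := lam 0 * m 1 - lam 1 * m 0 with hDd
      set v : Fin 2 → k' := ![(m 1 * f 1 - lam 1 * f ⟨s, hs⟩) / D,
        (lam 0 * f ⟨s, hs⟩ - m 0 * f 1) / D] with hv
      have v1 : E v 1 = f 1 := by
        rw [hE]
        simp only [Subgroup.coe_one, hx1, vecMul_one, dotProduct, Fin.sum_univ_two]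
        simp only [hv, cons_val_zero, cons_val_one]
        field_simp
        rw [hDd]; ring
      have vs : E v ⟨s, hs⟩ = f ⟨s, hs⟩ := by
        rw [hE]
        simp only [← hm, dotProduct, Fin.sum_univ_two]
        simp only [hv, cons_val_zero, cons_val_one]
        field_simp
        rw [hDd]; ring
      refine ⟨v, Subtype.ext ?_⟩
      show E v = f
      ext g
      rcases hdec g g.2 with hg | hg
      · have h1 := hf g 1 hg
        have h2 := hEV v g 1 hg
        rw [mul_one] at h1 h2
        rw [h1, h2, v1]
      · have h1 := hf (g * ⟨s, hs⟩⁻¹) ⟨s, hs⟩ hg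
        have h2 := hEV v (g * ⟨s, hs⟩⁻¹) ⟨s, hs⟩ hg
        rw [inv_mul_cancel_right] at h1 h2
        rw [h1, h2, vs]
  refine ⟨LinearEquiv.ofBijective E' hbij, ?_⟩
  intro g v x
  show E (xt k' (ρ g).val *ᵥ v) x = E v (x * g)
  rw [hE, hE, Subgroup.coe_mul, hxm, ← vecMul_vecMul, dotProduct_mulVec]

end Ind



section FindK

set_option linter.unusedSectionVars false
set_option linter.unusedVariables false

variable {k : Type*} [Field k] {Γ : Type*} [Group Γ] (ρ : Γ →* GL (Fin 2) k)

theorem find_lam {k' : Type*} [Field k'] [Algebra k k'] (G₁ : Subgroup Γ)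
    (a : Matrix (Fin 2) (Fin 2) k) (ha : ¬ IsSc a)
    (hcomm : ∀ g ∈ G₁, a * ((ρ g).val * a * ((ρ g)⁻¹).val) = ((ρ g).val * a * ((ρ g)⁻¹).val) * a)
    (lam : Fin 2 → k') (hlam0 : lam ≠ 0) (μ : k') (hlam : lam ᵥ* xt k' a = μ • lam)
    (hker : ρ.ker ≤ G₁)
    (hirr : ¬ ∀ g ∈ G₁, Par (lam ᵥ* xt k' (ρ g).val) lam) :
    ∃ G₂ ≤ G₁, ρ.ker ≤ G₂ ∧ (∀ g ∈ G₂, ∃ c : k', lam ᵥ* xt k' (ρ g).val = c • lam) ∧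
      ∃ s ∈ G₁, ¬ Par lam (lam ᵥ* xt k' (ρ s).val) ∧ (∀ g ∈ G₁, g ∈ G₂ ∨ g * s⁻¹ ∈ G₂) ∧
      G₂.relIndex G₁ = 2 := by
  have hxm : ∀ a b : Γ, xt k' (ρ (a * b)).val = xt k' (ρ a).val * xt k' (ρ b).val := by
    intro a b; rw [map_mul, Units.val_mul, xt_mul]
  have hx1 : xt k' (ρ (1 : Γ)).val = 1 := by rw [map_one, Units.val_one, xt_one]
  have hA : ¬ IsSc (xt k' a) := fun h => ha ((isSc_xt _).1 h)
  have heig : ∀ g ∈ G₁, ∃ c : k', (lam ᵥ* xt k' (ρ g).val) ᵥ* xt k' a = c • (lam ᵥ* xt k' (ρ g).val) := by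
    intro g hg
    have e := congrArg (xt k') (hcomm g hg)
    rw [xt_mul, xt_mul _ a] at e
    set B := xt k' ((ρ g).val * a * ((ρ g)⁻¹).val) with hB
    have hBg : B * xt k' (ρ g).val = xt k' (ρ g).val * xt k' a := by
      rw [hB, ← xt_mul, ← xt_mul, mul_assoc, ← Units.val_mul, inv_mul_cancel, Units.val_one, mul_one]
    have hBA : (lam ᵥ* B) ᵥ* xt k' a = μ • (lam ᵥ* B) := by
      rw [vecMul_vecMul, ← e, ← vecMul_vecMul, hlam, smul_vecMul]
    have hp : Par (lam ᵥ* B) lam := by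
      by_contra h
      exact hA (row_scalar h hBA hlam)
    obtain ⟨c, hc⟩ := hp.exists_smul hlam0
    refine ⟨c, ?_⟩
    rw [vecMul_vecMul, ← hBg, ← vecMul_vecMul, hc, smul_vecMul]
  let G₂ : Subgroup Γ :=
    { carrier := {g | g ∈ G₁ ∧ ∃ c : k', c ≠ 0 ∧ lam ᵥ* xt k' (ρ g).val = c • lam}
      one_mem' := ⟨one_mem _, 1, one_ne_zero, by rw [hx1]; simp⟩
      mul_mem' := by
        rintro x y ⟨hx, c, hc0, hc⟩ ⟨hy, d, hd0, hd⟩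
        refine ⟨mul_mem hx hy, c * d, mul_ne_zero hc0 hd0, ?_⟩
        rw [hxm, ← vecMul_vecMul, hc, smul_vecMul, hd, smul_smul]
      inv_mem' := by
        rintro x ⟨hx, c, hc0, hc⟩
        refine ⟨inv_mem hx, c⁻¹, inv_ne_zero hc0, ?_⟩
        have : lam ᵥ* xt k' (ρ (x * x⁻¹)).val = lam := by rw [mul_inv_cancel, hx1, vecMul_one]
        rw [hxm, ← vecMul_vecMul, hc, smul_vecMul] at this
        rw [← this, smul_smul, inv_mul_cancel₀ hc0, one_smul, this] }
  have hne : ∀ g, lam ᵥ* xt k' (ρ g).val ≠ 0 := by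
    intro g h
    have : lam ᵥ* xt k' (ρ (g * g⁻¹)).val = lam := by rw [mul_inv_cancel, hx1, vecMul_one]
    rw [hxm, ← vecMul_vecMul, h, zero_vecMul] at this
    exact hlam0 this.symm
  have hG₂ : ∀ g ∈ G₁, Par (lam ᵥ* xt k' (ρ g).val) lam → g ∈ G₂ := by
    intro g hg hp
    obtain ⟨c, hc⟩ := hp.exists_smul hlam0
    refine ⟨hg, c, ?_, hc⟩
    rintro rfl
    exact hne g (by simpa using hc)
  push Not at hirr
  obtain ⟨s, hs, hs2⟩ := hirr
  have hs3 : ¬ Par lam (lam ᵥ* xt k' (ρ s).val) := fun h => hs2 h.symm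
  have hdec : ∀ g ∈ G₁, g ∈ G₂ ∨ g * s⁻¹ ∈ G₂ := by
    intro g hg
    by_cases hp : Par (lam ᵥ* xt k' (ρ g).val) lam
    · exact Or.inl (hG₂ g hg hp)
    right
    obtain ⟨c, hc⟩ := heig g hg
    obtain ⟨d, hd⟩ := heig s hs
    have h := row_two hA hlam hc hd (fun h => hp h.symm) hs3
    obtain ⟨e, he⟩ := h.exists_smul (hne s)
    apply hG₂ _ (mul_mem hg (inv_mem hs))
    rw [hxm, ← vecMul_vecMul, he, smul_vecMul, vecMul_vecMul, ← hxm, mul_inv_cancel, hx1, vecMul_one]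
    simp only [Par, Pi.smul_apply, smul_eq_mul]; ring
  have hle : G₂ ≤ G₁ := fun g hg => hg.1
  have hsn : s ∉ G₂ := by
    rintro ⟨_, c, _, hc⟩
    apply hs2
    rw [hc]
    simp only [Par, Pi.smul_apply, smul_eq_mul]; ring
  refine ⟨G₂, hle, ?_, ?_, s, hs, hs3, hdec, ?_⟩
  · intro g hg
    refine ⟨hker hg, 1, one_ne_zero, ?_⟩
    rw [MonoidHom.mem_ker.1 hg]; simp
  · rintro g ⟨_, c, _, hc⟩; exact ⟨c, hc⟩
  · rw [Subgroup.relIndex, Subgroup.index_eq_two_iff]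
    refine ⟨⟨s⁻¹, inv_mem hs⟩, fun ⟨b, hb⟩ => ?_⟩
    simp only [Subgroup.mem_subgroupOf, Subgroup.coe_mul]
    rcases hdec b hb with h | h
    · right
      refine ⟨h, fun h' => ?_⟩
      have := mul_mem (inv_mem h) h'
      rw [inv_mul_cancel_left] at this
      exact hsn (inv_mem_iff.1 this)
    · left
      refine ⟨h, fun h' => ?_⟩
      have := mul_mem (inv_mem h') h
      rw [inv_mul_cancel_left] at this
      exact hsn (inv_mem_iff.1 this)

theorem find_k {Ω : Type} [Field Ω] [IsAlgClosed Ω] [Algebra k Ω] (G₁ : Subgroup Γ)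
    (a : Matrix (Fin 2) (Fin 2) k) (ha : ¬ IsSc a)
    (hcomm : ∀ g ∈ G₁, a * ((ρ g).val * a * ((ρ g)⁻¹).val) = ((ρ g).val * a * ((ρ g)⁻¹).val) * a)
    (hker : ρ.ker ≤ G₁)
    (hirr : ∀ v : Fin 2 → Ω, v ≠ 0 → ¬ ∀ γ ∈ G₁, Par (xt Ω (ρ γ).val *ᵥ v) v) :
    ∃ (k' : Type) (_ : Field k') (_ : Algebra k k'), Module.finrank k k' ≤ 2 ∧
    ∃ lam : Fin 2 → k', lam ≠ 0 ∧
    ∃ G₂ ≤ G₁, ρ.ker ≤ G₂ ∧ (∀ g ∈ G₂, ∃ c : k', lam ᵥ* xt k' (ρ g).val = c • lam) ∧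
      ∃ s ∈ G₁, ¬ Par lam (lam ᵥ* xt k' (ρ s).val) ∧ (∀ g ∈ G₁, g ∈ G₂ ∨ g * s⁻¹ ∈ G₂) ∧
      G₂.relIndex G₁ = 2 := by
  have hdeg : a.charpoly.natDegree = 2 := by
    rw [Matrix.charpoly_natDegree_eq_dim, Fintype.card_fin]
  obtain ⟨μ, hμ⟩ := IsAlgClosed.exists_aeval_eq_zero Ω a.charpoly (by
    intro h
    rw [Polynomial.natDegree_eq_of_degree_eq_some h] at hdeg
    exact absurd hdeg (by norm_num))
  have hint : IsIntegral k μ := ⟨a.charpoly, a.charpoly_monic, hμ⟩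
  let k' : IntermediateField k Ω := IntermediateField.adjoin k {μ}
  have hfin : Module.finrank k k' ≤ 2 := by
    rw [IntermediateField.adjoin.finrank hint, ← hdeg]
    exact Polynomial.natDegree_le_of_dvd (minpoly.dvd k μ hμ) a.charpoly_monic.ne_zero
  let μ' : k' := IntermediateField.AdjoinSimple.gen k μ
  have hμ' : aeval μ' a.charpoly = 0 := by
    apply (algebraMap k' Ω).injective
    rw [map_zero, ← Polynomial.aeval_algebraMap_apply]
    exact hμ
  have hdet : (Matrix.scalar (Fin 2) μ' - xt k' a).det = 0 := by
    rw [← Matrix.eval_charpoly]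
    rw [show (xt k' a).charpoly = a.charpoly.map (algebraMap k k') from Matrix.charpoly_map _ _]
    rw [Polynomial.eval_map_algebraMap, hμ']
  obtain ⟨lam, hlam0, hlam⟩ := Matrix.exists_vecMul_eq_zero_iff.2 hdet
  have hlam' : lam ᵥ* xt k' a = μ' • lam := by
    rw [vecMul_sub, sub_eq_zero] at hlam
    rw [← hlam]
    ext i
    simp [Matrix.scalar_apply, vecMul_diagonal, mul_comm]
  refine ⟨k', inferInstance, inferInstance, hfin, lam, hlam0, ?_⟩
  apply find_lam ρ G₁ a ha hcomm lam hlam0 μ' hlam' hker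
  intro hall
  let v : Fin 2 → Ω := ![algebraMap k' Ω (lam 1), - algebraMap k' Ω (lam 0)]
  have hinj := (algebraMap k' Ω).injective
  refine hirr v ?_ ?_
  · intro h
    apply hlam0
    have h0 : algebraMap k' Ω (lam 1) = 0 := congrFun h 0
    have h1 : - algebraMap k' Ω (lam 0) = 0 := congrFun h 1
    rw [neg_eq_zero, map_eq_zero_iff _ hinj] at h1
    rw [map_eq_zero_iff _ hinj] at h0
    ext i; fin_cases i
    · exact congrArg Subtype.val h1
    · exact congrArg Subtype.val h0
  · intro g hg
    have h := congrArg (algebraMap k' Ω) (hall g hg)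
    simp only [xt, vecMul, dotProduct, Fin.sum_univ_two, map_mul, map_add, Matrix.map_apply,
      ← IsScalarTower.algebraMap_apply] at h
    simp only [Par, v, xt, mulVec, dotProduct, Fin.sum_univ_two, Matrix.map_apply, cons_val_zero, cons_val_one]
    linear_combination (-1 : Ω) * h

end FindK



section Gal

set_option linter.unusedSectionVars false
set_option linter.unusedVariables false

lemma gal_comm (l : ℕ) [Fact l.Prime] (K : Type*) [Field K] [NumberField K]
    (a b : AlgebraicClosure K ≃ₐ[K] AlgebraicClosure K) :
    a * b * a⁻¹ * b⁻¹ ∈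
      (IntermediateField.adjoin K {x : AlgebraicClosure K | x ^ l = 1}).fixingSubgroup := by
  have hl0 : NeZero l := ⟨(Fact.out : l.Prime).ne_zero⟩
  have hl1 : NeZero (l : AlgebraicClosure K) := ⟨Nat.cast_ne_zero.2 hl0.1⟩
  obtain ⟨z, hz⟩ := HasEnoughRootsOfUnity.exists_primitiveRoot (AlgebraicClosure K) l
  have key : ∀ y : AlgebraicClosure K, y ^ l = 1 → a (b y) = b (a y) := by
    intro y hy
    obtain ⟨i, _, rfl⟩ := hz.eq_pow_of_pow_eq_one hy
    obtain ⟨p, _, hp⟩ := hz.eq_pow_of_pow_eq_one (ξ := a z) (by rw [← map_pow, hz.pow_eq_one, map_one])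
    obtain ⟨q, _, hq⟩ := hz.eq_pow_of_pow_eq_one (ξ := b z) (by rw [← map_pow, hz.pow_eq_one, map_one])
    rw [map_pow, map_pow, map_pow, map_pow, ← hp, ← hq, map_pow, map_pow, ← hp, ← hq]
    ring
  have hS : IntermediateField.adjoin K {x : AlgebraicClosure K | x ^ l = 1} ≤
      IntermediateField.fixedField (Subgroup.zpowers (a * b * a⁻¹ * b⁻¹)) := by
    rw [IntermediateField.adjoin_le_iff]
    intro x hx
    have h1 : (a * b * a⁻¹ * b⁻¹) x = x := by
      have := key (a⁻¹ (b⁻¹ x)) (by rw [← map_pow, ← map_pow, hx, map_one, map_one])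
      rw [AlgEquiv.mul_apply, AlgEquiv.mul_apply, AlgEquiv.mul_apply, this, ← AlgEquiv.mul_apply a, mul_inv_cancel,
        AlgEquiv.one_apply, ← AlgEquiv.mul_apply b, mul_inv_cancel, AlgEquiv.one_apply]
    rw [SetLike.mem_coe, IntermediateField.mem_fixedField_iff]
    intro f hf
    have : f ∈ MulAction.stabilizer (AlgebraicClosure K ≃ₐ[K] AlgebraicClosure K) x :=
      (Subgroup.zpowers_le.2 (MulAction.mem_stabilizer_iff.2 h1)) hf
    exact MulAction.mem_stabilizer_iff.1 this
  have h2 := (IntermediateField.le_iff_le _ _).1 hS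
  exact h2 (Subgroup.mem_zpowers _)

lemma irr_transfer {k Ω E : Type*} [Field k] [Field Ω] [Algebra k Ω] [Field E] [Algebra k E]
    (ψ : Ω →ₐ[k] E) {Γ : Type*} [Group Γ] (ρ : Γ →* GL (Fin 2) k)
    (habs : ∀ U : Submodule E (Fin 2 → E),
      (∀ v ∈ U, ∀ g : Γ, ((ρ g).val.map (algebraMap k E)).mulVec v ∈ U) → U = ⊥ ∨ U = ⊤)
    (v : Fin 2 → Ω) (hv : v ≠ 0) : ¬ ∀ γ, Par (xt Ω (ρ γ).val *ᵥ v) v := by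
  intro hall
  have hψ := ψ.toRingHom.injective
  set v' : Fin 2 → E := fun i => ψ (v i) with hv'
  have hv0 : v' ≠ 0 := by
    intro h
    apply hv
    ext i
    apply hψ
    have := congrFun h i
    simpa [hv'] using this
  have hinv : ∀ g, ∃ c : E, xt E (ρ g).val *ᵥ v' = c • v' := by
    intro g
    obtain ⟨c, hc⟩ := (hall g).exists_smul hv
    refine ⟨ψ c, ?_⟩
    ext i
    have := congrArg ψ (congrFun hc i)
    simpa [mulVec, dotProduct, Fin.sum_univ_two, hv'] using this
  rcases habs (Submodule.span E {v'}) (by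
    intro x hx g
    obtain ⟨c, rfl⟩ := Submodule.mem_span_singleton.1 hx
    obtain ⟨d, hd⟩ := hinv g
    rw [mulVec_smul]
    apply Submodule.smul_mem
    rw [hd]
    exact Submodule.smul_mem _ _ (Submodule.mem_span_singleton_self _)) with h | h
  · rw [Submodule.span_singleton_eq_bot] at h
    exact hv0 h
  · have h1 : Module.finrank E (Submodule.span E {v'}) = 1 := finrank_span_singleton hv0
    rw [h, finrank_top, Module.finrank_fin_fun] at h1
    omega

end Gal

/-- let `l > 5` be prime and `k` an algebraic extension of `𝔽_l`
containing a primitive cube root of unity.  Let `K` be a number field and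
`r : Gal(K̄/K) → GL₂(k)` a continuous (for the Krull topology, `k` discrete) absolutely
irreducible representation.  Then either `r(Gal(K̄/K(ζ_l)))` is 2-big, or there are
intermediate fields `K ⊆ K₁ ⊆ K₂ ⊆ K̄` with `K₁/K` trivial or cubic Galois and `K₂/K₁`
quadratic, an extension `k'/k` of degree at most 2, and a continuous character
`θ̄ : Gal(K̄/K₂) → k'^×` with `r|_{Gal(K̄/K₁)} ⊗ k' ≅ Ind_{Gal(K̄/K₂)}^{Gal(K̄/K₁)} θ̄`,
the induction being realised on functions `f : Gal(K̄/K₁) → k'` with `f(hg) = θ̄(h) f(g)`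
for `h ∈ Gal(K̄/K₂)`, with the Galois group acting by right translation. -/
theorem isTwoBig_or_induced_of_galois_rep (l : ℕ) [Fact l.Prime] (hl : 5 < l)
    (k : Type*) [Field k] [Algebra (ZMod l) k] [Algebra.IsAlgebraic (ZMod l) k]
    (ζ : k) (hζ : IsPrimitiveRoot ζ 3)
    (K : Type*) [Field K] [NumberField K]
    (r : (AlgebraicClosure K ≃ₐ[K] AlgebraicClosure K) →* GL (Fin 2) k)
    (hcont : @Continuous _ _ _ ⊥ ⇑r)
    (habs : ∀ U : Submodule (AlgebraicClosure k) (Fin 2 → AlgebraicClosure k),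
      (∀ v ∈ U, ∀ g : AlgebraicClosure K ≃ₐ[K] AlgebraicClosure K,
        ((r g).val.map (algebraMap k (AlgebraicClosure k))).mulVec v ∈ U) →
      U = ⊥ ∨ U = ⊤) :
    IsMBig l 2 (Subgroup.map r
      (IntermediateField.adjoin K {x : AlgebraicClosure K | x ^ l = 1}).fixingSubgroup) ∨
    ∃ K₁ K₂ : IntermediateField K (AlgebraicClosure K), K₁ ≤ K₂ ∧
      (K₁ = ⊥ ∨ (Module.finrank K K₁ = 3 ∧ IsGalois K K₁)) ∧
      Module.finrank K K₂ = 2 * Module.finrank K K₁ ∧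
      ∃ (k' : Type) (_ : Field k') (_ : Algebra k k'), Module.finrank k k' ≤ 2 ∧
      ∃ θ : K₂.fixingSubgroup →* k'ˣ,
        (@Continuous _ _ _ ⊥ (fun h : K₂.fixingSubgroup => θ h)) ∧
        ∃ V : Submodule k' (K₁.fixingSubgroup → k'),
          (∀ f : K₁.fixingSubgroup → k', f ∈ V ↔
            ∀ (h g : K₁.fixingSubgroup)
              (hh : (h : AlgebraicClosure K ≃ₐ[K] AlgebraicClosure K) ∈ K₂.fixingSubgroup),
              f (h * g) = (θ ⟨↑h, hh⟩ : k') * f g) ∧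
          ∃ e : (Fin 2 → k') ≃ₗ[k'] V,
            ∀ (g : K₁.fixingSubgroup) (v : Fin 2 → k') (x : K₁.fixingSubgroup),
              (e (((r ↑g).val.map (algebraMap k k')).mulVec v) : K₁.fixingSubgroup → k') x =
                (e v : K₁.fixingSubgroup → k') (x * g) := by
  
  have hch : CharP k l := charP_of_injective_algebraMap (algebraMap (ZMod l) k).injective l
  let Ω : Type := AlgebraicClosure (ZMod l)
  let φ : k →ₐ[ZMod l] Ω := IsAlgClosed.lift
  let _ : Algebra k Ω := φ.toRingHom.toAlgebra
  have : IsScalarTower (ZMod l) k Ω := IsScalarTower.of_algebraMap_eq fun x => (φ.commutes x).symm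
  have : Algebra.IsAlgebraic k Ω := Algebra.IsAlgebraic.tower_top (K := ZMod l) k
  let ψ : Ω →ₐ[k] AlgebraicClosure k := IsAlgClosed.lift
  have hirr := irr_transfer ψ r habs
  have hkero : IsOpen (r.ker : Set (AlgebraicClosure K ≃ₐ[K] AlgebraicClosure K)) := by
    have : (r.ker : Set (AlgebraicClosure K ≃ₐ[K] AlgebraicClosure K)) = r ⁻¹' {1} := by
      ext x; simp [MonoidHom.mem_ker]
    rw [this]
    exact @IsOpen.preimage _ _ _ ⊥ _ hcont _ trivial
  have hopen : ∀ G : Subgroup (AlgebraicClosure K ≃ₐ[K] AlgebraicClosure K), r.ker ≤ G →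
      ∃ L : IntermediateField K (AlgebraicClosure K), L.fixingSubgroup = G := by
    intro G hG
    have hGc := G.isClosed_of_isOpen (Subgroup.isOpen_mono hG hkero)
    exact ⟨_, InfiniteGalois.fixingSubgroup_fixedField ⟨G, hGc⟩⟩
  set N := (IntermediateField.adjoin K {x : AlgebraicClosure K | x ^ l = 1}).fixingSubgroup with hN
  have hcomm : ∀ a b, a * b * a⁻¹ * b⁻¹ ∈ N := gal_comm l K
  have hrange : (Set.range r).Finite := by
    let _ : TopologicalSpace (GL (Fin 2) k) := ⊥
    have : DiscreteTopology (GL (Fin 2) k) := ⟨rfl⟩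
    exact (isCompact_range hcont).finite_of_discrete
  have : Finite (Subgroup.map r N) := by
    apply (hrange.subset _).to_subtype
    rintro _ ⟨x, _, rfl⟩
    exact ⟨x, rfl⟩
  have h2 : (2 : k) ≠ 0 := (nat_ne l hl).1
  have h2Ω : (2 : Ω) ≠ 0 := by
    intro h
    apply h2
    apply (algebraMap k Ω).injective
    rw [map_zero, map_ofNat, h]
  by_cases hND : ND Ω (Subgroup.map r N).subtype
  · left
    obtain ⟨b1, b2, b3⟩ := bigness (Ω := Ω) (Subgroup.map r N).subtype l hl ζ hζ
      (Subgroup.subtype_injective _) hND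
    refine ⟨b1, ?_, ?_, ?_⟩
    · intro X hX hc
      exact h0_of_ND (Ω := Ω) (Subgroup.map r N).subtype h2Ω hND X hX hc
    · intro c h1 h2
      exact b2 c ⟨h1, h2⟩
    · intro W hW hW0 _
      exact b3 W hW hW0
  · right
    unfold ND at hND
    push Not at hND
    obtain ⟨v, w, hv, hw, hvw⟩ := hND
    obtain ⟨G₁, a, ha, hac, hG₁, hirr₁, hker₁⟩ := caseD (Ω := Ω) r h2 N hcomm hirr hv hw
      (fun h hh => hvw ⟨r h, Subgroup.mem_map_of_mem r hh⟩)
    obtain ⟨k', fk', ak', hfin, lam, hlam0, G₂, hle, hker₂, hlam, s, hs, hs2, hdec, hrel⟩ :=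
      find_k (Ω := Ω) r G₁ a ha hac hker₁ hirr₁
    obtain ⟨K₁, rfl⟩ := hopen G₁ hker₁
    obtain ⟨K₂, rfl⟩ := hopen G₂ hker₂
    refine ⟨K₁, K₂, ?_, ?_, ?_, k', fk', ak', hfin, ?_⟩
    · rw [← InfiniteGalois.fixedField_fixingSubgroup K₂]
      exact (IntermediateField.le_iff_le _ _).2 hle
    · rcases hG₁ with h | ⟨hn, hi⟩
      · left
        rw [← InfiniteGalois.fixedField_fixingSubgroup K₁, h]
        exact InfiniteGalois.fixedField_bot
      · right
        exact ⟨by rw [IntermediateField.finrank_eq_fixingSubgroup_index, hi],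
          (InfiniteGalois.normal_iff_isGalois K₁).1 hn⟩
    · rw [IntermediateField.finrank_eq_fixingSubgroup_index,
        IntermediateField.finrank_eq_fixingSubgroup_index, ← Subgroup.relIndex_mul_index hle, hrel]
    · obtain ⟨θ, hθ, hV⟩ := ind_data r K₁.fixingSubgroup K₂.fixingSubgroup hle lam hlam0 hlam s hs hs2 hdec
      refine ⟨θ, ?_, hV⟩
      let _ : TopologicalSpace k'ˣ := ⊥
      have : DiscreteTopology k'ˣ := ⟨rfl⟩
      have hko : IsOpen (θ.ker : Set K₂.fixingSubgroup) := by
        refine Subgroup.isOpen_mono (H₁ := r.ker.subgroupOf K₂.fixingSubgroup) ?_ ?_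
        · intro x hx
          exact hθ x hx
        · exact hkero.preimage continuous_subtype_val
      show Continuous θ
      refine continuous_of_continuousAt_one θ ?_
      rw [ContinuousAt, map_one, nhds_discrete k'ˣ, Filter.tendsto_pure]
      exact hko.mem_nhds (one_mem θ.ker)
end

section
/- Let l > 5 be a prime and k an algebraic extension of F_l. Let G = SL_2(F_5) (the binary icosahedral group 2.A_5) and let r : G → GL_2(k) be an injective group homomorphism such that k^2 is irreducible as a k[G]-module via r. Then the representation ad^0 r of G on the trace-zero 2-by-2 matrices sl_2(k), with g acting by conjugation by r(g), is irreducible. -/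
open Matrix

theorem aux_comm {k : Type*} [Field k] (h2 : (2 : k) ≠ 0) (X A : Matrix (Fin 2) (Fin 2) k)
    (hX : X ≠ 0) (ht : X.trace = 0) (hc : A * X = X * A) :
    ∃ s c : k, A = s • (1 : Matrix (Fin 2) (Fin 2) k) + c • X := by
  have e00 := congrFun (congrFun hc 0) 0
  have e01 := congrFun (congrFun hc 0) 1
  have e10 := congrFun (congrFun hc 1) 0
  simp only [Matrix.mul_apply, Fin.sum_univ_two] at e00 e01 e10
  rw [Matrix.trace_fin_two] at ht
  have hd : X 1 1 = - X 0 0 := by linear_combination ht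
  rw [hd] at e01 e10
  by_cases hy : X 0 1 = 0
  · by_cases hz : X 1 0 = 0
    · have hx : X 0 0 ≠ 0 := by
        intro hx
        apply hX
        ext i j
        fin_cases i <;> fin_cases j <;> simp [hx, hy, hz, hd]
      refine ⟨(A 0 0 + A 1 1) / 2, (A 0 0 - A 1 1) / (2 * X 0 0), ?_⟩
      have h1 : A 0 1 = 0 := by
        have : (2 * X 0 0) * A 0 1 = 0 := by rw [hy] at e01; linear_combination - e01
        simpa [h2, hx] using this
      have h3 : A 1 0 = 0 := by
        have : (2 * X 0 0) * A 1 0 = 0 := by rw [hz] at e10; linear_combination e10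
        simpa [h2, hx] using this
      ext i j
      fin_cases i <;> fin_cases j <;> simp [hy, hz, hd, h1, h3] <;> field_simp <;> ring
    · refine ⟨A 0 0 - A 1 0 / X 1 0 * X 0 0, A 1 0 / X 1 0, ?_⟩
      ext i j
      fin_cases i <;> fin_cases j <;> simp [hd] <;> field_simp
      · linear_combination e00
      · linear_combination e10
  · refine ⟨A 0 0 - A 0 1 / X 0 1 * X 0 0, A 0 1 / X 0 1, ?_⟩
    ext i j
    fin_cases i <;> fin_cases j <;> simp [hd] <;> field_simp
    · linear_combination -e00
    · linear_combination -e01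

theorem aux_mul {k : Type*} [Field k] (h2 : (2 : k) ≠ 0) (X A B : Matrix (Fin 2) (Fin 2) k)
    (hX : X ≠ 0) (ht : X.trace = 0) (hA : A * X = X * A) (hB : B * X = X * B) :
    A * B = B * A := by
  obtain ⟨s, c, rfl⟩ := aux_comm h2 X A hX ht hA
  simp [add_mul, mul_add, hB]

abbrev GG := Matrix.SpecialLinearGroup (Fin 2) (ZMod 5)

theorem aux_commutator {k G : Type*} [Field k] [Group G] (r : G →* GL (Fin 2) k)
    (X : Matrix (Fin 2) (Fin 2) k)
    (hX : ∀ g, ∃ c : k, (r g).val * X = c • (X * (r g).val)) (g a b : G)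
    (hg : g * (b * a) = a * b) :
    (r g).val * X = X * (r g).val := by
  obtain ⟨c, hc⟩ := hX a
  obtain ⟨d, hd⟩ := hX b
  have h1 : (r (a * b)).val * X = (c * d) • (X * (r (a * b)).val) := by
    simp only [map_mul, Units.val_mul]
    rw [mul_assoc, hd, mul_smul_comm, ← mul_assoc, hc, smul_mul_assoc, smul_smul, mul_assoc,
      mul_comm d c]
  have h2 : (r (b * a)).val * X = (c * d) • (X * (r (b * a)).val) := by
    simp only [map_mul, Units.val_mul]
    rw [mul_assoc, hc, mul_smul_comm, ← mul_assoc, hd, smul_mul_assoc, smul_smul, mul_assoc]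
  rw [← hg, map_mul, Units.val_mul, mul_assoc, h2] at h1
  have h3 : ((r g).val * X) * (r (b * a)).val = (X * (r g).val) * (r (b * a)).val := by
    by_cases hcd : c * d = 0
    · rw [hcd, zero_smul] at h2
      have : X = 0 := by
        have := congrArg (fun M => ((r (b * a))⁻¹).val * M) h2
        simpa [← mul_assoc] using this
      simp [this]
    · rw [mul_smul_comm] at h1
      have := smul_right_injective _ hcd h1
      simpa [mul_assoc] using this
  have := congrArg (fun M => M * ((r (b * a))⁻¹).val) h3
  simpa only [mul_assoc, Units.mul_inv, mul_one] using this

theorem aux_main {k : Type*} [Field k] (h2 : (2 : k) ≠ 0) (r : GG →* GL (Fin 2) k)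
    (hinj : Function.Injective r) (X : Matrix (Fin 2) (Fin 2) k) (h0 : X ≠ 0)
    (ht : X.trace = 0)
    (hX : ∀ g, ∃ c : k, (r g).val * X = c • (X * (r g).val)) : False := by
  let D : GG := ⟨!![2, 0; 0, 3], by decide⟩
  let T : GG := ⟨!![1, 1; 0, 1], by decide⟩
  let L : GG := ⟨!![1, 0; 1, 1], by decide⟩
  have hT : (r T).val * X = X * (r T).val :=
    aux_commutator r X hX T D (T * T) (by decide)
  have hL : (r L).val * X = X * (r L).val := by
    refine aux_commutator r X hX L D (L * L) ?_
    decide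
  have := aux_mul h2 X _ _ h0 ht hT hL
  rw [← Units.val_mul, ← Units.val_mul, ← map_mul, ← map_mul] at this
  exact absurd (hinj (Units.ext this)) (by decide)


/-- let `l > 5` be prime and `k` an algebraic extension of `𝔽_l`.  If
`r : SL₂(𝔽₅) → GL₂(k)` (the binary icosahedral group `2.A₅ ≅ SL₂(𝔽₅)`) is a faithful
representation with `k²` irreducible, then `ad⁰ r` — the representation on trace-zero
`2 × 2` matrices by conjugation — is irreducible. -/
theorem ad0_irreducible_of_binary_icosahedral (l : ℕ) [Fact l.Prime] (hl : 5 < l)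
    (k : Type*) [Field k] [Algebra (ZMod l) k] [Algebra.IsAlgebraic (ZMod l) k]
    (r : Matrix.SpecialLinearGroup (Fin 2) (ZMod 5) →* GL (Fin 2) k)
    (hinj : Function.Injective r)
    (hirr : ∀ U : Submodule k (Fin 2 → k),
      (∀ v ∈ U, ∀ g : Matrix.SpecialLinearGroup (Fin 2) (ZMod 5), (r g).val.mulVec v ∈ U) →
      U = ⊥ ∨ U = ⊤) :
    ∀ U : Submodule k (Matrix (Fin 2) (Fin 2) k),
      U ≤ LinearMap.ker (Matrix.traceLinearMap (Fin 2) k k) →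
      (∀ X ∈ U, ∀ g : Matrix.SpecialLinearGroup (Fin 2) (ZMod 5),
        (r g).val * X * ((r g)⁻¹).val ∈ U) →
      U = ⊥ ∨ U = LinearMap.ker (Matrix.traceLinearMap (Fin 2) k k) := by
  have h2 : (2 : k) ≠ 0 := by
    have : CharP k l := charP_of_injective_algebraMap (algebraMap (ZMod l) k).injective l
    intro h
    have h' : ((2 : ℕ) : k) = 0 := by exact_mod_cast h
    rw [CharP.cast_eq_zero_iff k l] at h'
    have := Nat.le_of_dvd (by norm_num) h'
    omega
  intro U hU hinv
  have htr : ∀ X ∈ U, X.trace = 0 := fun X hX => by simpa using hU hX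
  by_cases hb : U = ⊥
  · exact Or.inl hb
  right
  have conj : ∀ (X Y : Matrix (Fin 2) (Fin 2) k) (g : GG),
      (r g).val * X * ((r g)⁻¹).val = Y → (r g).val * X = Y * (r g).val := by
    intro X Y g h
    rw [← h, mul_assoc, Units.inv_mul, mul_one]
  obtain ⟨X, hXU, hX0⟩ := Submodule.exists_mem_ne_zero_of_ne_bot hb
  have hspan : ∃ Y ∈ U, ∀ c : k, Y ≠ c • X := by
    by_contra! hcon
    refine aux_main h2 r hinj X hX0 (htr X hXU) fun g => ?_
    obtain ⟨c, hc⟩ := hcon _ (hinv X hXU g)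
    exact ⟨c, by rw [conj _ _ _ hc, smul_mul_assoc]⟩
  obtain ⟨Y, hYU, hY⟩ := hspan
  have hZ0 : X * Y - Y * X ≠ 0 := by
    intro h
    obtain ⟨s, c, hs⟩ := aux_comm h2 X Y hX0 (htr X hXU) (sub_eq_zero.mp h).symm
    have h3 := htr Y hYU
    rw [hs] at h3
    simp [htr X hXU, h2] at h3
    exact hY c (by simpa [h3] using hs)
  have hspan2 : ∃ W ∈ U, ∀ c d : k, W ≠ c • X + d • Y := by
    by_contra! hcon
    refine aux_main h2 r hinj (X * Y - Y * X) hZ0 (by simp [Matrix.trace_mul_comm X Y])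
      fun g => ?_
    obtain ⟨a, b, h1⟩ := hcon _ (hinv X hXU g)
    obtain ⟨c, d, h3⟩ := hcon _ (hinv Y hYU g)
    have h1 := conj _ _ _ h1
    have h3 := conj _ _ _ h3
    refine ⟨a * d - b * c, ?_⟩
    rw [mul_sub, ← mul_assoc, h1, mul_assoc, h3, ← mul_assoc, ← mul_assoc, h3, mul_assoc _ _ X,
      h1, ← mul_assoc, ← sub_mul, ← smul_mul_assoc]
    congr 1
    simp only [add_mul, mul_add, smul_mul_assoc, mul_smul_comm, smul_add, smul_sub, smul_smul,
      sub_smul]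
    rw [mul_comm c a, mul_comm d a, mul_comm c b, mul_comm d b]
    abel
  obtain ⟨W, hWU, hW⟩ := hspan2
  have hli : LinearIndependent k (![⟨X, hXU⟩, ⟨Y, hYU⟩, ⟨W, hWU⟩] : Fin 3 → U) := by
    rw [Fintype.linearIndependent_iff]
    intro g hg
    have hg' := congrArg (fun u : U => (u : Matrix (Fin 2) (Fin 2) k)) hg
    simp [Fin.sum_univ_three] at hg'
    have g2 : g 2 = 0 := by
      by_contra h
      apply hW (-(g 2)⁻¹ * g 0) (-(g 2)⁻¹ * g 1)
      have h4 : g 2 • W = -(g 0 • X + g 1 • Y) := by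
        rw [eq_neg_iff_add_eq_zero, add_comm]; exact hg'
      rw [← inv_smul_smul₀ h W, h4]
      simp [mul_smul]
      abel
    rw [g2, zero_smul, add_zero] at hg'
    have g1 : g 1 = 0 := by
      by_contra h
      apply hY (-(g 1)⁻¹ * g 0)
      have h4 : g 1 • Y = -(g 0 • X) := by
        rw [eq_neg_iff_add_eq_zero, add_comm]; exact hg'
      rw [← inv_smul_smul₀ h Y, h4]
      simp [mul_smul]
    rw [g1, zero_smul, add_zero] at hg'
    have g0 : g 0 = 0 := by simpa [hX0] using hg'
    intro i
    fin_cases i <;> simp [g0, g1, g2]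
  have h3 := hli.fintype_card_le_finrank
  have h4 : Module.finrank k (LinearMap.ker (Matrix.traceLinearMap (Fin 2) k k)) <
      Module.finrank k (Matrix (Fin 2) (Fin 2) k) := by
    apply Submodule.finrank_lt
    intro h
    have : (1 : Matrix (Fin 2) (Fin 2) k) ∈ LinearMap.ker (Matrix.traceLinearMap (Fin 2) k k) := by
      rw [h]; trivial
    simp [h2] at this
  rw [Module.finrank_matrix] at h4
  simp at h3 h4
  exact Submodule.eq_of_le_of_finrank_le hU (by omega)
end

section
/- Let l > 5 be a prime and k an algebraic extension of F_l. Let G = SL_2(F_3) (the binary tetrahedral group 2.A_4) and let r : G → GL_2(k) be an injective group homomorphism such that k^2 is irreducible as a k[G]-module via r. Then the representation ad^0 r of G on the trace-zero 2-by-2 matrices sl_2(k), with g acting by conjugation by r(g), is irreducible. -/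
open Matrix


abbrev qI : Matrix.SpecialLinearGroup (Fin 2) (ZMod 3) := ⟨!![0,-1;1,0], by decide⟩
abbrev qJ : Matrix.SpecialLinearGroup (Fin 2) (ZMod 3) := ⟨!![1,1;1,-1], by decide⟩
abbrev qC : Matrix.SpecialLinearGroup (Fin 2) (ZMod 3) := ⟨!![1,1;0,1], by decide⟩
abbrev qZ : Matrix.SpecialLinearGroup (Fin 2) (ZMod 3) := ⟨!![-1,0;0,-1], by decide⟩

lemma q_comm (g : Matrix.SpecialLinearGroup (Fin 2) (ZMod 3)) : qZ * g = g * qZ := by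
  ext i j
  fin_cases i <;> fin_cases j <;> simp [Matrix.mul_apply, Fin.sum_univ_two]

lemma q_zz : qZ * qZ = 1 := by decide
lemma q_z1 : qZ ≠ 1 := by decide
lemma q_ii : qI * qI = qZ := by decide
lemma q_jj : qJ * qJ = qZ := by decide
lemma q_ij : qI * qJ = qZ * (qJ * qI) := by decide
lemma q_ci : qC * qI * qC⁻¹ = qJ := by decide
lemma q_cj : qC * qJ * qC⁻¹ = qI * qJ := by decide
lemma q_ck : qC * (qI * qJ) * qC⁻¹ = qI := by decide

lemma anti2 {k : Type*} [Field k] (A B : Matrix (Fin 2) (Fin 2) k) (hA : A.trace = 0)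
    (hB : B.trace = 0) : A * B + B * A = (A * B).trace • (1 : Matrix (Fin 2) (Fin 2) k) := by
  rw [Matrix.trace_fin_two] at hA hB
  have h1 : A 1 1 = - A 0 0 := by linear_combination hA
  have h2 : B 1 1 = - B 0 0 := by linear_combination hB
  ext i j
  fin_cases i <;> fin_cases j <;>
    simp [Matrix.mul_apply, Fin.sum_univ_two, Matrix.trace_fin_two, h1, h2] <;> ring

lemma conj2 {k : Type*} [Field k] (X I : Matrix (Fin 2) (Fin 2) k) (hX : X.trace = 0)
    (hI : I.trace = 0) (hII : I * I = -1) : X - I * X * I = -((X * I).trace • I) := by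
  have h := anti2 X I hX hI
  have h' : I * X = (X * I).trace • (1 : Matrix (Fin 2) (Fin 2) k) - X * I := by
    rw [← h]; abel
  rw [h', sub_mul, mul_assoc, hII]
  simp

lemma zero_of {k : Type*} [Field k] (h2 : (2 : k) ≠ 0) (X I J : Matrix (Fin 2) (Fin 2) k)
    (hX : X.trace = 0) (hI : I.trace = 0) (hJ : J.trace = 0) (hK : (I * J).trace = 0)
    (hII : I * I = -1) (hJJ : J * J = -1)
    (a : (X * I).trace = 0) (b : (X * J).trace = 0) (c : (X * (I * J)).trace = 0) : X = 0 := by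
  have h1 := anti2 X I hX hI
  have h3 := anti2 X J hX hJ
  have h4 := anti2 X (I * J) hX hK
  rw [a, zero_smul] at h1
  rw [b, zero_smul] at h3
  rw [c, zero_smul] at h4
  have e1 : X * I = - (I * X) := eq_neg_of_add_eq_zero_left h1
  have e2 : X * J = - (J * X) := eq_neg_of_add_eq_zero_left h3
  have e3 : X * (I * J) = I * J * X := by
    rw [← mul_assoc, e1, neg_mul, mul_assoc, e2, mul_neg, neg_neg, mul_assoc]
  have e4 : (2 : k) • (X * (I * J)) = 0 := by
    rw [two_smul]; nth_rewrite 2 [e3]; exact h4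
  have e5 : X * (I * J) = 0 := (smul_eq_zero.mp e4).resolve_left h2
  have e6 : X * (I * J) * J * I = X := by
    calc X * (I * J) * J * I = X * (I * (J * J) * I) := by simp only [mul_assoc]
      _ = X := by rw [hJJ]; simp [hII]
  rw [← e6, e5]; simp

/-- let `l > 5` be prime and `k` an algebraic extension of `𝔽_l`.  If
`r : SL₂(𝔽₃) → GL₂(k)` (the binary tetrahedral group `2.A₄ ≅ SL₂(𝔽₃)`) is a faithful
representation with `k²` irreducible, then `ad⁰ r` — the representation on trace-zero
`2 × 2` matrices by conjugation — is irreducible. -/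
theorem ad0_irreducible_of_binary_tetrahedral (l : ℕ) [Fact l.Prime] (hl : 5 < l)
    (k : Type*) [Field k] [Algebra (ZMod l) k] [Algebra.IsAlgebraic (ZMod l) k]
    (r : Matrix.SpecialLinearGroup (Fin 2) (ZMod 3) →* GL (Fin 2) k)
    (hinj : Function.Injective r)
    (hirr : ∀ U : Submodule k (Fin 2 → k),
      (∀ v ∈ U, ∀ g : Matrix.SpecialLinearGroup (Fin 2) (ZMod 3), (r g).val.mulVec v ∈ U) →
      U = ⊥ ∨ U = ⊤) :
    ∀ U : Submodule k (Matrix (Fin 2) (Fin 2) k),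
      U ≤ LinearMap.ker (Matrix.traceLinearMap (Fin 2) k k) →
      (∀ X ∈ U, ∀ g : Matrix.SpecialLinearGroup (Fin 2) (ZMod 3),
        (r g).val * X * ((r g)⁻¹).val ∈ U) →
      U = ⊥ ∨ U = LinearMap.ker (Matrix.traceLinearMap (Fin 2) k k) := by
  have h2 : (2 : k) ≠ 0 := by
    have : CharP k l := charP_of_injective_algebraMap (algebraMap (ZMod l) k).injective l
    intro h
    have : ((2 : ℕ) : k) = 0 := by exact_mod_cast h
    rw [CharP.cast_eq_zero_iff k l] at this
    have := Nat.le_of_dvd (by norm_num) this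
    omega
  have hm : ∀ a b, (r (a * b)).val = (r a).val * (r b).val := fun a b => by simp
  have hZ : (r qZ).val = -1 := by
    have hzz : (r qZ).val * (r qZ).val = 1 := by rw [← hm, q_zz]; simp
    rcases hirr (LinearMap.ker (Matrix.mulVecLin ((r qZ).val - 1))) (by
      intro v hv g
      simp only [LinearMap.mem_ker, Matrix.mulVecLin_apply, Matrix.sub_mulVec,
        Matrix.one_mulVec, sub_eq_zero] at hv ⊢
      rw [Matrix.mulVec_mulVec, ← hm, q_comm, hm, ← Matrix.mulVec_mulVec, hv]) with h | h
    · have h0 : ((r qZ).val + 1) = 0 := by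
        apply Matrix.ext_of_mulVec_single
        intro i
        have : ((r qZ).val + 1) *ᵥ (Pi.single i 1) ∈
            LinearMap.ker (Matrix.mulVecLin ((r qZ).val - 1)) := by
          rw [LinearMap.mem_ker, Matrix.mulVecLin_apply, Matrix.mulVec_mulVec]
          have : ((r qZ).val - 1) * ((r qZ).val + 1) = 0 := by
            rw [sub_mul, mul_add, hzz]; simp [add_comm]
          rw [this, Matrix.zero_mulVec]
        rw [h, Submodule.mem_bot] at this
        rw [this, Matrix.zero_mulVec]; try rfl
      exact eq_neg_of_add_eq_zero_left h0
    · exfalso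
      apply q_z1
      apply hinj
      rw [map_one]
      apply Units.ext
      rw [LinearMap.ker_eq_top] at h
      have h0 : (r qZ).val - 1 = 0 := by
        apply Matrix.ext_of_mulVec_single
        intro i
        have := LinearMap.congr_fun h (Pi.single i 1)
        rw [Matrix.mulVecLin_apply] at this
        rw [this, Matrix.zero_mulVec]; try rfl
      exact sub_eq_zero.mp h0
  have hII : (r qI).val * (r qI).val = -1 := by rw [← hm, q_ii, hZ]
  have hJJ : (r qJ).val * (r qJ).val = -1 := by rw [← hm, q_jj, hZ]
  have hIJ : (r qI).val * (r qJ).val = -((r qJ).val * (r qI).val) := by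
    rw [← hm, q_ij, hm, hm, hZ]; simp
  have inv : ∀ g, (r g).val * (r g).val = -1 → ((r g)⁻¹).val = -(r g).val := by
    intro g hg
    rw [Units.inv_eq_of_mul_eq_one_right (u := r g) (a := -(r g).val)]
    rw [mul_neg, hg, neg_neg]
  have hCI : (r qC).val * (r qI).val * ((r qC)⁻¹).val = (r qJ).val := by
    rw [← map_inv, ← hm, ← hm, q_ci]
  have hCJ : (r qC).val * (r qJ).val * ((r qC)⁻¹).val = (r qI).val * (r qJ).val := by
    rw [← map_inv, ← hm, ← hm, q_cj, hm]
  have hCK : (r qC).val * ((r qI).val * (r qJ).val) * ((r qC)⁻¹).val = (r qI).val := by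
    rw [← map_inv, ← hm, ← hm, ← hm, q_ck]
  have hKK : (r (qI * qJ)).val * (r (qI * qJ)).val = -1 := by
    rw [hm]
    nth_rewrite 2 [hIJ]
    rw [mul_neg, mul_assoc, ← mul_assoc (r qJ).val, hJJ]
    simp [hII]
  have iI := inv _ hII
  have iJ := inv _ hJJ
  have iK := inv _ hKK
  intro U hU hinv
  have gK := fun X hX => hinv X hX (qI * qJ)
  have gI := fun X hX => hinv X hX qI
  have gJ := fun X hX => hinv X hX qJ
  have gC := fun X hX => hinv X hX qC
  rw [iI] at gI
  rw [iJ] at gJ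
  rw [iK] at gK
  rw [hm] at gK hKK
  generalize (r qI).val = I at *
  generalize (r qJ).val = J at *
  have tz : ∀ t : k, t = -t → t = 0 := by
    intro t ht
    have : 2 * t = 0 := by linear_combination ht
    exact (mul_eq_zero.mp this).resolve_left h2
  have tK : (I * J).trace = 0 := by
    apply tz
    nth_rewrite 1 [hIJ]
    rw [Matrix.trace_neg, Matrix.trace_mul_comm]
  have tI : I.trace = 0 := by
    rw [← hCK, Matrix.trace_mul_comm, ← mul_assoc]
    simp [tK]
  have tJ : J.trace = 0 := by
    rw [← hCI, Matrix.trace_mul_comm, ← mul_assoc]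
    simp [tI]
  have key : ∀ E : Matrix (Fin 2) (Fin 2) k, E.trace = 0 → E * E = -1 →
      (∀ X ∈ U, E * X * (-E) ∈ U) → ∀ X ∈ U, (X * E).trace ≠ 0 → E ∈ U := by
    intro E hE hEE hEU X hX hne
    have hX0 : X.trace = 0 := by simpa using hU hX
    have h := U.add_mem hX (hEU X hX)
    rw [mul_neg, ← sub_eq_add_neg, conj2 X E hX0 hE hEE] at h
    exact (U.smul_mem_iff hne).mp (U.neg_mem_iff.mp h)
  have all : I ∈ U → U = LinearMap.ker (Matrix.traceLinearMap (Fin 2) k k) := by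
    intro hIU
    have hJU : J ∈ U := by rw [← hCI]; exact gC _ hIU
    have hKU : I * J ∈ U := by rw [← hCJ]; exact gC _ hJU
    apply le_antisymm hU
    intro Y hY
    have hY0 : Y.trace = 0 := by simpa using hY
    have t1 : (1 : Matrix (Fin 2) (Fin 2) k).trace = 2 := by simp
    have tIK : (I * (I * J)).trace = 0 := by rw [← mul_assoc, hII]; simp [tJ]
    have tKJ : (I * J * J).trace = 0 := by rw [mul_assoc, hJJ]; simp [tI]
    have tJI : (J * I).trace = 0 := by rw [Matrix.trace_mul_comm, tK]
    have tJK : (J * (I * J)).trace = 0 := by rw [Matrix.trace_mul_comm, tKJ]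
    have tKI : (I * J * I).trace = 0 := by rw [Matrix.trace_mul_comm, tIK]
    have hz := zero_of h2 (Y + ((Y * I).trace / 2) • I + ((Y * J).trace / 2) • J
      + ((Y * (I * J)).trace / 2) • (I * J)) I J
      (by simp [hY0, tI, tJ, tK]) tI tJ tK hII hJJ
      (by simp only [add_mul, Matrix.trace_add, smul_mul_assoc, Matrix.trace_smul, hII, tJI, tKI,
            Matrix.trace_neg, t1, smul_eq_mul]; field_simp; ring)
      (by simp only [add_mul, Matrix.trace_add, smul_mul_assoc, Matrix.trace_smul, hJJ, tK, tKJ,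
            Matrix.trace_neg, t1, smul_eq_mul]; field_simp; ring)
      (by simp only [add_mul, Matrix.trace_add, smul_mul_assoc, Matrix.trace_smul, hKK, tIK, tJK,
            Matrix.trace_neg, t1, smul_eq_mul]; field_simp; ring)
    have m1 := U.smul_mem ((Y * I).trace / 2) hIU
    have m2 := U.smul_mem ((Y * J).trace / 2) hJU
    have m3 := U.smul_mem ((Y * (I * J)).trace / 2) hKU
    have hz' := U.zero_mem
    rw [← hz] at hz'
    rwa [U.add_mem_iff_left m3, U.add_mem_iff_left m2, U.add_mem_iff_left m1] at hz'
  by_cases hb : U = ⊥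
  · exact Or.inl hb
  right
  obtain ⟨X, hX, hX0⟩ := U.ne_bot_iff.mp hb
  have hXt : X.trace = 0 := by simpa using hU hX
  by_cases a : (X * I).trace = 0
  · by_cases b : (X * J).trace = 0
    · by_cases c : (X * (I * J)).trace = 0
      · exact absurd (zero_of h2 X I J hXt tI tJ tK hII hJJ a b c) hX0
      · have := key _ tK hKK gK X hX c
        apply all; rw [← hCK]; exact gC _ this
    · have := key _ tJ hJJ gJ X hX b
      have := gC _ this
      rw [hCJ] at this
      apply all; rw [← hCK]; exact gC _ this
  · exact all (key _ tI hII gI X hX a)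
end
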